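/- Let K be a congruence function field over 𝔽₂ with genus g_K = 4 and class number h_K = 1. Then every proper intermediate field E with 𝔽₂ ⊊ E ⊊ K such that K/E is separable has genus 0. -/

import Mathlib

set_option synthInstance.maxHeartbeats 1000000
set_option maxHeartbeats 1000000

open scoped Classical

noncomputable section

namespace CFF

variable (F : Type*) [Field F]

/-- `K` is a (congruence) function field in one variable over `F`: a finitely
generated field extension of transcendence degree one. -/
def IsFunctionField (K : Type*) [Field K] [Algebra F K] : Prop :=
  ∃ x : K, Transcendental F x ∧
    FiniteDimensional (IntermediateField.adjoin F {x}) K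

/-- The exact field of constants of `K` is `F`: every element of `K` algebraic
over `F` already lies in `F`. -/
def HasExactConstants (K : Type*) [Field K] [Algebra F K] : Prop :=
  ∀ a : K, IsAlgebraic F a → a ∈ (algebraMap F K).range

variable (K : Type*) [Field K] [Algebra F K]

/-- A place of the function field `K/F`: a proper valuation subring of `K`
containing the constants. -/
def IsPlace (O : ValuationSubring K) : Prop :=
  O ≠ ⊤ ∧ ∀ c : F, algebraMap F K c ∈ O

/-- The type of places (prime divisors) of `K/F`. -/
def Place := {O : ValuationSubring K // IsPlace F K O}

variable {K}

/-- `𝔪`-adic order of an element of a valuation subring. -/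
def ordAux (O : ValuationSubring K) (x : O) : ℕ :=
  sSup {n : ℕ | x ∈ IsLocalRing.maximalIdeal O ^ n}

/-- The order (normalized valuation) of `f ∈ K` at a valuation subring `O`. -/
def ordAt (O : ValuationSubring K) (f : K) : ℤ :=
  if h : f ∈ O then (ordAux O ⟨f, h⟩ : ℤ)
  else -(ordAux O ⟨f⁻¹, (O.mem_or_inv_mem f).resolve_left h⟩ : ℤ)

/-- The constants embed into (the valuation ring of) any place. -/
def constHom (p : Place F K) : F →+* p.1 :=
  (algebraMap F K).codRestrict p.1.toSubring fun c => p.2.2 c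

/-- The map from the constants to the residue field of a place. -/
def residueHom (p : Place F K) : F →+* IsLocalRing.ResidueField p.1 :=
  (IsLocalRing.residue (p.1 : ValuationSubring K)).comp (constHom F p)

/-- The degree of a place: the dimension of its residue field over the
constants. -/
def placeDegree (p : Place F K) : ℕ :=
  letI := (residueHom F p).toAlgebra
  Module.finrank F (IsLocalRing.ResidueField p.1)

variable (K)

/-- The group of divisors of `K/F`. -/
abbrev Divisor := Place F K →₀ ℤ

/-- The degree homomorphism on divisors. -/
def degHom : Divisor F K →+ ℤ :=
  Finsupp.liftAddHom fun p => AddMonoidHom.mulRight (placeDegree F p : ℤ)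

variable {K}

/-- The Riemann-Roch space `L(D)` of a divisor `D` (the span coincides with the
set of `f` with `div f ≥ -D`, which is an `F`-subspace). -/
def RRspace (D : Divisor F K) : Submodule F K :=
  Submodule.span F {f : K | ∀ p : Place F K, 0 ≤ D p + ordAt p.1 f}

/-- `ℓ(D)`, the dimension of the Riemann-Roch space of `D`. -/
def ell (D : Divisor F K) : ℕ := Module.finrank F (RRspace F D)

variable (K)

/-- The genus of `K/F`, via Riemann's theorem: `g = max_D (deg D + 1 - ℓ(D))`. -/
def genus : ℕ :=
  sSup {g : ℕ | ∃ D : Divisor F K, (g : ℤ) = degHom F K D + 1 - ell F D}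

/-- The subgroup of divisors of degree zero. -/
def zeroDivisors : AddSubgroup (Divisor F K) := (degHom F K).ker

/-- The subgroup of principal divisors. -/
def principalDivisors : AddSubgroup (Divisor F K) :=
  AddSubgroup.closure
    {D : Divisor F K | ∃ f : K, f ≠ 0 ∧ ∀ p : Place F K, D p = ordAt p.1 f}

/-- The group of divisor classes of degree zero of `K/F`. -/
def ClassGroup0 :=
  zeroDivisors F K ⧸ (principalDivisors F K).addSubgroupOf (zeroDivisors F K)

instance : AddGroup (ClassGroup0 F K) := by
  unfold ClassGroup0; infer_instance

/-- The class number of `K/F`: the order of the group of divisor classes of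
degree zero. -/
def classNumber : ℕ := Nat.card (ClassGroup0 F K)

section Extension

variable {k L : Type*} [Field k] [Field L] [Algebra F k] [Algebra F L] [Algebra k L]

/-- A place `P` of `L` lies over the place `p` of `k`. -/
def LiesOver (P : Place F L) (p : Place F k) : Prop :=
  P.1.comap (algebraMap k L) = p.1

variable (L)

/-- `p` is inert in `L/k`: there is a unique place of `L` above `p`, and its
degree is `[L:k] · deg p` (i.e. the residue degree is `[L:k]`, so `e = 1`). -/
def IsInert (p : Place F k) : Prop :=
  ∃ P : Place F L, LiesOver F P p ∧
    placeDegree F P = Module.finrank k L * placeDegree F p ∧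
    ∀ P' : Place F L, LiesOver F P' p → P' = P

/-- `p` splits completely in `L/k`: there are `[L:k]` places above `p`, each of
the same degree as `p`. -/
def SplitsCompletely (p : Place F k) : Prop :=
  Nat.card {P : Place F L // LiesOver F P p} = Module.finrank k L ∧
    ∀ P : Place F L, LiesOver F P p → placeDegree F P = placeDegree F p

/-- `p` is totally ramified in `L/k`: there is a unique place above `p`, of the
same degree (so `f = 1` and `e = [L:k]`). -/
def IsTotallyRamified (p : Place F k) : Prop :=
  ∃ P : Place F L, LiesOver F P p ∧ placeDegree F P = placeDegree F p ∧
    ∀ P' : Place F L, LiesOver F P' p → P' = P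

/-- `p` is unramified in `L/k`: at every place above `p` the orders of elements
of `k` are preserved (`e = 1`). -/
def IsUnramifiedAt (p : Place F k) : Prop :=
  ∀ P : Place F L, LiesOver F P p →
    ∀ x : k, ordAt P.1 (algebraMap k L x) = ordAt p.1 x

end Extension

section Rational

/-- The finite place of `𝔽₂(T)` corresponding to an irreducible polynomial `P`:
the place contains all polynomials and `P` lies in its maximal ideal. -/
def IsFinitePlaceOf (p : Place (ZMod 2) (RatFunc (ZMod 2)))
    (P : Polynomial (ZMod 2)) : Prop :=
  (∀ g : Polynomial (ZMod 2), algebraMap (Polynomial (ZMod 2)) (RatFunc (ZMod 2)) g ∈ p.1) ∧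
    (algebraMap (Polynomial (ZMod 2)) (RatFunc (ZMod 2)) P)⁻¹ ∉ p.1

/-- The infinite place `𝔭_∞` of `𝔽₂(T)`: the place where `T` has a pole. -/
def IsInfinitePlace (p : Place (ZMod 2) (RatFunc (ZMod 2))) : Prop :=
  RatFunc.X ∉ p.1

end Rational

end CFF

namespace CFF

set_option linter.unusedSectionVars false

local notation "𝔽" => ZMod 2

open IntermediateField Polynomial

/-- A congruence function field over `𝔽₂` with exact field of constants `𝔽₂`. -/
class CongFF (K : Type) [Field K] [Algebra 𝔽 K] : Prop where
  ff : IsFunctionField 𝔽 K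
  const : HasExactConstants 𝔽 K

section Basic

variable {K : Type} [Field K] [Algebra 𝔽 K]

lemma zmod_two_cases (c : 𝔽) : c = 0 ∨ c = 1 := by
  revert c; decide

lemma add_self_K (a : K) : a + a = 0 := by
  have h2 : (2 : K) = 0 := by
    have := congrArg (algebraMap 𝔽 K) (show (2 : 𝔽) = 0 by decide)
    rwa [map_ofNat, map_zero] at this
  rw [← two_mul, h2, zero_mul]

lemma charP_K (K : Type) [Field K] [Algebra 𝔽 K] : CharP K 2 :=
  charP_of_injective_algebraMap (algebraMap 𝔽 K).injective 2

lemma neg_K (a : K) : -a = a := by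
  rw [neg_eq_iff_add_eq_zero, add_self_K]

lemma sub_K (a b : K) : a - b = a + b := by rw [sub_eq_add_neg, neg_K]

lemma mem_subring {R : Type*} [SetLike R K] [SubringClass R K] (O : R) (c : 𝔽) :
    algebraMap 𝔽 K c ∈ O := by
  rcases zmod_two_cases c with rfl | rfl
  · rw [map_zero]; exact zero_mem _
  · rw [map_one]; exact one_mem _

lemma transcendental_iff [CongFF K] {z : K} : Transcendental 𝔽 z ↔ z ≠ 0 ∧ z ≠ 1 := by
  constructor
  · intro h
    refine ⟨?_, ?_⟩
    · rintro rfl; exact h isAlgebraic_zero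
    · rintro rfl; exact h isAlgebraic_one
  · rintro ⟨h0, h1⟩ h
    obtain ⟨c, hc⟩ := CongFF.const z h
    rcases zmod_two_cases c with rfl | rfl
    · exact h0 (by rw [← hc, map_zero])
    · exact h1 (by rw [← hc, map_one])

lemma exists_transcendental (K : Type) [Field K] [Algebra 𝔽 K] [CongFF K] :
    ∃ x : K, Transcendental 𝔽 x := by
  obtain ⟨x, hx, -⟩ := CongFF.ff (K := K)
  exact ⟨x, hx⟩

theorem finite_over_adjoin [CongFF K] {z : K} (hz : Transcendental 𝔽 z) :
    FiniteDimensional 𝔽⟮z⟯ K := by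
  obtain ⟨x, hx, hfin⟩ := CongFF.ff (K := K)
  have hle : Algebra.trdeg 𝔽 K ≤ Cardinal.mk Unit := by
    open scoped IntermediateField.algebraAdjoinAdjoin in
    have : Algebra.IsAlgebraic (Algebra.adjoin 𝔽 ({x} : Set K)) K :=
      Algebra.IsAlgebraic.trans _ 𝔽⟮x⟯ _
    have := Algebra.IsAlgebraic.trdeg_le_cardinalMk 𝔽 ({x} : Set K)
    simpa using this
  have hb : IsTranscendenceBasis 𝔽 (fun _ : Unit => z) :=
    (algebraicIndependent_unique_type_iff.2 hz).isTranscendenceBasis_of_trdeg_le_of_finite hle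
  have halg := hb.isAlgebraic_field
  rw [Set.range_const] at halg
  have h1 : Algebra.EssFiniteType 𝔽 𝔽⟮x⟯ :=
    essFiniteType_iff.2 ⟨{x}, by simp⟩
  have h2 : Algebra.EssFiniteType 𝔽 K := Algebra.EssFiniteType.comp 𝔽 𝔽⟮x⟯ K
  have h3 : Algebra.EssFiniteType 𝔽⟮z⟯ K := Algebra.EssFiniteType.of_comp 𝔽 _ _
  obtain ⟨s, hs⟩ := fg_top 𝔽⟮z⟯ K
  have := finiteDimensional_adjoin (K := 𝔽⟮z⟯) (S := (s : Set K))
    (fun y _ => (halg.isAlgebraic y).isIntegral)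
  rw [hs] at this
  exact Module.Finite.equiv (IntermediateField.topEquiv (F := 𝔽⟮z⟯) (E := K)).toLinearEquiv

/-- The degree of `K` over `𝔽₂(z)`. -/
def dg (z : K) : ℕ := Module.finrank 𝔽⟮z⟯ K

/-- A relation over `𝔽₂(z)` can be cleared to a polynomial relation, not divisible by `z`. -/
lemma poly_relation {z : K} (hz : Transcendental 𝔽 z) {ι : Type*} [Fintype ι] (r : ι → K)
    (h : ¬ LinearIndependent 𝔽⟮z⟯ r) :
    ∃ p : ι → 𝔽[X], (∃ i, (p i).coeff 0 ≠ 0) ∧ ∑ i, aeval z (p i) * r i = 0 := by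
  open scoped IntermediateField.algebraAdjoinAdjoin in
  rw [← LinearIndependent.iff_fractionRing (Algebra.adjoin 𝔽 ({z} : Set K)) 𝔽⟮z⟯,
    Fintype.not_linearIndependent_iff] at h
  obtain ⟨g, hg, i, hi⟩ := h
  have hex : ∃ n : ℕ, ∃ p : ι → 𝔽[X], ∃ i, (p i).coeff n ≠ 0 ∧ ∑ i, aeval z (p i) * r i = 0 := by
    have hp : ∀ j, ∃ q : 𝔽[X], aeval z q = (g j : K) := fun j => by
      exact (Algebra.adjoin_singleton_eq_range_aeval 𝔽 z).le (g j).2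
    choose p hp using hp
    have hpi : p i ≠ 0 := by
      rintro h0
      apply hi
      have := hp i
      rw [h0, map_zero] at this
      exact Subtype.ext this.symm
    obtain ⟨n, hn⟩ : ∃ n, (p i).coeff n ≠ 0 := by
      by_contra hcon
      push Not at hcon
      exact hpi (Polynomial.ext (by simpa using hcon))
    refine ⟨n, p, i, hn, ?_⟩
    rw [← hg]
    exact Finset.sum_congr rfl fun j _ => by rw [hp j]; rfl
  have hz0 : z ≠ 0 := by rintro rfl; exact hz isAlgebraic_zero
  obtain ⟨p, i, hn, hp⟩ := Nat.find_spec hex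
  rcases Nat.eq_zero_or_pos (Nat.find hex) with h0 | hpos
  · rw [h0] at hn
    exact ⟨p, ⟨i, hn⟩, hp⟩
  · exfalso
    obtain ⟨m, hm⟩ := Nat.exists_eq_succ_of_ne_zero hpos.ne'
    have hdiv : ∀ j, ∃ q, p j = X * q := by
      intro j
      have : (p j).coeff 0 = 0 := by
        by_contra hc
        exact Nat.find_min hex hpos ⟨p, j, hc, hp⟩
      exact X_dvd_iff.2 this
    choose q hq using hdiv
    refine Nat.find_min hex (m := m) (by omega) ⟨q, i, ?_, ?_⟩
    · rw [hm, hq i, Nat.succ_eq_add_one, coeff_X_mul] at hn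
      exact hn
    · have : z * ∑ j, aeval z (q j) * r j = 0 := by
        rw [← hp, Finset.mul_sum]
        refine Finset.sum_congr rfl fun j _ => ?_
        rw [hq j, map_mul, aeval_X, mul_assoc]
      exact (mul_eq_zero.1 this).resolve_left hz0

lemma aeval_mul_mem {z : K} {M : Submodule 𝔽 K} (hM : ∀ m ∈ M, z * m ∈ M) (p : 𝔽[X]) {m : K}
    (hm : m ∈ M) : aeval z p * m ∈ M := by
  induction p using Polynomial.induction_on' with
  | add p q hp hq => rw [map_add, add_mul]; exact M.add_mem hp hq
  | monomial n a =>
    rw [aeval_monomial, mul_assoc, ← Algebra.smul_def]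
    refine M.smul_mem _ ?_
    clear a
    induction n with
    | zero => simpa using hm
    | succ n ih => rw [pow_succ', mul_assoc]; exact hM _ ih

/-- Elements of a `z`-stable space which are independent modulo `z` are independent over
`𝔽₂(z)`. -/
lemma linearIndependent_of_mod {z : K} (hz : Transcendental 𝔽 z) {M : Submodule 𝔽 K}
    (hM : ∀ m ∈ M, z * m ∈ M) {ι : Type*} [Fintype ι] (r : ι → K) (hr : ∀ i, r i ∈ M)
    (hind : ∀ c : ι → 𝔽, (∃ m ∈ M, ∑ i, algebraMap 𝔽 K (c i) * r i = z * m) → ∀ i, c i = 0) :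
    LinearIndependent 𝔽⟮z⟯ r := by
  by_contra h
  obtain ⟨p, ⟨i, hi⟩, hp⟩ := poly_relation hz r h
  refine hi (hind (fun j => (p j).coeff 0) ⟨-∑ j, aeval z ((p j).divX) * r j, ?_, ?_⟩ i)
  · exact M.neg_mem (M.sum_mem fun j _ => aeval_mul_mem hM _ (hr j))
  · have : ∀ j, aeval z (p j) * r j =
        z * (aeval z ((p j).divX) * r j) + algebraMap 𝔽 K ((p j).coeff 0) * r j := by
      intro j
      conv_lhs => rw [← Polynomial.X_mul_divX_add (p j)]
      rw [map_add, map_mul, aeval_X, aeval_C]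
      ring
    rw [Finset.sum_congr rfl (fun j _ => this j), Finset.sum_add_distrib, ← Finset.mul_sum] at hp
    rw [mul_neg, eq_neg_iff_add_eq_zero, add_comm]
    exact hp

/-- The space `z * M`. -/
def mulSub (z : K) (M : Submodule 𝔽 K) : Submodule 𝔽 K := M.map (LinearMap.mulLeft 𝔽 z)

lemma mem_mulSub {z : K} {M : Submodule 𝔽 K} {y : K} : y ∈ mulSub z M ↔ ∃ m ∈ M, z * m = y := by
  simp [mulSub, Submodule.mem_map]

theorem finrank_mod_le [CongFF K] {z : K} (hz : Transcendental 𝔽 z) {M : Submodule 𝔽 K}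
    (hM : ∀ m ∈ M, z * m ∈ M) :
    Module.Finite 𝔽 (M ⧸ (mulSub z M).submoduleOf M) ∧
      Module.finrank 𝔽 (M ⧸ (mulSub z M).submoduleOf M) ≤ dg z := by
  have := finite_over_adjoin hz
  have key : ∀ (n : ℕ) (v : Fin n → M ⧸ (mulSub z M).submoduleOf M), LinearIndependent 𝔽 v →
      n ≤ dg z := by
    intro n v hv
    choose w hw using fun i => Submodule.Quotient.mk_surjective _ (v i)
    have : LinearIndependent 𝔽⟮z⟯ (fun i => (w i : K)) := by
      refine linearIndependent_of_mod hz hM _ (fun i => (w i).2) ?_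
      rintro c ⟨m, hm, hc⟩
      refine Fintype.linearIndependent_iff.1 hv c ?_
      have : ∑ i, c i • v i =
          Submodule.Quotient.mk (p := (mulSub z M).submoduleOf M) (∑ i, c i • w i) := by
        simp only [← hw]
        exact (map_sum ((mulSub z M).submoduleOf M).mkQ (fun i => c i • w i) _).symm
      rw [this, Submodule.Quotient.mk_eq_zero, Submodule.submoduleOf, Submodule.mem_comap, mem_mulSub]
      refine ⟨m, hm, ?_⟩
      rw [← hc]
      rw [map_sum]
      exact Finset.sum_congr rfl fun i _ => by rw [map_smul, Algebra.smul_def]; rfl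
    simpa [dg] using this.fintype_card_le_finrank
  have hr : Module.rank 𝔽 (M ⧸ (mulSub z M).submoduleOf M) ≤ (dg z : Cardinal) := by
    refine rank_le (fun s hs => ?_)
    have := key s.card (fun i => ((s.equivFin.symm i : s) : M ⧸ (mulSub z M).submoduleOf M))
      (hs.comp _ s.equivFin.symm.injective)
    exact this
  have hfin : Module.Finite 𝔽 (M ⧸ (mulSub z M).submoduleOf M) :=
    Module.rank_lt_aleph0_iff.1 (hr.trans_lt (Cardinal.natCast_lt_aleph0))
  exact ⟨hfin, by rw [← Nat.cast_le (α := Cardinal), Module.finrank_eq_rank]; exact hr⟩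

end Basic

section Places

variable {K : Type} [Field K] [Algebra 𝔽 K]

/-- Places of a function field over `𝔽₂`. -/
abbrev Pl (K : Type) [Field K] [Algebra 𝔽 K] := Place 𝔽 K

lemma isPlace_iff {O : ValuationSubring K} : IsPlace 𝔽 K O ↔ O ≠ ⊤ :=
  ⟨fun h => h.1, fun h => ⟨h, mem_subring O⟩⟩

/-- The valuation ring of a place as an `𝔽₂`-space. -/
def plSub (P : Pl K) : Submodule 𝔽 K where
  carrier := P.1
  add_mem' := P.1.add_mem _ _
  zero_mem' := P.1.zero_mem
  smul_mem' c x hx := by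
    rw [Algebra.smul_def]
    exact P.1.mul_mem _ _ (P.2.2 c) hx

lemma mem_plSub {P : Pl K} {x : K} : x ∈ plSub P ↔ x ∈ P.1 := Iff.rfl

variable [CongFF K]

instance instFiniteQuot (P : Pl K) : Ring.HasFiniteQuotients P.1 where
  finiteQuotient := by
    intro I hI
    obtain ⟨z, hzI, hz0⟩ := Submodule.exists_mem_ne_zero_of_ne_bot hI
    by_cases hu : IsUnit z
    · have : I = ⊤ := Ideal.eq_top_of_isUnit_mem _ hzI hu
      subst this
      have := Ideal.Quotient.subsingleton_iff.2 (rfl : (⊤ : Ideal P.1) = ⊤)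
      infer_instance
    have hz : Transcendental 𝔽 (z : K) := by
      rw [transcendental_iff]
      refine ⟨fun h => hz0 (Subtype.ext h), fun h => hu ?_⟩
      have : z = 1 := Subtype.ext h
      rw [this]; exact isUnit_one
    have hM : ∀ m ∈ plSub P, (z : K) * m ∈ plSub P := fun m hm => P.1.mul_mem _ _ z.2 hm
    obtain ⟨hfin, -⟩ := finrank_mod_le hz hM
    have : Finite (plSub P ⧸ (mulSub (z : K) (plSub P)).submoduleOf (plSub P)) :=
      Module.finite_of_finite 𝔽
    let f : (plSub P ⧸ (mulSub (z : K) (plSub P)).submoduleOf (plSub P)) → P.1 ⧸ I :=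
      fun q => Ideal.Quotient.mk I ⟨(Quotient.out q : plSub P), (Quotient.out q : plSub P).2⟩
    refine Finite.of_surjective f fun y => ?_
    obtain ⟨y, rfl⟩ := Ideal.Quotient.mk_surjective y
    let y' : plSub P := ⟨y, y.2⟩
    refine ⟨Submodule.Quotient.mk y', ?_⟩
    have h1 : Submodule.Quotient.mk (p := (mulSub (z : K) (plSub P)).submoduleOf (plSub P))
        (Quotient.out (Submodule.Quotient.mk (p := (mulSub (z : K) (plSub P)).submoduleOf
          (plSub P)) y')) = Submodule.Quotient.mk y' := Quotient.out_eq _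
    rw [Submodule.Quotient.eq] at h1
    obtain ⟨m, hm, h2⟩ := mem_mulSub.1 h1
    refine Ideal.Quotient.eq.2 ?_
    have : (⟨_, (Quotient.out (Submodule.Quotient.mk (p := (mulSub (z : K) (plSub P)).submoduleOf
          (plSub P)) y') : plSub P).2⟩ : P.1) - y = z * ⟨m, hm⟩ := Subtype.ext h2.symm
    rw [this]
    exact I.mul_mem_right _ hzI

instance instDVR (P : Pl K) : IsDiscreteValuationRing P.1 := by
  have h1 : IsPrincipalIdealRing P.1 := inferInstance
  refine { not_a_field' := ?_ }
  intro h
  have hf : IsField P.1 := IsLocalRing.isField_iff_maximalIdeal_eq.2 h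
  refine P.2.1 (eq_top_iff.2 fun x _ => ?_)
  by_contra hx
  have hi := (P.1.mem_or_inv_mem x).resolve_left hx
  have hx0 : x ≠ 0 := by rintro rfl; exact hx P.1.zero_mem
  obtain ⟨b, hb⟩ := hf.mul_inv_cancel (a := ⟨x⁻¹, hi⟩)
    (fun h => inv_ne_zero hx0 (congrArg Subtype.val h))
  have hb' : x⁻¹ * (b : K) = 1 := congrArg Subtype.val hb
  have : x = b := by field_simp at hb'; exact hb'.symm
  exact hx (this ▸ b.2)

/-- A uniformizer at a place. -/
def unif (P : Pl K) : K :=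
  ((IsDiscreteValuationRing.exists_irreducible P.1).choose : P.1)

lemma unif_mem (P : Pl K) : unif P ∈ P.1 := Subtype.prop _

lemma unif_irr (P : Pl K) : Irreducible (⟨unif P, unif_mem P⟩ : P.1) :=
  (IsDiscreteValuationRing.exists_irreducible P.1).choose_spec

lemma unif_ne (P : Pl K) : unif P ≠ 0 := fun h => (unif_irr P).ne_zero (Subtype.ext h)

lemma exists_unif_zpow (P : Pl K) {f : K} (hf : f ≠ 0) :
    ∃ (n : ℤ) (u : P.1ˣ), f = unif P ^ n * (u : P.1) := by
  have key : ∀ f : K, f ≠ 0 → f ∈ P.1 → ∃ (n : ℕ) (u : P.1ˣ), f = unif P ^ n * (u : P.1) := by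
    intro f hf hfP
    obtain ⟨n, u, h⟩ := IsDiscreteValuationRing.eq_unit_mul_pow_irreducible
      (x := (⟨f, hfP⟩ : P.1)) (fun h => hf (congrArg Subtype.val h)) (unif_irr P)
    refine ⟨n, u, ?_⟩
    have := congrArg Subtype.val h
    rw [mul_comm]; exact this
  rcases P.1.mem_or_inv_mem f with h | h
  · obtain ⟨n, u, h⟩ := key f hf h
    exact ⟨n, u, by simpa using h⟩
  · obtain ⟨n, u, h⟩ := key f⁻¹ (inv_ne_zero hf) h
    refine ⟨-n, u⁻¹, ?_⟩
    have h2 : ((u⁻¹ : P.1ˣ) : P.1) = ((u : P.1) : K)⁻¹ := by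
      refine eq_inv_of_mul_eq_one_left ?_
      exact congrArg Subtype.val u.inv_mul
    rw [h2, zpow_neg, zpow_natCast, ← mul_inv, ← h, inv_inv]

lemma maximalIdeal_eq_span (P : Pl K) :
    IsLocalRing.maximalIdeal P.1 = Ideal.span {(⟨unif P, unif_mem P⟩ : P.1)} :=
  (IsDiscreteValuationRing.irreducible_iff_uniformizer _).1 (unif_irr P)

lemma ordAux_eq (P : Pl K) (n : ℕ) (u : P.1ˣ) (x : P.1)
    (h : (x : K) = unif P ^ n * (u : P.1)) : ordAux P.1 x = n := by
  have hx : x = (⟨unif P, unif_mem P⟩ : P.1) ^ n * u := Subtype.ext h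
  have : {k : ℕ | x ∈ IsLocalRing.maximalIdeal P.1 ^ k} = Set.Iic n := by
    ext k
    rw [Set.mem_ofPred_eq, Set.mem_Iic, maximalIdeal_eq_span, Ideal.span_singleton_pow,
      Ideal.mem_span_singleton, hx, Units.dvd_mul_right,
      pow_dvd_pow_iff (unif_irr P).ne_zero (unif_irr P).not_isUnit]
  rw [ordAux, this]
  exact csSup_Iic

/-- The normalized valuation at a place; `ord P 0 = 0` by convention. -/
def ord (P : Pl K) (f : K) : ℤ := ordAt P.1 f

lemma unit_mul_mem (P : Pl K) (n : ℤ) (u : P.1ˣ) :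
    unif P ^ n * ((u : P.1) : K) ∈ P.1 ↔ 0 ≤ n := by
  constructor
  · intro h
    by_contra hn
    push Not at hn
    obtain ⟨m, rfl⟩ : ∃ m : ℕ, n = -(m + 1 : ℕ) := ⟨(-n - 1).toNat, by push_cast; omega⟩
    have h2 : (unif P)⁻¹ ∈ P.1 := by
      have h3 : (unif P)⁻¹ = (unif P ^ (-(m + 1 : ℕ) : ℤ) * ((u : P.1) : K)) *
          (((u⁻¹ : P.1ˣ) : P.1) : K) * unif P ^ m := by
        have : ((u : P.1) : K) * (((u⁻¹ : P.1ˣ) : P.1) : K) = 1 :=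
          congrArg Subtype.val u.mul_inv
        rw [mul_assoc (unif P ^ _), this, mul_one, zpow_neg, zpow_natCast, pow_succ]
        have := unif_ne P
        field_simp
      rw [h3]
      exact P.1.mul_mem _ _ (P.1.mul_mem _ _ h (Subtype.prop _)) (pow_mem (unif_mem P) _)
    refine (unif_irr P).not_isUnit (IsUnit.of_mul_eq_one ⟨_, h2⟩ (Subtype.ext ?_))
    exact mul_inv_cancel₀ (unif_ne P)
  · intro h
    obtain ⟨m, rfl⟩ := Int.eq_ofNat_of_zero_le h
    rw [zpow_natCast]
    exact P.1.mul_mem _ _ (pow_mem (unif_mem P) _) (Subtype.prop _)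

lemma ord_eq (P : Pl K) (n : ℤ) (u : P.1ˣ) : ord P (unif P ^ n * (u : P.1)) = n := by
  rw [ord, ordAt]
  split_ifs with h
  · have hn := (unit_mul_mem P n u).1 h
    obtain ⟨m, rfl⟩ := Int.eq_ofNat_of_zero_le hn
    rw [ordAux_eq P m u _ (by simp)]
  · have hn := (unit_mul_mem P n u).not.1 h
    push Not at hn
    obtain ⟨m, hm⟩ := Int.eq_ofNat_of_zero_le (neg_nonneg.2 hn.le)
    rw [ordAux_eq P m u⁻¹]
    · omega
    · have h2 : ((u⁻¹ : P.1ˣ) : P.1) = ((u : P.1) : K)⁻¹ := by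
        refine eq_inv_of_mul_eq_one_left ?_
        exact congrArg Subtype.val u.inv_mul
      change (unif P ^ n * ((u : P.1) : K))⁻¹ = _
      rw [h2, mul_inv, ← zpow_neg, hm, zpow_natCast]

lemma ord_unif_zpow (P : Pl K) (n : ℤ) : ord P (unif P ^ n) = n := by
  simpa using ord_eq P n 1

@[simp] lemma ord_unif (P : Pl K) : ord P (unif P) = 1 := by
  simpa using ord_unif_zpow P 1

@[simp] lemma ord_one (P : Pl K) : ord P (1 : K) = 0 := by
  simpa using ord_unif_zpow P 0

@[simp] lemma ord_zero (P : Pl K) : ord P (0 : K) = 0 := by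
  rw [ord, ordAt, dif_pos P.1.zero_mem, ordAux]
  have : {n : ℕ | (⟨0, P.1.zero_mem⟩ : P.1) ∈ IsLocalRing.maximalIdeal P.1 ^ n} = Set.univ := by
    ext n
    simp only [Set.mem_ofPred_eq, Set.mem_univ, iff_true]
    exact Ideal.zero_mem _
  rw [this, csSup_of_not_bddAbove (by simp)]
  simp

lemma ord_mul (P : Pl K) {f g : K} (hf : f ≠ 0) (hg : g ≠ 0) :
    ord P (f * g) = ord P f + ord P g := by
  obtain ⟨n, u, rfl⟩ := exists_unif_zpow P hf
  obtain ⟨m, w, rfl⟩ := exists_unif_zpow P hg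
  have : unif P ^ n * ((u : P.1) : K) * (unif P ^ m * ((w : P.1) : K)) =
      unif P ^ (n + m) * (((u * w : P.1ˣ) : P.1) : K) := by
    rw [zpow_add₀ (unif_ne P), Units.val_mul, MulMemClass.coe_mul]; ring
  rw [this, ord_eq, ord_eq, ord_eq]

lemma ord_inv (P : Pl K) (f : K) : ord P f⁻¹ = -ord P f := by
  by_cases hf : f = 0
  · simp [hf]
  have := ord_mul P hf (inv_ne_zero hf)
  rw [mul_inv_cancel₀ hf, ord_one] at this
  omega

lemma ord_div (P : Pl K) {f g : K} (hf : f ≠ 0) (hg : g ≠ 0) :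
    ord P (f / g) = ord P f - ord P g := by
  rw [div_eq_mul_inv, ord_mul P hf (inv_ne_zero hg), ord_inv]; ring

lemma ord_pow (P : Pl K) (f : K) (n : ℕ) : ord P (f ^ n) = n * ord P f := by
  by_cases hf : f = 0
  · subst hf
    cases n <;> simp
  induction n with
  | zero => simp
  | succ n ih => rw [pow_succ, ord_mul P (pow_ne_zero _ hf) hf, ih]; push_cast; ring

lemma ord_zpow (P : Pl K) (f : K) (n : ℤ) : ord P (f ^ n) = n * ord P f := by
  cases n with
  | ofNat n => simpa using ord_pow P f n
  | negSucc n => rw [zpow_negSucc, ord_inv, ord_pow, Int.negSucc_eq]; push_cast; ring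

lemma mem_iff_ord (P : Pl K) {f : K} (hf : f ≠ 0) : f ∈ P.1 ↔ 0 ≤ ord P f := by
  obtain ⟨n, u, rfl⟩ := exists_unif_zpow P hf
  rw [ord_eq, unit_mul_mem]

/-- The elements of order at least `n` at the place `P`. -/
def pw (P : Pl K) (n : ℤ) : Submodule 𝔽 K := mulSub (unif P ^ n) (plSub P)

lemma mem_pw {P : Pl K} {n : ℤ} {f : K} : f ∈ pw P n ↔ f = 0 ∨ n ≤ ord P f := by
  rw [pw, mem_mulSub]
  have hu := zpow_ne_zero n (unif_ne P)
  constructor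
  · rintro ⟨m, hm, rfl⟩
    by_cases hm0 : m = 0
    · left; rw [hm0, mul_zero]
    · right
      rw [ord_mul P hu hm0, ord_unif_zpow]
      have := (mem_iff_ord P hm0).1 hm
      omega
  · rintro (rfl | h)
    · exact ⟨0, Submodule.zero_mem _, mul_zero _⟩
    · by_cases hf : f = 0
      · exact ⟨0, Submodule.zero_mem _, by rw [hf, mul_zero]⟩
      refine ⟨f / unif P ^ n, ?_, mul_div_cancel₀ _ hu⟩
      rw [mem_plSub, mem_iff_ord P (div_ne_zero hf hu), ord_div P hf hu, ord_unif_zpow]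
      omega

lemma mem_pw_of_ne {P : Pl K} {n : ℤ} {f : K} (hf : f ≠ 0) : f ∈ pw P n ↔ n ≤ ord P f := by
  rw [mem_pw]; simp [hf]

lemma mem_pw_ord (P : Pl K) (f : K) : f ∈ pw P (ord P f) := mem_pw.2 (Or.inr le_rfl)

lemma pw_zero (P : Pl K) : pw P 0 = plSub P := by
  ext f
  rw [mem_pw, mem_plSub]
  by_cases hf : f = 0
  · simp [hf, P.1.zero_mem]
  · simp [hf, mem_iff_ord P hf]

lemma mem_pw_zero {P : Pl K} {f : K} : f ∈ pw P 0 ↔ f ∈ P.1 := by rw [pw_zero, mem_plSub]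

lemma pw_anti {P : Pl K} {m n : ℤ} (h : m ≤ n) : pw P n ≤ pw P m := by
  intro f hf
  rw [mem_pw] at hf ⊢
  exact hf.imp id (fun h' => h.trans h')

lemma pw_mul {P : Pl K} {m n : ℤ} {f g : K} (hf : f ∈ pw P m) (hg : g ∈ pw P n) :
    f * g ∈ pw P (m + n) := by
  by_cases hf0 : f = 0
  · rw [hf0, zero_mul]; exact Submodule.zero_mem _
  by_cases hg0 : g = 0
  · rw [hg0, mul_zero]; exact Submodule.zero_mem _
  rw [mem_pw_of_ne hf0] at hf
  rw [mem_pw_of_ne hg0] at hg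
  rw [mem_pw_of_ne (mul_ne_zero hf0 hg0), ord_mul P hf0 hg0]
  omega

lemma pw_pow {P : Pl K} {m : ℤ} {f : K} (hf : f ∈ pw P m) (k : ℕ) : f ^ k ∈ pw P (k * m) := by
  induction k with
  | zero => rw [pow_zero, mem_pw_of_ne one_ne_zero, ord_one]; simp
  | succ k ih =>
    rw [pow_succ]
    have := pw_mul ih hf
    convert this using 2
    push_cast; ring

lemma one_mem_pw (P : Pl K) : (1 : K) ∈ pw P 0 := by
  rw [mem_pw_of_ne one_ne_zero, ord_one]

lemma one_not_mem_pw (P : Pl K) : (1 : K) ∉ pw P 1 := by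
  rw [mem_pw_of_ne one_ne_zero, ord_one]; omega

lemma ord_add_of_lt (P : Pl K) {f g : K} (hf : f ≠ 0) (hg : g ∈ pw P (ord P f + 1)) :
    f + g ≠ 0 ∧ ord P (f + g) = ord P f := by
  have hne : f + g ≠ 0 := by
    intro h
    have : f = -g := eq_neg_of_add_eq_zero_left h
    have h2 : f ∈ pw P (ord P f + 1) := by rw [this]; exact Submodule.neg_mem _ (this ▸ hg)
    rw [mem_pw_of_ne hf] at h2
    omega
  refine ⟨hne, ?_⟩
  have h1 : f + g ∈ pw P (ord P f) :=
    Submodule.add_mem _ (mem_pw_ord P f) (pw_anti (by omega) hg)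
  rw [mem_pw_of_ne hne] at h1
  by_contra hcon
  have h2 : f + g ∈ pw P (ord P f + 1) := by rw [mem_pw_of_ne hne]; omega
  have h3 := Submodule.sub_mem _ h2 hg
  rw [add_sub_cancel_right, mem_pw_of_ne hf] at h3
  omega

lemma mem_maximalIdeal_iff {P : Pl K} (x : P.1) :
    x ∈ IsLocalRing.maximalIdeal P.1 ↔ (x : K) ∈ pw P 1 := by
  rw [maximalIdeal_eq_span, Ideal.mem_span_singleton, pw, mem_mulSub, zpow_one]
  constructor
  · rintro ⟨c, rfl⟩; exact ⟨c, c.2, rfl⟩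
  · rintro ⟨m, hm, h⟩; exact ⟨⟨m, hm⟩, Subtype.ext h.symm⟩

lemma residue_eq_iff {P : Pl K} (x y : P.1) :
    IsLocalRing.residue P.1 x = IsLocalRing.residue P.1 y ↔ (x : K) - y ∈ pw P 1 := by
  rw [← sub_eq_zero, ← map_sub, IsLocalRing.residue_eq_zero_iff, mem_maximalIdeal_iff]
  rfl

instance (P : Pl K) : Finite (IsLocalRing.ResidueField P.1) := by
  have h : IsLocalRing.maximalIdeal P.1 ≠ ⊥ := IsDiscreteValuationRing.not_a_field P.1
  exact Ring.HasFiniteQuotients.finiteQuotient h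

/-- The degree of a place. -/
def deg (P : Pl K) : ℕ := placeDegree 𝔽 P

lemma card_residueField (P : Pl K) : Nat.card (IsLocalRing.ResidueField P.1) = 2 ^ deg P := by
  let _ := (residueHom 𝔽 P).toAlgebra
  have : Module.Finite 𝔽 (IsLocalRing.ResidueField P.1) := Module.Finite.of_finite
  rw [Module.natCard_eq_pow_finrank (K := 𝔽), Nat.card_zmod]
  rfl

lemma deg_pos (P : Pl K) : 0 < deg P := by
  rw [Nat.pos_iff_ne_zero]
  intro h
  have h1 := card_residueField P
  rw [h, pow_zero] at h1
  have : 1 < Nat.card (IsLocalRing.ResidueField P.1) := Finite.one_lt_card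
  omega

/-- The residue field at `P` has `2 ^ deg P` elements, hence Frobenius is trivial on it. -/
lemma pow_card_sub_mem (P : Pl K) {f : K} (hf : f ∈ P.1) : f ^ (2 ^ deg P) - f ∈ pw P 1 := by
  have := (residue_eq_iff (⟨f, hf⟩ ^ (2 ^ deg P) : P.1) ⟨f, hf⟩).1 (by
    rw [map_pow, ← card_residueField P]
    have := Fintype.ofFinite (IsLocalRing.ResidueField P.1)
    rw [Nat.card_eq_fintype_card]
    exact FiniteField.pow_card _)
  exact this

end Places

section Index

variable {V V' : Type} [AddCommGroup V] [Module 𝔽 V] [AddCommGroup V'] [Module 𝔽 V']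

/-- The index of `A ⊓ B` in `B`; it is `0` if this index is infinite. -/
def ix (A B : Submodule 𝔽 V) : ℕ := A.toAddSubgroup.relIndex B.toAddSubgroup

lemma ix_trans {A B C : Submodule 𝔽 V} (h1 : A ≤ B) (h2 : B ≤ C) :
    ix A B * ix B C = ix A C :=
  AddSubgroup.relIndex_mul_relIndex _ _ _ h1 h2

lemma ix_inf (A B : Submodule 𝔽 V) : ix (A ⊓ B) B = ix A B := by
  have : (A ⊓ B).toAddSubgroup = A.toAddSubgroup ⊓ B.toAddSubgroup := rfl
  rw [ix, this, AddSubgroup.inf_relIndex_right]; rfl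

lemma ix_sup (A B : Submodule 𝔽 V) : ix A (A ⊔ B) = ix A B := by
  rw [ix, Submodule.sup_toAddSubgroup, sup_comm, AddSubgroup.relIndex_sup_right]; rfl

lemma ix_le_right {A B C : Submodule 𝔽 V} (h : B ≤ C) (hA : ix A C ≠ 0) : ix A B ≤ ix A C :=
  AddSubgroup.relIndex_le_of_le_right h hA

lemma ix_ne_zero_right {A B C : Submodule 𝔽 V} (h : B ≤ C) (hA : ix A C ≠ 0) : ix A B ≠ 0 :=
  fun h0 => hA (AddSubgroup.relIndex_eq_zero_of_le_right h h0)

lemma ix_ne_zero_left {A B C : Submodule 𝔽 V} (h : A ≤ B) (hA : ix A C ≠ 0) : ix B C ≠ 0 :=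
  fun h0 => hA (AddSubgroup.relIndex_eq_zero_of_le_left h h0)

lemma ix_eq_one {A B : Submodule 𝔽 V} : ix A B = 1 ↔ B ≤ A := AddSubgroup.relIndex_eq_one

lemma ix_self (A : Submodule 𝔽 V) : ix A A = 1 := ix_eq_one.2 le_rfl

lemma ix_bot (B : Submodule 𝔽 V) : ix ⊥ B = Nat.card B := by
  rw [ix, Submodule.bot_toAddSubgroup, AddSubgroup.relIndex_bot_left]; rfl

lemma ix_card (A B : Submodule 𝔽 V) : ix A B = Nat.card (B ⧸ A.submoduleOf B) := by
  rw [ix, AddSubgroup.relIndex, AddSubgroup.index]; rfl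

lemma ix_pos_of_finite {A B : Submodule 𝔽 V} [Module.Finite 𝔽 (B ⧸ A.submoduleOf B)] :
    ix A B = 2 ^ Module.finrank 𝔽 (B ⧸ A.submoduleOf B) := by
  rw [ix_card, Module.natCard_eq_pow_finrank (K := 𝔽), Nat.card_zmod]

lemma ix_map {A B : Submodule 𝔽 V} (f : V →ₗ[𝔽] V') (hf : Function.Injective f) :
    ix (A.map f) (B.map f) = ix A B := by
  have := AddSubgroup.relIndex_map_map_of_injective (f := f.toAddMonoidHom)
    A.toAddSubgroup B.toAddSubgroup hf
  exact this

lemma ix_ker (f : V →ₗ[𝔽] V') (B : Submodule 𝔽 V) :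
    ix (LinearMap.ker f) B = Nat.card (B.map f) := by
  have := AddSubgroup.relIndex_ker B.toAddSubgroup f.toAddMonoidHom
  exact this

lemma ix_comap (f : V →ₗ[𝔽] V') (A : Submodule 𝔽 V') (B : Submodule 𝔽 V) :
    ix (A.comap f) B = ix A (B.map f) :=
  AddSubgroup.relIndex_comap A.toAddSubgroup f.toAddMonoidHom B.toAddSubgroup

end Index

section Approx

variable {K : Type} [Field K] [Algebra 𝔽 K] [CongFF K]

lemma pw_top (P : Pl K) (f : K) : ∃ n : ℕ, f ∈ pw P (-n) :=
  ⟨(-ord P f).toNat, mem_pw.2 (Or.inr (by omega))⟩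

lemma pl_eq_of_le {P Q : Pl K} (h : P.1 ≤ Q.1) : P = Q := by
  refine Subtype.ext (le_antisymm h fun y hy => ?_)
  by_contra hyP
  refine Q.2.1 (eq_top_iff.2 fun f _ => ?_)
  have hy0 : y ≠ 0 := by rintro rfl; exact hyP P.1.zero_mem
  by_cases hf : f = 0
  · rw [hf]; exact Q.1.zero_mem
  rw [mem_iff_ord P hy0] at hyP
  obtain ⟨n, hn⟩ := pw_top P f
  have h1 : f * (y⁻¹) ^ n ∈ P.1 := by
    rw [mem_iff_ord P (mul_ne_zero hf (pow_ne_zero _ (inv_ne_zero hy0))),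
      ord_mul P hf (pow_ne_zero _ (inv_ne_zero hy0)), ord_pow, ord_inv]
    rw [mem_pw_of_ne hf] at hn
    nlinarith
  have h2 : f = f * (y⁻¹) ^ n * y ^ n := by rw [mul_assoc, ← mul_pow]; simp [hy0]
  rw [h2]
  exact Q.1.mul_mem _ _ (h h1) (pow_mem hy n)

lemma exists_sep {P Q : Pl K} (h : P ≠ Q) : ∃ f : K, f ≠ 0 ∧ 0 < ord P f ∧ ord Q f < 0 := by
  obtain ⟨a, haP, haQ⟩ := SetLike.not_le_iff_exists.1 (fun h' => h (pl_eq_of_le h'))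
  obtain ⟨b, hbQ, hbP⟩ := SetLike.not_le_iff_exists.1 (fun h' => h (pl_eq_of_le h').symm)
  have ha : a ≠ 0 := by rintro rfl; exact haQ Q.1.zero_mem
  have hb : b ≠ 0 := by rintro rfl; exact hbP P.1.zero_mem
  rw [mem_iff_ord _ ha] at haP haQ
  rw [mem_iff_ord _ hb] at hbP hbQ
  refine ⟨a / b, div_ne_zero ha hb, ?_, ?_⟩ <;> rw [ord_div _ ha hb] <;> omega

lemma ord_add_of_ord_lt (P : Pl K) {f g : K} (hf : f ≠ 0) (hg : g ≠ 0) (h : ord P f < ord P g) :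
    f + g ≠ 0 ∧ ord P (f + g) = ord P f :=
  ord_add_of_lt P hf ((mem_pw_of_ne hg).2 h)

lemma exists_pos_neg (S : Finset (Pl K)) (P : Pl K) (hP : P ∉ S) :
    ∃ f : K, f ≠ 0 ∧ 0 < ord P f ∧ ∀ Q ∈ S, ord Q f < 0 := by
  induction S using Finset.induction_on with
  | empty => exact ⟨unif P, unif_ne P, by simp, by simp⟩
  | insert Q S hQ ih =>
    simp only [Finset.mem_insert, not_or] at hP
    obtain ⟨f, hf, hfP, hfS⟩ := ih hP.2
    obtain ⟨g, hg, hgP, hgQ⟩ := exists_sep hP.1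
    obtain ⟨r, hr⟩ : ∃ r : ℕ, 0 < r ∧ ∀ T ∈ insert Q S, -ord T f < r := by
      refine ⟨(∑ T ∈ insert Q S, (-ord T f).toNat) + 1, by omega, fun T hT => ?_⟩
      have := Finset.single_le_sum (f := fun T : Pl K => (-ord T f).toNat)
        (fun _ _ => Nat.zero_le _) hT
      omega
    have hgr : g ^ r ≠ 0 := pow_ne_zero _ hg
    have key : ∀ T ∈ insert Q S, f + g ^ r ≠ 0 ∧ ord T (f + g ^ r) < 0 := by
      intro T hT
      have h1 := hr.2 T hT
      by_cases hgT : ord T g < 0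
      · have h2 : ord T (g ^ r) < ord T f := by rw [ord_pow]; nlinarith
        obtain ⟨h3, h4⟩ := ord_add_of_ord_lt T hgr hf h2
        rw [add_comm]
        refine ⟨h3, ?_⟩
        rw [h4, ord_pow]
        have := hr.1
        have : (0 : ℤ) < r := by exact_mod_cast this
        nlinarith
      · have hTS : T ∈ S := by
          rcases Finset.mem_insert.1 hT with rfl | h
          · exact absurd hgQ hgT
          · exact h
        have hfT := hfS T hTS
        push Not at hgT
        have h2 : ord T f < ord T (g ^ r) := by rw [ord_pow]; nlinarith
        obtain ⟨h3, h4⟩ := ord_add_of_ord_lt T hf hgr h2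
        exact ⟨h3, by omega⟩
    have hne := (key Q (Finset.mem_insert_self _ _)).1
    refine ⟨f + g ^ r, hne, ?_, fun T hT => (key T hT).2⟩
    have h1 : f + g ^ r ∈ pw P 1 := by
      refine Submodule.add_mem _ ((mem_pw_of_ne hf).2 hfP) ((mem_pw_of_ne hgr).2 ?_)
      rw [ord_pow]
      have := hr.1
      have : (0 : ℤ) < r := by exact_mod_cast this
      nlinarith
    rw [mem_pw_of_ne hne] at h1
    omega

lemma exists_idem (S : Finset (Pl K)) (P : Pl K) (hP : P ∉ S) (N : ℕ) :
    ∃ u : K, u - 1 ∈ pw P N ∧ ∀ Q ∈ S, u ∈ pw Q N := by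
  obtain ⟨f, hf, hfP, hfS⟩ := exists_pos_neg S P hP
  have hfn : f ^ (N + 1) ≠ 0 := pow_ne_zero _ hf
  have hP1 : 1 + f ^ (N + 1) ≠ 0 ∧ ord P (1 + f ^ (N + 1)) = ord P (1 : K) := by
    refine ord_add_of_ord_lt P one_ne_zero hfn ?_
    rw [ord_one, ord_pow]; positivity
  obtain ⟨hne, hoP⟩ := hP1
  rw [ord_one] at hoP
  refine ⟨(1 + f ^ (N + 1))⁻¹, ?_, fun Q hQ => ?_⟩
  · have : (1 + f ^ (N + 1))⁻¹ - 1 = -(f ^ (N + 1) / (1 + f ^ (N + 1))) := by field_simp; ring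
    rw [this]
    refine Submodule.neg_mem _ ((mem_pw_of_ne (div_ne_zero hfn hne)).2 ?_)
    rw [ord_div P hfn hne, hoP, ord_pow]
    push_cast
    nlinarith
  · have hQ' := hfS Q hQ
    rw [mem_pw_of_ne (inv_ne_zero hne), ord_inv, add_comm]
    have := (ord_add_of_ord_lt Q hfn (one_ne_zero) (by
      rw [ord_one, ord_pow]; push_cast; nlinarith)).2
    rw [this, ord_pow]; push_cast; nlinarith

/-- Weak approximation. -/
theorem approx (S : Finset (Pl K)) (x : Pl K → K) (n : Pl K → ℤ) :
    ∃ f : K, ∀ P ∈ S, f - x P ∈ pw P (n P) := by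
  obtain ⟨N, hN⟩ : ∃ N : ℕ, ∀ P ∈ S, ∀ Q ∈ S, n P - ord P (x Q) ≤ N := by
    refine ⟨∑ P ∈ S, ∑ Q ∈ S, (n P - ord P (x Q)).toNat, fun P hP Q hQ => ?_⟩
    have h1 := Finset.single_le_sum (f := fun Q : Pl K => (n P - ord P (x Q)).toNat)
      (fun _ _ => Nat.zero_le _) hQ
    have h2 := Finset.single_le_sum (f := fun P : Pl K => ∑ Q ∈ S, (n P - ord P (x Q)).toNat)
      (fun _ _ => Nat.zero_le _) hP
    omega
  choose u hu1 hu2 using fun P : Pl K => exists_idem (S.erase P) P (by simp) N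
  refine ⟨∑ Q ∈ S, x Q * u Q, fun P hP => ?_⟩
  rw [← Finset.add_sum_erase S _ hP]
  have : x P * u P + ∑ Q ∈ S.erase P, x Q * u Q - x P =
      x P * (u P - 1) + ∑ Q ∈ S.erase P, x Q * u Q := by ring
  rw [this]
  have hb : ∀ Q ∈ S, ∀ v ∈ pw P N, x Q * v ∈ pw P (n P) := fun Q hQ v hv =>
    pw_anti (by have := hN P hP Q hQ; omega) (pw_mul (mem_pw_ord P (x Q)) hv)
  refine Submodule.add_mem _ (hb P hP _ (hu1 P)) (Submodule.sum_mem _ fun Q hQ => ?_)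
  have hQS := Finset.mem_of_mem_erase hQ
  exact hb Q hQS _ (hu2 Q P (Finset.mem_erase.2 ⟨(Finset.ne_of_mem_erase hQ).symm, hP⟩))

/-- Weak approximation with prescribed orders. -/
lemma approx_ord (S : Finset (Pl K)) (hS : S.Nonempty) (n : Pl K → ℤ) :
    ∃ f : K, f ≠ 0 ∧ ∀ P ∈ S, ord P f = n P := by
  obtain ⟨f, hf⟩ := approx S (fun P => unif P ^ n P) (fun P => n P + 1)
  have key : ∀ P ∈ S, f ≠ 0 ∧ ord P f = n P := by
    intro P hP
    have h := hf P hP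
    have h0 := zpow_ne_zero (n P) (unif_ne P)
    have := ord_add_of_lt P h0 (g := f - unif P ^ n P) (by rwa [ord_unif_zpow])
    rwa [add_sub_cancel, ord_unif_zpow] at this
  obtain ⟨P, hP⟩ := hS
  exact ⟨f, (key P hP).1, fun P hP => (key P hP).2⟩

lemma mulSub_pw (P : Pl K) {z : K} (hz : z ≠ 0) (n : ℤ) :
    mulSub z (pw P n) = pw P (n + ord P z) := by
  ext f
  rw [mem_mulSub]
  constructor
  · rintro ⟨m, hm, rfl⟩
    have := pw_mul hm (mem_pw_ord P z)
    rwa [mul_comm]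
  · intro hf
    refine ⟨z⁻¹ * f, ?_, by field_simp⟩
    have := pw_mul (mem_pw_ord P z⁻¹) hf
    rw [ord_inv] at this
    convert this using 1
    ring_nf

lemma ix_mulSub {z : K} (hz : z ≠ 0) (A B : Submodule 𝔽 K) :
    ix (mulSub z A) (mulSub z B) = ix A B :=
  ix_map _ (mul_right_injective₀ hz)

lemma ix_pw_one (P : Pl K) : ix (pw P 1) (pw P 0) = 2 ^ deg P := by
  rw [← card_residueField, ix_card]
  refine Nat.card_congr ?_
  refine Equiv.ofBijective (fun q => Quotient.liftOn' q
    (fun x : pw P 0 => IsLocalRing.residue P.1 ⟨x, mem_pw_zero.1 x.2⟩) ?_) ⟨?_, ?_⟩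
  · intro a b hab
    rw [residue_eq_iff]
    have := (Submodule.quotientRel_def _).1 hab
    exact this
  · intro a b
    induction a using Submodule.Quotient.induction_on
    induction b using Submodule.Quotient.induction_on
    intro h
    exact (Submodule.Quotient.eq _).2 ((residue_eq_iff _ _).1 h)
  · intro y
    obtain ⟨x, rfl⟩ := IsLocalRing.residue_surjective y
    exact ⟨Submodule.Quotient.mk ⟨x, mem_pw_zero.2 x.2⟩, rfl⟩

lemma ix_pw_succ (P : Pl K) (n : ℤ) : ix (pw P (n + 1)) (pw P n) = 2 ^ deg P := by
  have h := mulSub_pw P (zpow_ne_zero n (unif_ne P))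
  rw [← ix_pw_one, ← ix_mulSub (A := pw P 1) (zpow_ne_zero n (unif_ne P)), h, h, ord_unif_zpow,
    zero_add, add_comm]

lemma ix_pw (P : Pl K) (n : ℤ) (k : ℕ) : ix (pw P (n + k)) (pw P n) = 2 ^ (k * deg P) := by
  induction k with
  | zero => simp [ix_self]
  | succ k ih =>
    rw [← ix_trans (B := pw P (n + k)) (pw_anti (by push_cast; omega)) (pw_anti (by omega)), ih]
    push_cast
    rw [← add_assoc, ix_pw_succ, ← pow_add]; ring_nf

/-- Elements of prescribed order at finitely many places. -/
def semi (S : Finset (Pl K)) (n : Pl K → ℤ) : Submodule 𝔽 K := ⨅ P ∈ S, pw P (n P)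

lemma mem_semi {S : Finset (Pl K)} {n : Pl K → ℤ} {f : K} :
    f ∈ semi S n ↔ ∀ P ∈ S, f ∈ pw P (n P) := by simp [semi]

lemma ix_semi (S : Finset (Pl K)) (n : Pl K → ℤ) (k : Pl K → ℕ) :
    ix (semi S fun P => n P + k P) (semi S n) = 2 ^ ∑ P ∈ S, k P * deg P := by
  induction S using Finset.induction_on with
  | empty => simpa [semi] using ix_self (⊤ : Submodule 𝔽 K)
  | insert P S hP ih =>
    have e : ∀ n : Pl K → ℤ, semi (insert P S) n = pw P (n P) ⊓ semi S n := fun n => by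
      ext f; simp [mem_semi]
    rw [e, e]
    set S' := semi S fun P => n P + k P
    have hS' : S' ≤ semi S n := fun f hf => mem_semi.2 fun Q hQ =>
      pw_anti (by simp) (mem_semi.1 hf Q hQ)
    rw [← ix_trans (B := pw P (n P) ⊓ S') (inf_le_inf_right _ (pw_anti (by omega)))
      (inf_le_inf_left _ hS'), Finset.sum_insert hP, pow_add]
    have hle : pw P (n P + k P) ≤ pw P (n P) := pw_anti (by omega)
    congr 1
    · have h1 : pw P (n P + k P) ⊓ S' = pw P (n P + k P) ⊓ (pw P (n P) ⊓ S') := by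
        rw [← inf_assoc, inf_eq_left.2 hle]
      rw [h1, ix_inf, ← ix_sup, ← ix_pw P (n P)]
      congr 1
      refine le_antisymm (sup_le hle inf_le_left) fun f hf => ?_
      obtain ⟨g, hg⟩ := approx (insert P S) (fun Q => if Q = P then f else 0)
        (fun Q => n Q + k Q)
      have hgP := hg P (Finset.mem_insert_self _ _)
      rw [if_pos rfl] at hgP
      refine Submodule.mem_sup.2 ⟨f - g, ?_, g, ⟨?_, mem_semi.2 fun Q hQ => ?_⟩, by ring⟩
      · rw [← neg_sub]; exact Submodule.neg_mem _ hgP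
      · have := Submodule.add_mem _ (hle hgP) hf
        rwa [sub_add_cancel] at this
      · have := hg Q (Finset.mem_insert_of_mem hQ)
        rwa [if_neg (by rintro rfl; exact hP hQ), sub_zero] at this
    · have h1 : pw P (n P) ⊓ S' = S' ⊓ (pw P (n P) ⊓ semi S n) := by
        rw [← inf_assoc, inf_comm S', inf_assoc, inf_eq_left.2 hS']
      rw [h1, ix_inf, ← ix_sup, ← ih]
      congr 1
      refine le_antisymm (sup_le hS' inf_le_right) fun f hf => ?_
      obtain ⟨g, hg⟩ := approx (insert P S) (fun Q => if Q = P then 0 else f)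
        (fun Q => n Q + k Q)
      have hg' : ∀ Q ∈ S, g - f ∈ pw Q (n Q + k Q) := fun Q hQ => by
        have := hg Q (Finset.mem_insert_of_mem hQ)
        rwa [if_neg (by rintro rfl; exact hP hQ)] at this
      have hgP := hg P (Finset.mem_insert_self _ _)
      rw [if_pos rfl, sub_zero] at hgP
      refine Submodule.mem_sup.2 ⟨f - g, mem_semi.2 fun Q hQ => ?_, g,
        ⟨hle hgP, mem_semi.2 fun Q hQ => ?_⟩, by ring⟩
      · rw [← neg_sub]; exact Submodule.neg_mem _ (hg' Q hQ)
      · have := Submodule.add_mem _ (pw_anti (by omega) (hg' Q hQ)) (mem_semi.1 hf Q hQ)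
        rwa [sub_add_cancel] at this

end Approx

section Divisors

variable {K : Type} [Field K] [Algebra 𝔽 K] [CongFF K]

lemma mulSub_semi (S : Finset (Pl K)) {z : K} (hz : z ≠ 0) (n : Pl K → ℤ) :
    mulSub z (semi S n) = semi S fun P => n P + ord P z := by
  ext f
  simp only [mem_semi, ← mulSub_pw _ hz, mem_mulSub]
  constructor
  · rintro ⟨m, hm, rfl⟩ P hP
    exact ⟨m, hm P hP, rfl⟩
  · intro h
    refine ⟨z⁻¹ * f, fun P hP => ?_, by field_simp⟩
    obtain ⟨m, hm, rfl⟩ := h P hP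
    rwa [← mul_assoc, inv_mul_cancel₀ hz, one_mul]

lemma sum_ord_le {z : K} (hz : Transcendental 𝔽 z) (S : Finset (Pl K))
    (hS : ∀ P ∈ S, 0 ≤ ord P z) : ∑ P ∈ S, (ord P z).toNat * deg P ≤ dg z := by
  have hz0 : z ≠ 0 := (transcendental_iff.1 hz).1
  have hM : ∀ m ∈ semi S (fun _ : Pl K => (0 : ℤ)), z * m ∈ semi S (fun _ : Pl K => (0 : ℤ)) := by
    intro m hm
    rw [mem_semi] at hm ⊢
    intro P hP
    have := pw_mul ((mem_pw_of_ne hz0).2 (hS P hP)) (hm P hP)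
    simpa using this
  obtain ⟨hfin, hle⟩ := finrank_mod_le hz hM
  have h1 := ix_pos_of_finite (A := mulSub z (semi S (fun _ : Pl K => (0 : ℤ))))
    (B := semi S (fun _ : Pl K => (0 : ℤ)))
  have h2 := ix_semi S (fun _ : Pl K => (0 : ℤ)) (fun P => (ord P z).toNat)
  have h3 : mulSub z (semi S (fun _ : Pl K => (0 : ℤ))) =
      semi S fun P => (0 : ℤ) + ((ord P z).toNat : ℤ) := by
    rw [mulSub_semi S hz0]
    ext f
    simp only [mem_semi]
    refine forall₂_congr fun P hP => ?_
    rw [Int.toNat_of_nonneg (hS P hP)]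
  rw [← h3, h1] at h2
  rw [← Nat.pow_right_injective le_rfl h2]
  exact hle

lemma finite_pos (z : K) : {P : Pl K | 0 < ord P z}.Finite := by
  by_cases hz : Transcendental 𝔽 z
  · by_contra hinf
    obtain ⟨S, hS, hc⟩ := Set.Infinite.exists_subset_card_eq hinf (dg z + 1)
    have h1 := sum_ord_le hz S (fun P hP => (hS hP).le)
    have h2 : ∑ P ∈ S, 1 ≤ ∑ P ∈ S, (ord P z).toNat * deg P := by
      refine Finset.sum_le_sum fun P hP => ?_
      have h3 : 0 < ord P z := hS hP
      have : 0 < (ord P z).toNat := by omega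
      exact Nat.mul_pos this (deg_pos P)
    rw [Finset.sum_const, hc, smul_eq_mul, mul_one] at h2
    omega
  · rw [transcendental_iff, not_and_or, not_not, not_not] at hz
    rcases hz with rfl | rfl <;> simp

lemma finite_ord (z : K) : (Function.support fun P : Pl K => ord P z).Finite := by
  refine ((finite_pos z).union (finite_pos z⁻¹)).subset fun P hP => ?_
  have : ord P z ≠ 0 := hP
  simp only [Set.mem_union, Set.mem_ofPred_eq, ord_inv]
  omega

/-- Divisors of a function field over `𝔽₂`. -/
abbrev Dv (K : Type) [Field K] [Algebra 𝔽 K] := Divisor 𝔽 K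

/-- The divisor of a function. -/
def dv (z : K) : Dv K := Finsupp.ofSupportFinite (fun P => ord P z) (finite_ord z)

@[simp] lemma dv_apply (z : K) (P : Pl K) : dv z P = ord P z := rfl

lemma dv_mul {f g : K} (hf : f ≠ 0) (hg : g ≠ 0) : dv (f * g) = dv f + dv g := by
  ext P; exact ord_mul P hf hg

lemma dv_inv (f : K) : dv f⁻¹ = -dv f := by
  ext P; exact ord_inv P f

lemma dv_pow (f : K) (n : ℕ) : dv (f ^ n) = n • dv f := by
  ext P
  rw [Finsupp.smul_apply, dv_apply, ord_pow, nsmul_eq_mul]; rfl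

/-- The zero divisor of a function. -/
def zdv (z : K) : Dv K := (dv z).mapRange (fun n => max n 0) (by simp)

@[simp] lemma zdv_apply (z : K) (P : Pl K) : zdv z P = max (ord P z) 0 := by
  simp [zdv]

lemma zdv_nonneg (z : K) : 0 ≤ zdv z := fun P => by simp

lemma zdv_sub (z : K) : dv z = zdv z - zdv z⁻¹ := by
  ext P
  simp only [dv_apply, Finsupp.sub_apply, zdv_apply, ord_inv]
  omega

/-- The degree of a divisor. -/
def degD : Dv K →+ ℤ := degHom 𝔽 K

@[simp] lemma degD_single (P : Pl K) (n : ℤ) : degD (Finsupp.single P n : Dv K) = n * deg P := by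
  simp [degD, degHom, deg]

lemma degD_eq_sum (D : Dv K) (S : Finset (Pl K)) (h : D.support ⊆ S) :
    degD D = ∑ P ∈ S, D P * deg P := by
  have : degD D = D.sum fun P n => n * (deg P : ℤ) := by
    simp [degD, degHom, deg, Finsupp.sum]
  rw [this]
  exact Finsupp.sum_of_support_subset _ h _ (by simp)

lemma degD_nonneg {D : Dv K} (hD : 0 ≤ D) : 0 ≤ degD D := by
  rw [degD_eq_sum D _ subset_rfl]
  exact Finset.sum_nonneg fun P _ => mul_nonneg (hD P) (by positivity)

lemma degD_mono {D E : Dv K} (h : D ≤ E) : degD D ≤ degD E := by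
  have := degD_nonneg (sub_nonneg.2 h)
  rw [map_sub] at this; omega

lemma degD_ge {D : Dv K} (hD : 0 ≤ D) (P : Pl K) : D P * deg P ≤ degD D := by
  rw [← degD_single]
  refine degD_mono fun Q => ?_
  rw [Finsupp.single_apply]
  split_ifs with h
  · rw [h]
  · exact hD Q

lemma eq_zero_of_degD {D : Dv K} (hD : 0 ≤ D) (h : degD D = 0) : D = 0 := by
  ext P
  have h1 := degD_ge hD P
  have h2 := deg_pos P
  have h3 : 0 ≤ D P := hD P
  rw [h] at h1
  have : (0 : ℤ) < deg P := by exact_mod_cast h2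
  simp only [Finsupp.coe_zero, Pi.zero_apply]
  nlinarith

lemma single_nonneg' (P : Pl K) : (0 : Dv K) ≤ Finsupp.single P 1 := by
  intro Q
  rw [Finsupp.single_apply]
  split_ifs <;> simp

lemma divisor_induction {p : Dv K → Prop} (h0 : p 0)
    (h1 : ∀ D P, 0 ≤ D → p D → p (D + Finsupp.single P 1)) : ∀ D, 0 ≤ D → p D := by
  have key : ∀ (n : ℕ) (D : Dv K), 0 ≤ D → degD D ≤ n → p D := by
    intro n
    induction n with
    | zero =>
      intro D hD hn
      rw [eq_zero_of_degD hD (le_antisymm (by simpa using hn) (degD_nonneg hD))]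
      exact h0
    | succ n ih =>
      intro D hD hn
      by_cases hz : D = 0
      · rw [hz]; exact h0
      obtain ⟨P, hP⟩ := Finsupp.ne_iff.1 hz
      have hP' : 0 ≤ D P := hD P
      simp only [Finsupp.coe_zero, Pi.zero_apply] at hP
      have hD' : 0 ≤ D - Finsupp.single P 1 := by
        intro Q
        have hQ : 0 ≤ D Q := hD Q
        simp only [Finsupp.coe_zero, Pi.zero_apply, Finsupp.sub_apply, Finsupp.single_apply]
        split_ifs with h
        · subst h; omega
        · omega
      have := h1 _ P hD' (ih _ hD' (by
        rw [map_sub, degD_single]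
        have := deg_pos P
        push_cast at hn
        omega))
      rwa [sub_add_cancel] at this
  exact fun D hD => key (degD D).toNat D hD (by omega)

/-- The Riemann-Roch space of a divisor. -/
def Lsp (D : Dv K) : Submodule 𝔽 K := ⨅ P : Pl K, pw P (-D P)

lemma mem_Lsp {D : Dv K} {f : K} : f ∈ Lsp D ↔ ∀ P, f ∈ pw P (-D P) := by simp [Lsp]

lemma mem_Lsp_of_ne {D : Dv K} {f : K} (hf : f ≠ 0) : f ∈ Lsp D ↔ 0 ≤ dv f + D := by
  rw [mem_Lsp]
  refine forall_congr' fun P => ?_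
  rw [mem_pw_of_ne hf]
  simp only [Finsupp.coe_zero, Pi.zero_apply, Finsupp.add_apply, dv_apply]
  omega

lemma RRspace_eq (D : Dv K) : RRspace 𝔽 D = Lsp D := by
  refine le_antisymm (Submodule.span_le.2 fun f hf => ?_) fun f hf => ?_
  · refine mem_Lsp.2 fun P => mem_pw.2 (Or.inr ?_)
    have := hf P
    change 0 ≤ D P + ord P f at this
    omega
  · by_cases h0 : f = 0
    · rw [h0]; exact Submodule.zero_mem _
    refine Submodule.subset_span fun P => ?_
    have := (mem_pw_of_ne h0).1 (mem_Lsp.1 hf P)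
    change 0 ≤ D P + ord P f
    omega

lemma Lsp_mono {D E : Dv K} (h : D ≤ E) : Lsp D ≤ Lsp E := fun f hf => mem_Lsp.2 fun P =>
  pw_anti (by have : D P ≤ E P := h P; omega) (mem_Lsp.1 hf P)

lemma Lsp_inf (D : Dv K) (P : Pl K) :
    Lsp D = pw P (-D P) ⊓ Lsp (D + Finsupp.single P 1) := by
  ext f
  refine ⟨fun h => ⟨mem_Lsp.1 h P, Lsp_mono ?_ h⟩, fun h => mem_Lsp.2 fun Q => ?_⟩
  · exact le_add_of_nonneg_right (single_nonneg' P)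
  · by_cases hQ : P = Q
    · rw [← hQ]; exact h.1
    · have := mem_Lsp.1 h.2 Q
      simpa [Finsupp.single_apply, hQ] using this

lemma ix_Lsp_single (D : Dv K) (P : Pl K) :
    ix (Lsp D) (Lsp (D + Finsupp.single P 1)) ≤ 2 ^ deg P ∧
      ix (Lsp D) (Lsp (D + Finsupp.single P 1)) ≠ 0 := by
  have h := ix_pw_succ P (-D P - 1)
  rw [sub_add_cancel] at h
  have hle : Lsp (D + Finsupp.single P 1) ≤ pw P (-D P - 1) := fun f hf => by
    have := mem_Lsp.1 hf P
    rw [Finsupp.add_apply, Finsupp.single_eq_same] at this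
    convert this using 2
    ring
  rw [Lsp_inf D P, ix_inf]
  have h0 : ix (pw P (-D P)) (pw P (-D P - 1)) ≠ 0 := by rw [h]; positivity
  exact ⟨h ▸ ix_le_right hle h0, ix_ne_zero_right hle h0⟩

lemma ix_Lsp (D E : Dv K) (hE : 0 ≤ E) :
    ix (Lsp D) (Lsp (D + E)) ≤ 2 ^ (degD E).toNat ∧ ix (Lsp D) (Lsp (D + E)) ≠ 0 := by
  refine divisor_induction (p := fun E => ix (Lsp D) (Lsp (D + E)) ≤ 2 ^ (degD E).toNat ∧
    ix (Lsp D) (Lsp (D + E)) ≠ 0) (by simp [ix_self]) (fun E P hE ih => ?_) E hE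
  · have h := ix_Lsp_single (D + E) P
    rw [← add_assoc, ← ix_trans (B := Lsp (D + E)) (Lsp_mono (le_add_of_nonneg_right hE))
      (Lsp_mono (le_add_of_nonneg_right (single_nonneg' P)))]
    refine ⟨?_, mul_ne_zero ih.2 h.2⟩
    rw [map_add, degD_single, one_mul, Int.toNat_add (degD_nonneg hE) (by positivity),
      Int.toNat_natCast, pow_add]
    exact Nat.mul_le_mul ih.1 h.1

lemma exists_place_pos {z : K} (hz : Transcendental 𝔽 z) : ∃ P : Pl K, 0 < ord P z := by
  have hz0 : z ≠ 0 := (transcendental_iff.1 hz).1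
  let A : Subring K := (Algebra.adjoin 𝔽 {z}).toSubring
  have hzA : z ∈ A := Algebra.subset_adjoin (Set.mem_singleton z)
  have hI : Ideal.span {(⟨z, hzA⟩ : A)} ≠ ⊤ := by
    intro h
    rw [Ideal.span_singleton_eq_top] at h
    obtain ⟨⟨b, hb⟩, hb1⟩ := h.exists_right_inv
    have hb' : b ∈ Algebra.adjoin 𝔽 {z} := hb
    rw [Algebra.adjoin_singleton_eq_range_aeval] at hb'
    obtain ⟨p, rfl⟩ := hb'
    have h1 : z * aeval z p = 1 := congrArg Subtype.val hb1
    have h2 : aeval z (X * p - 1 : 𝔽[X]) = 0 := by simp [h1]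
    have h3 := (transcendental_iff_injective.1 hz) (h2.trans (map_zero _).symm)
    have := congrArg (Polynomial.eval 0) h3
    simp at this
  obtain ⟨B, hAB, hB⟩ := Ideal.image_subset_nonunits_valuationSubring _ hI
  have hzB : z ∈ B.nonunits := hB ⟨⟨z, hzA⟩, Ideal.subset_span rfl, rfl⟩
  obtain ⟨hzB', hmax⟩ := ValuationSubring.mem_nonunits_iff_exists_mem_maximalIdeal.1 hzB
  have hT : B ≠ ⊤ := by
    rintro rfl
    have hu : IsUnit (⟨z, hzB'⟩ : (⊤ : ValuationSubring K)) :=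
      IsUnit.of_mul_eq_one ⟨z⁻¹, trivial⟩ (Subtype.ext (mul_inv_cancel₀ hz0))
    exact (IsLocalRing.mem_maximalIdeal _).1 hmax hu
  refine ⟨⟨B, isPlace_iff.2 hT⟩, ?_⟩
  have := (mem_maximalIdeal_iff (P := ⟨B, isPlace_iff.2 hT⟩) ⟨z, hzB'⟩).1 hmax
  have := (mem_pw_of_ne hz0).1 this
  omega

lemma mem_Lsp_zero {f : K} : f ∈ Lsp (0 : Dv K) ↔ f = 0 ∨ f = 1 := by
  constructor
  · intro h
    by_contra hcon
    push Not at hcon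
    have ht := (transcendental_iff.2 hcon)
    have ht' : Transcendental 𝔽 f⁻¹ := by
      rw [transcendental_iff] at ht ⊢; simpa using ht
    obtain ⟨P, hP⟩ := exists_place_pos ht'
    have := (mem_pw_of_ne hcon.1).1 (mem_Lsp.1 h P)
    rw [ord_inv] at hP
    simp at this
    omega
  · rintro (rfl | rfl)
    · exact Submodule.zero_mem _
    · exact mem_Lsp.2 fun P => by simpa using one_mem_pw P

lemma card_Lsp_zero : Nat.card (Lsp (0 : Dv K)) = 2 := by
  have : ((Lsp (0 : Dv K) : Submodule 𝔽 K) : Set K) = {0, 1} := by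
    ext f; exact mem_Lsp_zero
  change Nat.card ((Lsp (0 : Dv K) : Submodule 𝔽 K) : Set K) = 2
  rw [this, Nat.card_coe_set_eq, Set.ncard_pair zero_ne_one]

/-- The dimension of the Riemann-Roch space. -/
def el (D : Dv K) : ℕ := ell 𝔽 D

lemma el_eq (D : Dv K) : el D = Module.finrank 𝔽 (Lsp D) := by
  rw [el, ell, RRspace_eq]

lemma finite_Lsp_nonneg {D : Dv K} (hD : 0 ≤ D) : Finite (Lsp D) := by
  have h := ix_Lsp 0 D hD
  have h2 := ix_trans (A := ⊥) (bot_le) (Lsp_mono hD)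
  rw [ix_bot, ix_bot, card_Lsp_zero] at h2
  rw [zero_add] at h
  refine Nat.finite_of_card_ne_zero ?_
  rw [← h2]
  exact mul_ne_zero (by norm_num) h.2

/-- The positive part of a divisor. -/
def posD (D : Dv K) : Dv K := D.mapRange (fun n => max n 0) (by simp)

lemma posD_nonneg (D : Dv K) : 0 ≤ posD D := fun P => by simp [posD]

lemma le_posD (D : Dv K) : D ≤ posD D := fun P => by simp [posD]

instance finite_Lsp (D : Dv K) : Finite (Lsp D) := by
  have := finite_Lsp_nonneg (posD_nonneg D)
  exact Finite.of_injective (Submodule.inclusion (Lsp_mono (le_posD D)))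
    (Submodule.inclusion_injective _)

lemma card_Lsp (D : Dv K) : Nat.card (Lsp D) = 2 ^ el D := by
  rw [el_eq, Module.natCard_eq_pow_finrank (K := 𝔽), Nat.card_zmod]

lemma el_mono {D E : Dv K} (h : D ≤ E) : el D ≤ el E := by
  rw [el_eq, el_eq]
  exact Submodule.finrank_mono (Lsp_mono h)

lemma pow_el (D E : Dv K) (h : D ≤ E) : 2 ^ el D * ix (Lsp D) (Lsp E) = 2 ^ el E := by
  have h2 := ix_trans (A := ⊥) (bot_le) (Lsp_mono h)
  rwa [ix_bot, ix_bot, card_Lsp, card_Lsp] at h2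

lemma el_add_le (D E : Dv K) (hE : 0 ≤ E) : (el (D + E) : ℤ) ≤ el D + degD E := by
  have h1 := pow_el D (D + E) (le_add_of_nonneg_right hE)
  have h2 := ix_Lsp D E hE
  have h3 : 2 ^ el (D + E) ≤ 2 ^ (el D + (degD E).toNat) := by
    rw [← h1, pow_add]; exact Nat.mul_le_mul_left _ h2.1
  have := (Nat.pow_le_pow_iff_right (by norm_num)).1 h3
  have := degD_nonneg hE
  omega

lemma el_zero : el (0 : Dv K) = 1 := by
  have := card_Lsp (0 : Dv K)
  rw [card_Lsp_zero] at this
  exact (Nat.pow_right_injective le_rfl (by simpa using this)).symm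

lemma el_le {D : Dv K} (hD : 0 ≤ D) : (el D : ℤ) ≤ degD D + 1 := by
  have := el_add_le 0 D hD
  rw [zero_add, el_zero] at this
  push_cast at this
  omega

lemma adjoin_inv (z : K) : 𝔽⟮z⁻¹⟯ = 𝔽⟮z⟯ := by
  refine le_antisymm ?_ ?_ <;> rw [adjoin_simple_le_iff]
  · exact inv_mem (mem_adjoin_simple_self _ _)
  · have := inv_mem (mem_adjoin_simple_self 𝔽 z⁻¹)
    rwa [inv_inv] at this

lemma dg_inv (z : K) : dg z⁻¹ = dg z := by rw [dg, dg, adjoin_inv]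

lemma transcendental_inv {z : K} (hz : Transcendental 𝔽 z) : Transcendental 𝔽 z⁻¹ := by
  rw [transcendental_iff] at hz ⊢; simpa using hz

lemma degD_zdv_le {z : K} (hz : Transcendental 𝔽 z) : degD (zdv z) ≤ dg z := by
  let S := (finite_pos z).toFinset
  have h := sum_ord_le hz S (fun P hP => by
    have : 0 < ord P z := by simpa [S] using hP
    omega)
  rw [degD_eq_sum _ S]
  · have : ∑ P ∈ S, zdv z P * (deg P : ℤ) = ((∑ P ∈ S, (ord P z).toNat * deg P : ℕ) : ℤ) := by
      push_cast
      refine Finset.sum_congr rfl fun P _ => ?_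
      rw [zdv_apply, Int.ofNat_toNat]
    rw [this]; exact_mod_cast h
  · intro P hP
    rw [Finsupp.mem_support_iff, zdv_apply] at hP
    simp only [S, Set.Finite.mem_toFinset, Set.mem_ofPred_eq]
    omega

/-- The number of poles of a nonconstant function `z` is the degree of `K` over `𝔽₂(z)`. -/
lemma degD_pole {z : K} (hz : Transcendental 𝔽 z) : degD (zdv z⁻¹) = dg z := by
  refine le_antisymm (dg_inv z ▸ degD_zdv_le (transcendental_inv hz)) ?_
  have := finite_over_adjoin hz
  have hz0 : z ≠ 0 := (transcendental_iff.1 hz).1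
  let u := Module.finBasis 𝔽⟮z⟯ K
  let C : Dv K := ∑ i, zdv (u i)⁻¹
  have hC : 0 ≤ C := Finset.sum_nonneg fun i _ => zdv_nonneg _
  set B := zdv z⁻¹
  have hB : 0 ≤ B := zdv_nonneg _
  have key : ∀ l : ℕ, ((l : ℤ) + 1) * dg z ≤ l * degD B + degD C + 1 := by
    intro l
    let zz : 𝔽⟮z⟯ := AdjoinSimple.gen 𝔽 z
    have hpow : LinearIndependent 𝔽 (fun j : Fin (l + 1) => zz ^ (j : ℕ)) := by
      have h1 : LinearIndependent 𝔽 (fun j : ℕ => z ^ j) := by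
        have h2 := (Polynomial.basisMonomials 𝔽).linearIndependent.map'
          ((aeval z : 𝔽[X] →ₐ[𝔽] K).toLinearMap)
          (LinearMap.ker_eq_bot.2 (transcendental_iff_injective.1 hz))
        have e : (fun j : ℕ => z ^ j) =
            ⇑((aeval z : 𝔽[X] →ₐ[𝔽] K).toLinearMap) ∘ ⇑(Polynomial.basisMonomials 𝔽) := by
          funext j; simp
        rw [e]; exact h2
      have h3 : LinearIndependent 𝔽 (fun j : Fin (l + 1) => z ^ (j : ℕ)) :=
        h1.comp _ Fin.val_injective
      refine LinearIndependent.of_comp (𝔽⟮z⟯.val.toLinearMap) ?_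
      exact h3
    have hli := linearIndependent_smul hpow u.linearIndependent
    let w : Fin (l + 1) × Fin (Module.finrank 𝔽⟮z⟯ K) → Lsp (l • B + C) := fun p =>
      ⟨zz ^ (p.1 : ℕ) • u p.2, by
        have hu0 : u p.2 ≠ 0 := u.ne_zero _
        have e : zz ^ (p.1 : ℕ) • u p.2 = z ^ (p.1 : ℕ) * u p.2 := by
          rw [Algebra.smul_def]; simp [zz]
        rw [e, mem_Lsp_of_ne (mul_ne_zero (pow_ne_zero _ hz0) hu0),
          dv_mul (pow_ne_zero _ hz0) hu0, dv_pow]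
        intro P
        have h1 : zdv (u p.2)⁻¹ ≤ C := Finset.single_le_sum
          (f := fun i => zdv (u i)⁻¹) (fun i _ => zdv_nonneg _) (Finset.mem_univ p.2)
        have h2 := h1 P
        have h3 : (p.1 : ℕ) ≤ l := by omega
        simp only [zdv_apply, ord_inv, Finsupp.coe_zero, Pi.zero_apply, Finsupp.add_apply,
          Finsupp.smul_apply, dv_apply, B, nsmul_eq_mul] at h2 ⊢
        have h4 : ((p.1 : ℕ) : ℤ) ≤ l := by exact_mod_cast h3
        have h5 : 0 ≤ ((p.1 : ℕ) : ℤ) := by positivity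
        have h6 : 0 ≤ ((p.1 : ℕ) : ℤ) * ord P z + (l : ℤ) * max (-ord P z) 0 := by
          rcases le_total 0 (ord P z) with h | h
          · rw [max_eq_right (by omega)]; nlinarith
          · rw [max_eq_left (by omega)]; nlinarith
        have h7 := le_max_left (-ord P (u p.2)) 0
        linarith⟩
    have hw : LinearIndependent 𝔽 w := LinearIndependent.of_comp (Lsp (l • B + C)).subtype hli
    have h1 := hw.fintype_card_le_finrank
    rw [← el_eq, Fintype.card_prod, Fintype.card_fin, Fintype.card_fin] at h1
    have h2 := el_le (D := l • B + C) (add_nonneg (nsmul_nonneg hB l) hC)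
    rw [map_add, map_nsmul, nsmul_eq_mul] at h2
    have h3 : (((l + 1) * dg z : ℕ) : ℤ) ≤ (el (l • B + C) : ℤ) := by exact_mod_cast h1
    push_cast at h3
    linarith
  by_contra hcon
  push Not at hcon
  have h1 := key (degD C + 1).toNat
  have h2 := degD_nonneg hC
  rw [Int.toNat_of_nonneg (by omega)] at h1
  have h3 := mul_nonneg (by omega : 0 ≤ degD C + 1) (by omega : 0 ≤ (dg z : ℤ) - degD B - 1)
  have h4 := degD_nonneg hB
  nlinarith

lemma degD_zero' {z : K} (hz : Transcendental 𝔽 z) : degD (zdv z) = dg z := by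
  have := degD_pole (transcendental_inv hz)
  rwa [inv_inv, dg_inv] at this

lemma degD_dv (z : K) : degD (dv z) = 0 := by
  by_cases hz : Transcendental 𝔽 z
  · rw [zdv_sub, map_sub, degD_zero' hz, degD_pole hz, sub_self]
  · rw [transcendental_iff, not_and_or, not_not, not_not] at hz
    have : dv z = 0 := by ext P; rcases hz with rfl | rfl <;> simp
    rw [this, map_zero]

end Divisors

section Adeles

variable {K : Type} [Field K] [Algebra 𝔽 K] [CongFF K]

/-- The space of repartitions. -/
def adl (K : Type) [Field K] [Algebra 𝔽 K] : Submodule 𝔽 (Pl K → K) where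
  carrier := {α | {P : Pl K | α P ∉ P.1}.Finite}
  add_mem' {a b} ha hb := by
    refine (Set.Finite.union ha hb).subset fun P hP => ?_
    by_contra hcon
    simp only [Set.mem_union, Set.mem_ofPred_eq, not_or, not_not] at hcon
    exact hP (P.1.add_mem _ _ hcon.1 hcon.2)
  zero_mem' := by
    refine Set.finite_empty.subset fun P hP => ?_
    exact absurd P.1.zero_mem hP
  smul_mem' c a ha := by
    refine Set.Finite.subset ha fun P hP => ?_
    by_contra hcon
    simp only [Set.mem_ofPred_eq, not_not] at hcon
    refine hP ?_
    rw [Pi.smul_apply, Algebra.smul_def]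
    exact P.1.mul_mem _ _ (P.2.2 c) hcon

lemma finite_not_mem (f : K) : {P : Pl K | f ∉ P.1}.Finite := by
  refine (finite_pos f⁻¹).subset fun P hP => ?_
  have hf : f ≠ 0 := by rintro rfl; exact hP P.1.zero_mem
  have hP' : f ∉ P.1 := hP
  rw [mem_iff_ord P hf] at hP'
  simp only [Set.mem_ofPred_eq, ord_inv]
  omega

/-- Principal repartitions. -/
def dgl (K : Type) [Field K] [Algebra 𝔽 K] [CongFF K] : K →ₗ[𝔽] adl K where
  toFun f := ⟨fun _ => f, finite_not_mem f⟩
  map_add' _ _ := rfl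
  map_smul' _ _ := rfl

@[simp] lemma dgl_apply (f : K) (P : Pl K) : (dgl K f : Pl K → K) P = f := rfl

/-- Multiplication of repartitions by functions. -/
def mulA (f : K) : adl K →ₗ[𝔽] adl K where
  toFun α := ⟨fun P => f * (α : Pl K → K) P, by
    refine ((finite_not_mem f).union α.2).subset fun P hP => ?_
    by_contra hcon
    simp only [Set.mem_union, Set.mem_ofPred_eq, not_or, not_not] at hcon
    exact hP (P.1.mul_mem _ _ hcon.1 hcon.2)⟩
  map_add' a b := Subtype.ext (funext fun P => mul_add _ _ _)
  map_smul' c a := Subtype.ext (funext fun P => mul_smul_comm _ _ _)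

@[simp] lemma mulA_apply (f : K) (α : adl K) (P : Pl K) :
    (mulA f α : Pl K → K) P = f * (α : Pl K → K) P := rfl

/-- The repartitions bounded by a divisor. -/
def AD (D : Dv K) : Submodule 𝔽 (adl K) :=
  ⨅ P : Pl K, (pw P (-D P)).comap ((LinearMap.proj P).comp (adl K).subtype)

lemma mem_AD {D : Dv K} {α : adl K} : α ∈ AD D ↔ ∀ P, (α : Pl K → K) P ∈ pw P (-D P) := by
  simp [AD]

lemma AD_mono {D E : Dv K} (h : D ≤ E) : AD D ≤ AD E := fun α hα => mem_AD.2 fun P =>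
  pw_anti (by have : D P ≤ E P := h P; omega) (mem_AD.1 hα P)

/-- The repartition with a single entry. -/
def sgl (P : Pl K) : K →ₗ[𝔽] adl K where
  toFun f := ⟨fun Q => if Q = P then f else 0, by
    refine (Set.finite_singleton P).subset fun Q hQ => ?_
    by_contra hne
    simp only [Set.mem_singleton_iff] at hne
    refine hQ ?_
    simp only [if_neg hne]
    exact Q.1.zero_mem⟩
  map_add' a b := Subtype.ext (funext fun Q => by
    simp only [Submodule.coe_add, Pi.add_apply]; split_ifs <;> simp)
  map_smul' a b := Subtype.ext (funext fun Q => by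
    simp only [Submodule.coe_smul, Pi.smul_apply, RingHom.id_apply]; split_ifs <;> simp)

lemma sgl_apply (P Q : Pl K) (f : K) : (sgl P f : Pl K → K) Q = if Q = P then f else 0 := rfl

@[simp] lemma sgl_same (P : Pl K) (f : K) : (sgl P f : Pl K → K) P = f := if_pos rfl

lemma ix_AD_single (D : Dv K) (P : Pl K) :
    ix (AD D) (AD (D + Finsupp.single P 1)) = 2 ^ deg P := by
  have h := ix_pw_succ P (-D P - 1)
  rw [sub_add_cancel] at h
  let π : adl K →ₗ[𝔽] K := (LinearMap.proj P).comp (adl K).subtype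
  have h1 : AD D = (pw P (-D P)).comap π ⊓ AD (D + Finsupp.single P 1) := by
    ext α
    refine ⟨fun hα => ⟨mem_AD.1 hα P, AD_mono (le_add_of_nonneg_right (single_nonneg' P)) hα⟩,
      fun hα => mem_AD.2 fun Q => ?_⟩
    by_cases hQ : P = Q
    · rw [← hQ]; exact hα.1
    · have := mem_AD.1 hα.2 Q
      simpa [Finsupp.single_apply, hQ] using this
  have h2 : (AD (D + Finsupp.single P 1)).map π = pw P (-D P - 1) := by
    ext f
    constructor
    · rintro ⟨α, hα, rfl⟩
      have := mem_AD.1 hα P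
      rw [Finsupp.add_apply, Finsupp.single_eq_same] at this
      have e : -(D P + 1) = -D P - 1 := by ring
      rw [e] at this
      exact this
    · intro hf
      refine ⟨sgl P f, mem_AD.2 fun Q => ?_, sgl_same P f⟩
      rw [sgl_apply]
      split_ifs with hQ
      · rw [hQ, Finsupp.add_apply, Finsupp.single_eq_same]
        convert hf using 2
        ring
      · exact Submodule.zero_mem _
  rw [h1, ix_inf, ix_comap, h2, h]

lemma ix_AD (D E : Dv K) (hE : 0 ≤ E) : ix (AD D) (AD (D + E)) = 2 ^ (degD E).toNat := by
  refine divisor_induction (p := fun E => ix (AD D) (AD (D + E)) = 2 ^ (degD E).toNat)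
    (by simp [ix_self]) (fun E P hE ih => ?_) E hE
  rw [← add_assoc, ← ix_trans (B := AD (D + E)) (AD_mono (le_add_of_nonneg_right hE))
    (AD_mono (le_add_of_nonneg_right (single_nonneg' P))), ih, ix_AD_single,
    map_add, degD_single, one_mul, Int.toNat_add (degD_nonneg hE) (by positivity),
    Int.toNat_natCast, pow_add]

/-- The sum of the bounded and the principal repartitions. -/
def SD (D : Dv K) : Submodule 𝔽 (adl K) := AD D ⊔ LinearMap.range (dgl K)

lemma comap_dgl (D : Dv K) : (AD D).comap (dgl K) = Lsp D := by
  ext f; simp [mem_AD, mem_Lsp]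

lemma SD_mono {D E : Dv K} (h : D ≤ E) : SD D ≤ SD E := sup_le_sup_right (AD_mono h) _

lemma ix_SD (D E : Dv K) (hE : 0 ≤ E) :
    ix (SD D) (SD (D + E)) * ix (Lsp D) (Lsp (D + E)) = 2 ^ (degD E).toNat := by
  have hle : AD D ≤ AD (D + E) := AD_mono (le_add_of_nonneg_right hE)
  have h1 : SD (D + E) = SD D ⊔ AD (D + E) := by
    rw [SD, SD, sup_right_comm, sup_eq_right.2 hle]
  have h2 : SD D ⊓ AD (D + E) = AD D ⊔ (Lsp (D + E)).map (dgl K) := by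
    rw [SD, sup_inf_assoc_of_le _ hle, ← comap_dgl, Submodule.map_comap_eq]
  have h3 : ix (AD D) (SD D ⊓ AD (D + E)) = ix (Lsp D) (Lsp (D + E)) := by
    rw [h2, ix_sup, ← ix_comap, comap_dgl]
  rw [h1, ix_sup, ← ix_inf, ← h3, mul_comm, ix_trans _ inf_le_right, ix_AD D E hE]
  exact le_inf le_sup_left hle

end Adeles

/-- A function field of positive genus. -/
class PosGenus (K : Type) [Field K] [Algebra 𝔽 K] : Prop extends CongFF K where
  genus_ne : genus 𝔽 K ≠ 0

section RiemannRoch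

variable {K : Type} [Field K] [Algebra 𝔽 K] [PosGenus K]

/-- The genus. -/
def gn (K : Type) [Field K] [Algebra 𝔽 K] : ℕ := genus 𝔽 K

lemma gn_pos : 0 < gn K := Nat.pos_of_ne_zero PosGenus.genus_ne

lemma genus_set : BddAbove {g : ℕ | ∃ D : Dv K, (g : ℤ) = degHom 𝔽 K D + 1 - ell 𝔽 D} := by
  by_contra h
  exact PosGenus.genus_ne (K := K) (Nat.sSup_of_not_bddAbove h)

/-- Riemann's inequality. -/
lemma riemann (D : Dv K) : degD D + 1 - el D ≤ gn K := by
  by_contra h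
  push Not at h
  have h1 : ((degD D + 1 - el D).toNat : ℤ) = degD D + 1 - el D := by omega
  have h2 := le_csSup (genus_set (K := K)) ⟨D, h1⟩
  have h3 : (degD D + 1 - el D).toNat ≤ gn K := h2
  omega

lemma exists_attain : ∃ D : Dv K, degD D + 1 - el D = gn K := by
  have hne : {g : ℕ | ∃ D : Dv K, (g : ℤ) = degHom 𝔽 K D + 1 - ell 𝔽 D}.Nonempty := by
    by_contra h
    rw [Set.not_nonempty_iff_eq_empty] at h
    refine PosGenus.genus_ne (K := K) ?_
    rw [genus, h, Nat.sSup_def ⟨0, by simp⟩]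
    simp
  obtain ⟨D, hD⟩ := Nat.sSup_mem hne genus_set
  exact ⟨D, hD.symm⟩

lemma pow_mul_ix (D E : Dv K) (hE : 0 ≤ E) :
    ix (SD D) (SD (D + E)) * 2 ^ el (D + E) = 2 ^ ((degD E).toNat + el D) := by
  rw [← pow_el D (D + E) (le_add_of_nonneg_right hE), mul_left_comm, ix_SD D E hE, pow_add, mul_comm]

lemma exists_SD_top : ∃ D : Dv K, SD D = ⊤ ∧ ∀ E : Dv K, 0 ≤ E →
    degD (D + E) + 1 - el (D + E) = gn K := by
  obtain ⟨D, hD⟩ := exists_attain (K := K)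
  have key : ∀ E : Dv K, 0 ≤ E → ix (SD D) (SD (D + E)) = 1 ∧
      degD (D + E) + 1 - el (D + E) = gn K := by
    intro E hE
    have h1 := pow_mul_ix D E hE
    have h2 := riemann (D + E)
    rw [map_add] at h2
    have h3 : (degD E).toNat + el D ≤ el (D + E) := by
      have := degD_nonneg hE; omega
    have h4 : 2 ^ ((degD E).toNat + el D) ≤ 2 ^ el (D + E) := Nat.pow_le_pow_right (by norm_num) h3
    have h5 : 0 < 2 ^ el (D + E) := by positivity
    have h6 : ix (SD D) (SD (D + E)) ≠ 0 := by
      intro h0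
      rw [h0, zero_mul] at h1
      exact absurd h1.symm (by positivity)
    have h7 : ix (SD D) (SD (D + E)) = 1 := by nlinarith [Nat.pos_of_ne_zero h6]
    rw [h7, one_mul] at h1
    have h8 : el (D + E) = (degD E).toNat + el D := Nat.pow_right_injective le_rfl h1
    refine ⟨h7, ?_⟩
    rw [map_add]
    have := degD_nonneg hE
    have h9 : (el (D + E) : ℤ) = degD E + el D := by omega
    omega
  refine ⟨D, eq_top_iff.2 fun α _ => ?_, fun E hE => (key E hE).2⟩
  let E : Dv K := Finsupp.ofSupportFinite
    (fun P => if (α : Pl K → K) P ∉ P.1 ∨ D P < 0 then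
      max (-ord P ((α : Pl K → K) P) - D P) 0 else 0) (by
      refine (α.2.union (D.support.finite_toSet)).subset fun P hP => ?_
      by_contra hcon
      simp only [Set.mem_union, not_or, Finset.mem_coe, Finsupp.mem_support_iff, not_not] at hcon
      refine hP ?_
      simp only
      rw [if_neg]
      rintro (h | h)
      · exact hcon.1 h
      · omega)
  have hv : ∀ P, E P = if (α : Pl K → K) P ∉ P.1 ∨ D P < 0 then
      max (-ord P ((α : Pl K → K) P) - D P) 0 else 0 := fun P => rfl
  have hE : 0 ≤ E := fun P => by
    rw [hv]
    split_ifs <;> simp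
  have h1 : α ∈ AD (D + E) := mem_AD.2 fun P => by
    rw [Finsupp.add_apply, hv]
    split_ifs with h
    · refine mem_pw.2 (Or.inr ?_)
      have := le_max_left (-ord P ((α : Pl K → K) P) - D P) 0
      linarith
    · push Not at h
      exact pw_anti (by omega) (mem_pw_zero.2 h.1)
  exact ix_eq_one.1 (key E hE).1 (le_sup_left (a := AD (D + E)) h1)

/-- The index of speciality. -/
def iD (D : Dv K) : ℕ := (el D + gn K - 1 - degD D).toNat

lemma iD_eq (D : Dv K) : (iD D : ℤ) = el D + gn K - 1 - degD D := by
  have := riemann D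
  rw [iD]; omega

lemma ix_SD_top (D : Dv K) : ix (SD D) ⊤ = 2 ^ iD D := by
  obtain ⟨D0, hD0, hatt⟩ := exists_SD_top (K := K)
  have h1 : SD (D + posD (D0 - D)) = ⊤ := by
    rw [eq_top_iff, ← hD0]
    refine SD_mono ?_
    have := le_posD (D0 - D)
    rwa [sub_le_iff_le_add, add_comm] at this
  have h2 := pow_mul_ix D _ (posD_nonneg (D0 - D))
  have h3 := hatt (D + posD (D0 - D) - D0) (by
    rw [sub_nonneg]
    have := le_posD (D0 - D)
    rwa [sub_le_iff_le_add, add_comm] at this)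
  rw [add_sub_cancel, map_add] at h3
  rw [h1] at h2
  have h4 := iD_eq D
  have h5 : (degD (posD (D0 - D))).toNat + el D = iD D + el (D + posD (D0 - D)) := by
    have := degD_nonneg (posD_nonneg (D0 - D))
    omega
  rw [h5, pow_add] at h2
  exact Nat.eq_of_mul_eq_mul_right (by positivity) h2

/-- The differentials bounded by a divisor. -/
def Om (D : Dv K) : Submodule 𝔽 (Module.Dual 𝔽 (adl K)) := (SD D).dualAnnihilator

lemma mem_Om {D : Dv K} {l : Module.Dual 𝔽 (adl K)} :
    l ∈ Om D ↔ (∀ α ∈ AD D, l α = 0) ∧ ∀ f, l (dgl K f) = 0 := by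
  rw [Om, Submodule.mem_dualAnnihilator]
  constructor
  · intro h
    exact ⟨fun α hα => h α (Submodule.mem_sup_left hα),
      fun f => h _ (Submodule.mem_sup_right ⟨f, rfl⟩)⟩
  · rintro ⟨h1, h2⟩ α hα
    obtain ⟨β, hβ, _, ⟨f, rfl⟩, rfl⟩ := Submodule.mem_sup.1 hα
    rw [map_add, h1 β hβ, h2, add_zero]

lemma finrank_Om (D : Dv K) : Module.Finite 𝔽 (Om D) ∧ Module.finrank 𝔽 (Om D) = iD D := by
  have h1 : Nat.card (adl K ⧸ SD D) = 2 ^ iD D := by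
    rw [← ix_SD_top, ix, Submodule.top_toAddSubgroup, AddSubgroup.relIndex_top_right]
    rfl
  have hfin : Finite (adl K ⧸ SD D) := Nat.finite_of_card_ne_zero (by rw [h1]; positivity)
  have : Module.Finite 𝔽 (adl K ⧸ SD D) := Module.Finite.of_finite
  have h2 := Module.natCard_eq_pow_finrank (K := 𝔽) (V := adl K ⧸ SD D)
  rw [h1, Nat.card_zmod] at h2
  have h3 := Nat.pow_right_injective le_rfl h2
  let e := (SD D).dualQuotEquivDualAnnihilator
  refine ⟨Module.Finite.equiv e, ?_⟩
  rw [Om, ← e.finrank_eq, Subspace.dual_finrank_eq]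
  exact h3.symm

end RiemannRoch

section Differentials

variable {K : Type} [Field K] [Algebra 𝔽 K]

lemma AD_sup [CongFF K] (D E : Dv K) : AD (D ⊔ E) ≤ AD D ⊔ AD E := by
  intro α hα
  let s : Set (Pl K) := {P | (α : Pl K → K) P ∈ pw P (-D P)}
  let β : adl K := ⟨fun P => if P ∈ s then (α : Pl K → K) P else 0, by
    refine Set.Finite.subset α.2 fun P hP => ?_
    by_contra hcon
    simp only [Set.mem_ofPred_eq, not_not] at hcon
    refine hP ?_
    simp only
    split_ifs
    · exact hcon
    · exact P.1.zero_mem⟩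
  have hβ : ∀ P, (β : Pl K → K) P = if P ∈ s then (α : Pl K → K) P else 0 := fun P => rfl
  refine Submodule.mem_sup.2 ⟨β, mem_AD.2 fun P => ?_, α - β, mem_AD.2 fun P => ?_, by abel⟩
  · rw [hβ]
    split_ifs with h
    · exact h
    · exact Submodule.zero_mem _
  · rw [Submodule.coe_sub, Pi.sub_apply, hβ]
    split_ifs with h
    · rw [sub_self]; exact Submodule.zero_mem _
    · rw [sub_zero]
      have h1 := mem_AD.1 hα P
      rw [Finsupp.sup_apply] at h1
      rcases le_total (D P) (E P) with h2 | h2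
      · rwa [sup_eq_right.2 h2] at h1
      · rw [sup_eq_left.2 h2] at h1
        exact absurd h1 h

variable [PosGenus K]

/-- The action of functions on differentials. -/
def act (f : K) (l : Module.Dual 𝔽 (adl K)) : Module.Dual 𝔽 (adl K) := l.comp (mulA f)

lemma act_apply (f : K) (l : Module.Dual 𝔽 (adl K)) (α : adl K) : act f l α = l (mulA f α) := rfl

lemma act_act (f h : K) (l : Module.Dual 𝔽 (adl K)) : act f (act h l) = act (h * f) l := by
  ext α
  simp only [act_apply]
  congr 1
  exact Subtype.ext (funext fun P => (mul_assoc _ _ _).symm)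

lemma act_one (l : Module.Dual 𝔽 (adl K)) : act 1 l = l := by
  ext α
  simp only [act_apply]
  congr 1
  exact Subtype.ext (funext fun P => one_mul _)

/-- The action as a linear map in the function. -/
def actL (l : Module.Dual 𝔽 (adl K)) : K →ₗ[𝔽] Module.Dual 𝔽 (adl K) where
  toFun f := act f l
  map_add' f h := by
    ext α
    simp only [act_apply, LinearMap.add_apply, ← map_add]
    congr 1
    exact Subtype.ext (funext fun P => add_mul _ _ _)
  map_smul' c f := by
    ext α
    simp only [act_apply, LinearMap.smul_apply, ← map_smul]
    congr 1
    exact Subtype.ext (funext fun P =>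
      (smul_mul_assoc c f ((α : Pl K → K) P)).trans (mul_smul_comm c f _).symm)

lemma actL_apply (l : Module.Dual 𝔽 (adl K)) (f : K) : actL l f = act f l := rfl

lemma act_ne {f : K} (hf : f ≠ 0) {l : Module.Dual 𝔽 (adl K)} (hl : l ≠ 0) : act f l ≠ 0 := by
  intro h
  apply hl
  rw [← act_one l, ← mul_inv_cancel₀ hf, ← act_act, h]
  rfl

lemma act_mem (f : K) {l : Module.Dual 𝔽 (adl K)} {D : Dv K} (hl : l ∈ Om D) :
    act f l ∈ Om (D + dv f) := by
  rw [mem_Om] at hl ⊢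
  refine ⟨fun α hα => hl.1 _ (mem_AD.2 fun P => ?_), fun h => hl.2 (f * h)⟩
  have h1 := pw_mul (mem_pw_ord P f) (mem_AD.1 hα P)
  rw [Finsupp.add_apply, dv_apply] at h1
  exact pw_anti (by linarith) h1

lemma act_mem_iff {f : K} (hf : f ≠ 0) {l : Module.Dual 𝔽 (adl K)} {D : Dv K} :
    act f l ∈ Om D ↔ l ∈ Om (D - dv f) := by
  constructor
  · intro h
    have := act_mem f⁻¹ h
    rwa [act_act, mul_inv_cancel₀ hf, act_one, dv_inv, ← sub_eq_add_neg] at this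
  · intro h
    have := act_mem f h
    rwa [sub_add_cancel] at this

lemma Om_anti {D E : Dv K} (h : D ≤ E) : Om E ≤ Om D :=
  Submodule.dualAnnihilator_anti (SD_mono h)

/-- `W` is the divisor of the nonzero differential `l`. -/
def IsDivOf (l : Module.Dual 𝔽 (adl K)) (W : Dv K) : Prop :=
  l ≠ 0 ∧ ∀ D, l ∈ Om D ↔ D ≤ W

lemma el_le_of_mem_Om {l : Module.Dual 𝔽 (adl K)} (hl : l ≠ 0) {D B : Dv K} (h : l ∈ Om D) :
    el (D + B) ≤ iD (-B) := by
  obtain ⟨hfin, hrk⟩ := finrank_Om (-B : Dv K)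
  have hm : ∀ f ∈ Lsp (D + B), act f l ∈ Om (-B : Dv K) := by
    intro f hf
    by_cases hf0 : f = 0
    · rw [hf0, ← actL_apply, map_zero]; exact Submodule.zero_mem _
    · refine Om_anti ?_ (act_mem f h)
      have := (mem_Lsp_of_ne hf0).1 hf
      rw [← sub_nonneg]
      convert this using 1
      abel
  let φ : Lsp (D + B) →ₗ[𝔽] Om (-B : Dv K) :=
    ((actL l).comp (Lsp (D + B)).subtype).codRestrict _ fun f => hm f f.2
  have hinj : Function.Injective φ := by
    rw [injective_iff_map_eq_zero]
    intro f hf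
    by_contra hne
    exact act_ne (f := f.1) (fun h => hne (Subtype.ext h)) hl (congrArg Subtype.val hf)
  rw [← hrk, el_eq]
  exact LinearMap.finrank_le_finrank_of_injective hinj

lemma exists_isDivOf {l : Module.Dual 𝔽 (adl K)} (hl : l ≠ 0) {D : Dv K} (h : l ∈ Om D) :
    ∃ W, IsDivOf l W := by
  have hb : ∀ E, l ∈ Om E → degD E ≤ 2 * gn K := by
    intro E hE
    have h1 := el_le_of_mem_Om hl (B := 0) hE
    rw [add_zero, neg_zero] at h1
    have h2 := iD_eq (0 : Dv K)
    rw [el_zero, map_zero] at h2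
    have h3 := riemann E
    omega
  obtain ⟨W, hW, hmax⟩ : ∃ W, l ∈ Om W ∧ ∀ E, l ∈ Om E → degD E ≤ degD W := by
    by_contra hcon
    push Not at hcon
    have : ∀ n : ℕ, ∃ E, l ∈ Om E ∧ degD D + n ≤ degD E := by
      intro n
      induction n with
      | zero => exact ⟨D, h, by simp⟩
      | succ n ih =>
        obtain ⟨E, hE, hn⟩ := ih
        obtain ⟨E', hE', hn'⟩ := hcon E hE
        exact ⟨E', hE', by push_cast; omega⟩
    obtain ⟨E, hE, hn⟩ := this (2 * gn K + 1 - degD D).toNat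
    have := hb E hE
    omega
  refine ⟨W, hl, fun E => ⟨fun hE => ?_, fun hE => Om_anti hE hW⟩⟩
  have h1 : l ∈ Om (E ⊔ W) := by
    rw [mem_Om] at hE hW ⊢
    refine ⟨fun α hα => ?_, hE.2⟩
    obtain ⟨β, hβ, γ, hγ, rfl⟩ := Submodule.mem_sup.1 (AD_sup E W hα)
    rw [map_add, hE.1 β hβ, hW.1 γ hγ, add_zero]
  have h2 := hmax _ h1
  have h3 : E ⊔ W - W = 0 := by
    refine eq_zero_of_degD (sub_nonneg.2 le_sup_right) ?_
    have := degD_nonneg (sub_nonneg.2 (le_sup_right : W ≤ E ⊔ W))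
    rw [map_sub] at this ⊢
    omega
  rw [sub_eq_zero] at h3
  rw [← h3]
  exact le_sup_left

lemma exists_big (n : ℕ) : ∃ B : Dv K, (n : ℤ) ≤ degD B := by
  obtain ⟨z, hz⟩ := exists_transcendental K
  have h1 : 0 < degD (zdv z) := by
    rw [degD_zero' hz]
    have := finite_over_adjoin hz
    exact_mod_cast Module.finrank_pos
  refine ⟨n • zdv z, ?_⟩
  rw [map_nsmul, nsmul_eq_mul]
  nlinarith

lemma exists_act {l m : Module.Dual 𝔽 (adl K)} (hl : l ≠ 0) (hm : m ≠ 0) {D E : Dv K}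
    (hD : l ∈ Om D) (hE : m ∈ Om E) : ∃ f ≠ 0, m = act f l := by
  obtain ⟨B, hB⟩ := exists_big (K := K) ((3 * gn K - degD D - degD E + 1).toNat + 1)
  obtain ⟨hfin, hrk⟩ := finrank_Om (-B : Dv K)
  have hmem : ∀ (l : Module.Dual 𝔽 (adl K)) (D : Dv K), l ∈ Om D →
      ∀ f ∈ Lsp (D + B), act f l ∈ Om (-B : Dv K) := by
    intro l D h f hf
    by_cases hf0 : f = 0
    · rw [hf0, ← actL_apply, map_zero]; exact Submodule.zero_mem _
    · refine Om_anti ?_ (act_mem f h)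
      have := (mem_Lsp_of_ne hf0).1 hf
      rw [← sub_nonneg]
      convert this using 1
      abel
  let φ : Lsp (D + B) →ₗ[𝔽] Om (-B : Dv K) :=
    ((actL l).comp (Lsp (D + B)).subtype).codRestrict _ fun f => hmem l D hD f f.2
  let ψ : Lsp (E + B) →ₗ[𝔽] Om (-B : Dv K) :=
    ((actL m).comp (Lsp (E + B)).subtype).codRestrict _ fun f => hmem m E hE f f.2
  have hker : ∃ x, x ≠ 0 ∧ φ.coprod ψ x = 0 := by
    by_contra hcon
    push Not at hcon
    have hinj : Function.Injective (φ.coprod ψ) := by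
      rw [injective_iff_map_eq_zero]
      intro x hx
      by_contra hne
      exact hcon x hne hx
    have h1 := LinearMap.finrank_le_finrank_of_injective hinj
    rw [Module.finrank_prod, hrk, ← el_eq, ← el_eq] at h1
    have h2 := iD_eq (-B : Dv K)
    have h3 := riemann (D + B)
    have h4 := riemann (E + B)
    have h5 : el (-B : Dv K) = 0 := by
      by_contra h0
      have h6 : 0 < Module.finrank 𝔽 (Lsp (-B : Dv K)) := by rw [← el_eq]; omega
      obtain ⟨x, hx⟩ := Module.finrank_pos_iff_exists_ne_zero.1 h6
      have hx0 : (x : K) ≠ 0 := fun h => hx (Subtype.ext h)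
      have h7 := degD_nonneg ((mem_Lsp_of_ne hx0).1 x.2)
      rw [map_add, degD_dv, map_neg] at h7
      push_cast at hB
      omega
    rw [map_add] at h3 h4
    rw [map_neg] at h2
    push_cast at hB
    omega
  obtain ⟨⟨f, h⟩, hne, h0⟩ := hker
  have h1 : act (f : K) l + act (h : K) m = 0 := by
    rw [LinearMap.coprod_apply] at h0
    exact congrArg Subtype.val h0
  have h2 : act (h : K) m = act (f : K) l := by
    ext α
    have := LinearMap.congr_fun h1 α
    rw [LinearMap.add_apply, LinearMap.zero_apply, add_eq_zero_iff_eq_neg, ZModModule.neg_eq_self] at this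
    exact this.symm
  have hh0 : (h : K) ≠ 0 := by
    intro hh0
    have hf0 : (f : K) ≠ 0 := by
      intro hf0
      refine hne ?_
      rw [Prod.mk_eq_zero]
      exact ⟨Subtype.ext hf0, Subtype.ext hh0⟩
    refine act_ne hf0 hl ?_
    rw [← h2, hh0, ← actL_apply, map_zero]
  have hf0 : (f : K) ≠ 0 := by
    intro hf0
    refine act_ne hh0 hm ?_
    rw [h2, hf0, ← actL_apply, map_zero]
  refine ⟨f * (h : K)⁻¹, mul_ne_zero hf0 (inv_ne_zero hh0), ?_⟩
  rw [← act_act, ← h2, act_act, mul_inv_cancel₀ hh0, act_one]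

lemma IsDivOf.act {l : Module.Dual 𝔽 (adl K)} {W : Dv K} (h : IsDivOf l W) {f : K} (hf : f ≠ 0) :
    IsDivOf (act f l) (W + dv f) :=
  ⟨act_ne hf h.1, fun D => by rw [act_mem_iff hf, h.2, sub_le_iff_le_add]⟩

lemma IsDivOf.iD_eq {l : Module.Dual 𝔽 (adl K)} {W : Dv K} (h : IsDivOf l W) (D : Dv K) :
    iD D = el (W - D) := by
  refine le_antisymm ?_ ?_
  · obtain ⟨hfin, hrk⟩ := finrank_Om D
    rw [← hrk, el_eq]
    have hle : Om D ≤ (Lsp (W - D)).map (actL l) := by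
      intro m hm
      by_cases hm0 : m = 0
      · rw [hm0]; exact Submodule.zero_mem _
      obtain ⟨f, hf, rfl⟩ := exists_act h.1 hm0 ((h.2 W).2 le_rfl) hm
      refine ⟨f, ?_, rfl⟩
      have h1 := ((h.act hf).2 D).1 hm
      refine (mem_Lsp_of_ne hf).2 ?_
      rw [← sub_nonneg] at h1
      convert h1 using 1
      abel
    exact (Submodule.finrank_mono hle).trans (Submodule.finrank_map_le _ _)
  · have := el_le_of_mem_Om h.1 (B := -D) ((h.2 W).2 le_rfl)
    rwa [← sub_eq_add_neg, neg_neg] at this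

/-- The Riemann-Roch theorem. -/
lemma IsDivOf.RR {l : Module.Dual 𝔽 (adl K)} {W : Dv K} (h : IsDivOf l W) (D : Dv K) :
    (el D : ℤ) = degD D + 1 - gn K + el (W - D) := by
  have := CFF.iD_eq D
  rw [h.iD_eq] at this
  omega

lemma IsDivOf.el_eq {l : Module.Dual 𝔽 (adl K)} {W : Dv K} (h : IsDivOf l W) :
    el W = gn K := by
  have := h.RR 0
  rw [map_zero, el_zero, sub_zero] at this
  omega

lemma IsDivOf.deg_eq {l : Module.Dual 𝔽 (adl K)} {W : Dv K} (h : IsDivOf l W) :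
    degD W = 2 * gn K - 2 := by
  have := h.RR W
  rw [h.el_eq, sub_self, el_zero] at this
  omega

lemma exists_differential : ∃ (l : Module.Dual 𝔽 (adl K)) (W : Dv K), IsDivOf l W ∧ 0 ≤ W := by
  obtain ⟨hfin, hrk⟩ := finrank_Om (0 : Dv K)
  have h2 := iD_eq (0 : Dv K)
  rw [el_zero, map_zero] at h2
  have := gn_pos (K := K)
  have h3 : 0 < Module.finrank 𝔽 (Om (0 : Dv K)) := by omega
  obtain ⟨x, hx⟩ := Module.finrank_pos_iff_exists_ne_zero.1 h3
  have hx0 : (x : Module.Dual 𝔽 (adl K)) ≠ 0 := fun h => hx (Subtype.ext h)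
  obtain ⟨W, hW⟩ := exists_isDivOf hx0 x.2
  exact ⟨x, W, hW, (hW.2 0).1 x.2⟩

end Differentials

section Extensions

lemma isIntegral_of_forall {K : Type} [Field K] {A : Type*} [CommRing A] [Algebra A K] {z : K}
    (h : ∀ V : ValuationSubring K, (∀ a, algebraMap A K a ∈ V) → z ∈ V) : IsIntegral A z := by
  have h1 : z ∈ (integralClosure (Subring.closure (Set.range (algebraMap A K))) K).toSubring := by
    rw [← iInf_valuationSubring_superset, Subring.mem_iInf]
    intro V
    exact h V.1 fun a => V.2 ⟨a, rfl⟩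
  have h2 : IsIntegral (Subring.closure (Set.range (algebraMap A K))) z := h1
  have h3 : Subring.closure (Set.range (algebraMap A K)) = (algebraMap A K).range := by
    rw [← RingHom.coe_range, Subring.closure_eq]
  rw [h3] at h2
  let : Algebra A (algebraMap A K).range := (algebraMap A K).rangeRestrict.toAlgebra
  have : Algebra.IsIntegral A (algebraMap A K).range := ⟨fun ⟨_, a, ha⟩ => by
    subst ha
    exact ⟨X - C a, monic_X_sub_C a, by
      simp only [eval₂_sub, eval₂_X, eval₂_C, sub_eq_zero]; exact Subtype.ext rfl⟩⟩
  have : IsScalarTower A (algebraMap A K).range K := IsScalarTower.of_algebraMap_eq fun _ => rfl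
  exact isIntegral_trans z h2

lemma valuationSubring_mem_of_isIntegral {K : Type} [Field K] {A : Type*} [CommRing A] [Algebra A K]
    {z : K} (h : IsIntegral A z) (V : ValuationSubring K) (hV : ∀ a, algebraMap A K a ∈ V) :
    z ∈ V := by
  let f : A →+* V := (algebraMap A K).codRestrict V.toSubring hV
  have h1 : IsIntegral V z := by
    obtain ⟨p, hp, hz⟩ := h
    refine ⟨p.map f, hp.map f, ?_⟩
    rw [eval₂_map]
    exact hz
  obtain ⟨y, hy⟩ := IsIntegrallyClosed.isIntegral_iff.1 h1
  rw [← hy]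
  exact y.2

variable {K : Type} [Field K] [Algebra 𝔽 K]

lemma congFF_intermediate [CongFF K] {E : IntermediateField 𝔽 K} {y : E}
    (hy : Transcendental 𝔽 (y : K)) : CongFF E ∧ FiniteDimensional E K := by
  have hfin := finite_over_adjoin hy
  have hyE : Transcendental 𝔽 y := fun h => hy (h.algebraMap (A := K))
  have hle : 𝔽⟮(y : K)⟯ ≤ E := by rw [adjoin_simple_le_iff]; exact y.2
  let e : 𝔽⟮y⟯ ≃ₐ[𝔽] 𝔽⟮(y : K)⟯ :=
    (liftAlgEquiv 𝔽⟮y⟯).trans (equivOfEq (by simp [lift_adjoin]))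
  have h1 : FiniteDimensional 𝔽⟮y⟯ K := by
    refine Module.Finite.of_equiv_equiv (A₁ := 𝔽⟮(y : K)⟯) (B₁ := K) (A₂ := 𝔽⟮y⟯) (B₂ := K)
      e.symm.toRingEquiv (RingEquiv.refl K) ?_
    ext a
    obtain ⟨b, rfl⟩ := e.surjective a
    simp
    rfl
  refine ⟨⟨⟨y, hyE, ?_⟩, fun a ha => ?_⟩, ?_⟩
  · exact FiniteDimensional.left 𝔽⟮y⟯ E K
  · obtain ⟨c, hc⟩ := CongFF.const (a : K) (ha.algebraMap (A := K))
    exact ⟨c, Subtype.ext hc⟩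
  · exact FiniteDimensional.right 𝔽⟮y⟯ E K

lemma dg_coe [CongFF K] {E : IntermediateField 𝔽 K} [CongFF E] [FiniteDimensional E K] (y : E) :
    dg (y : K) = dg y * Module.finrank E K := by
  let e : 𝔽⟮y⟯ ≃ₐ[𝔽] 𝔽⟮(y : K)⟯ :=
    (liftAlgEquiv 𝔽⟮y⟯).trans (equivOfEq (by simp [lift_adjoin]))
  rw [dg, dg, Module.finrank_mul_finrank]
  refine Algebra.finrank_eq_of_equiv_equiv e.symm.toRingEquiv (RingEquiv.refl K) ?_
  ext a
  obtain ⟨b, rfl⟩ := e.surjective a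
  simp
  rfl

variable (E : IntermediateField 𝔽 K) [CongFF K] [CongFF E] [FiniteDimensional E K]

/-- The restriction of a place to a subfield. -/
def res (P : Pl K) : Pl E := ⟨P.1.comap (algebraMap E K), isPlace_iff.2 fun h => P.2.1 (by
  rw [eq_top_iff]
  intro z _
  refine valuationSubring_mem_of_isIntegral (A := E) (Algebra.IsIntegral.isIntegral z) P.1 fun a => ?_
  have : a ∈ P.1.comap (algebraMap E K) := h ▸ trivial
  exact this)⟩

lemma mem_res {P : Pl K} {y : E} : y ∈ (res E P).1 ↔ (y : K) ∈ P.1 := Iff.rfl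

/-- The ramification index. -/
def ram (P : Pl K) : ℤ := ord P ((unif (res E P) : E) : K)

lemma coe_zpow_mul (a b : E) (n : ℤ) : ((a ^ n * b : E) : K) = (a : K) ^ n * b := by
  push_cast; rfl

lemma ord_coe (P : Pl K) (y : E) : ord P (y : K) = ram E P * ord (res E P) y := by
  by_cases hy : y = 0
  · simp [hy]
  obtain ⟨n, u, rfl⟩ := exists_unif_zpow (res E P) hy
  have hu0 : ((u : (res E P).1) : E) ≠ 0 := fun h => u.ne_zero (Subtype.ext h)
  have hu0' : (((u : (res E P).1) : E) : K) ≠ 0 := fun h => hu0 (Subtype.ext h)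
  have h1 : (((u : (res E P).1) : E) : K) ∈ P.1 := (u : (res E P).1).2
  have h2 : (((u : (res E P).1) : E) : K)⁻¹ ∈ P.1 := by
    have h3 : ((↑u⁻¹ : (res E P).1) : E) = ((u : (res E P).1) : E)⁻¹ := by
      refine eq_inv_of_mul_eq_one_left ?_
      exact congrArg Subtype.val u.inv_mul
    have h4 := (↑u⁻¹ : (res E P).1).2
    rw [h3] at h4
    exact h4
  rw [mem_iff_ord P hu0'] at h1
  rw [mem_iff_ord P (inv_ne_zero hu0'), ord_inv] at h2
  rw [ord_eq]
  have hun : ((unif (res E P) : E) : K) ≠ 0 := fun h => unif_ne (res E P) (Subtype.ext h)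
  have hc : ((unif (res E P) ^ n * ((u : (res E P).1) : E) : E) : K) =
    ((unif (res E P) : E) : K) ^ n * (((u : (res E P).1) : E) : K) := by
    exact coe_zpow_mul E _ _ n
  rw [hc, ord_mul P (zpow_ne_zero _ hun) hu0', ord_zpow, ram]
  have : ord P (((u : (res E P).1) : E) : K) = 0 := by omega
  rw [this]; ring

lemma ram_pos (P : Pl K) : 0 < ram E P := by
  by_contra h
  have hun : ((unif (res E P) : E) : K) ≠ 0 := fun h => unif_ne (res E P) (Subtype.ext h)
  have h1 : (((unif (res E P))⁻¹ : E) : K) ∈ P.1 := by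
    push_cast
    rw [mem_iff_ord P (inv_ne_zero hun), ord_inv]
    have : ram E P ≤ 0 := not_lt.1 h
    rw [ram] at this
    omega
  have h2 := (mem_res E).2 h1
  rw [mem_iff_ord _ (inv_ne_zero (unif_ne _)), ord_inv, ord_unif] at h2
  omega

lemma coe_mem_pw (P : Pl K) (y : E) (n : ℤ) :
    (y : K) ∈ pw P (ram E P * n) ↔ y ∈ pw (res E P) n := by
  rw [mem_pw, mem_pw, ord_coe, mul_le_mul_iff_right₀ (ram_pos E P)]
  simp

lemma coe_mem_pw_one {P : Pl K} {y : E} (h : y ∈ pw (res E P) 1) : (y : K) ∈ pw P 1 := by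
  have h1 := (coe_mem_pw E P y 1).2 h
  have := ram_pos E P
  exact pw_anti (by omega) h1

lemma exists_over (p : Pl E) : ∃ P : Pl K, res E P = p := by
  by_contra hcon
  push Not at hcon
  have h1 : IsIntegral p.1 (((unif p)⁻¹ : E) : K) := by
    refine isIntegral_of_forall fun V hV => ?_
    by_cases hT : V = ⊤
    · rw [hT]; trivial
    · refine absurd ?_ (hcon ⟨V, isPlace_iff.2 hT⟩)
      exact (pl_eq_of_le fun y hy => hV ⟨y, hy⟩).symm
  have h2 : IsIntegral p.1 ((unif p)⁻¹ : E) :=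
    (isIntegral_algebraMap_iff (algebraMap E K).injective).1 h1
  obtain ⟨y, hy⟩ := IsIntegrallyClosed.isIntegral_iff.1 h2
  have h3 : (unif p)⁻¹ ∈ p.1 := by rw [← hy]; exact y.2
  rw [mem_iff_ord _ (inv_ne_zero (unif_ne _)), ord_inv, ord_unif] at h3
  omega

lemma finite_over (p : Pl E) : {P : Pl K | res E P = p}.Finite := by
  refine (finite_pos ((unif p : E) : K)).subset fun P hP => ?_
  have hP' : res E P = p := hP
  have := ram_pos E P
  rw [ram, hP'] at this
  exact this

/-- The set of places over a place. -/
def abv (p : Pl E) : Finset (Pl K) := (finite_over E p).toFinset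

@[simp] lemma mem_abv {p : Pl E} {P : Pl K} : P ∈ abv E p ↔ res E P = p := by simp [abv]

lemma abv_nonempty (p : Pl E) : (abv E p).Nonempty := by
  obtain ⟨P, hP⟩ := exists_over E p
  exact ⟨P, (mem_abv E).2 hP⟩

lemma isIntegral_of_abv {p : Pl E} {z : K} (h : ∀ P ∈ abv E p, z ∈ P.1) : IsIntegral p.1 z := by
  refine isIntegral_of_forall fun V hV => ?_
  by_cases hT : V = ⊤
  · rw [hT]; trivial
  · refine h ⟨V, isPlace_iff.2 hT⟩ ((mem_abv E).2 ?_)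
    exact (pl_eq_of_le fun y hy => hV ⟨y, hy⟩).symm

lemma mem_of_isIntegral {p : Pl E} {y : E} (h : IsIntegral p.1 y) : y ∈ p.1 := by
  obtain ⟨y, rfl⟩ := IsIntegrallyClosed.isIntegral_iff.1 h
  exact y.2

lemma trace_mem {p : Pl E} {z : K} (h : ∀ P ∈ abv E p, z ∈ P.1) : Algebra.trace E K z ∈ p.1 :=
  mem_of_isIntegral E (Algebra.isIntegral_trace (isIntegral_of_abv E h))

lemma norm_mem {p : Pl E} {z : K} (h : ∀ P ∈ abv E p, z ∈ P.1) : Algebra.norm E z ∈ p.1 :=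
  mem_of_isIntegral E (Algebra.isIntegral_norm (L := K) E (isIntegral_of_abv E h))

lemma trace_mem_pw {p : Pl E} {z : K} (n : ℤ) (h : ∀ P ∈ abv E p, z ∈ pw P (ram E P * n)) :
    Algebra.trace E K z ∈ pw p n := by
  have hu := zpow_ne_zero n (unif_ne p)
  have h1 : Algebra.trace E K ((unif p ^ n)⁻¹ • z) ∈ p.1 := by
    refine trace_mem E fun P hP => ?_
    rw [Algebra.smul_def, ← mem_pw_zero]
    have h2 : (((unif p ^ n)⁻¹ : E) : K) ∈ pw P (ram E P * (-n)) := by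
      rw [coe_mem_pw, (mem_abv E).1 hP]
      have := mem_pw_ord p ((unif p ^ n)⁻¹ : E)
      rwa [ord_inv, ord_unif_zpow] at this
    have h3 := pw_mul h2 (h P hP)
    rwa [mul_neg, neg_add_cancel] at h3
  rw [map_smul, smul_eq_mul] at h1
  have h4 := pw_mul (mem_pw_ord p (unif p ^ n)) (mem_pw_zero.2 h1)
  rwa [ord_unif_zpow, add_zero, ← mul_assoc, mul_inv_cancel₀ hu, one_mul] at h4

section Trace

variable [Algebra.IsSeparable E K]

lemma trace_pow (z : K) (k : ℕ) :
    Algebra.trace E K (z ^ 2 ^ k) = Algebra.trace E K z ^ 2 ^ k := by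
  have := charP_K K
  have := charP_K E
  have : CharP (AlgebraicClosure E) 2 := charP_of_injective_algebraMap
    (algebraMap E (AlgebraicClosure E)).injective 2
  have hp : Fact (Nat.Prime 2) := ⟨Nat.prime_two⟩
  apply (algebraMap E (AlgebraicClosure E)).injective
  rw [(algebraMap E (AlgebraicClosure E)).map_pow, trace_eq_sum_embeddings (AlgebraicClosure E),
    trace_eq_sum_embeddings (AlgebraicClosure E), sum_pow_char_pow]
  exact Finset.sum_congr rfl fun σ _ => σ.map_pow z _

lemma trace_sq (z : K) : Algebra.trace E K (z ^ 2) = Algebra.trace E K z ^ 2 := by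
  simpa using trace_pow E z 1

lemma trace_mem_max {p : Pl E} {z : K} (h : ∀ P ∈ abv E p, z ∈ pw P 1) :
    Algebra.trace E K z ∈ pw p 1 := by
  by_cases h0 : Algebra.trace E K z = 0
  · rw [h0]; exact Submodule.zero_mem _
  obtain ⟨k, hk⟩ : ∃ k : ℕ, ∀ P ∈ abv E p, ram E P ≤ 2 ^ k := by
    refine ⟨∑ P ∈ abv E p, (ram E P).toNat, fun P hP => ?_⟩
    have h1 := Finset.single_le_sum (f := fun P => (ram E P).toNat) (fun _ _ => Nat.zero_le _) hP
    have h2 := Nat.lt_two_pow_self (n := ∑ P ∈ abv E p, (ram E P).toNat)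
    have h3 : ((∑ P ∈ abv E p, (ram E P).toNat : ℕ) : ℤ) < (2 : ℤ) ^ (∑ P ∈ abv E p, (ram E P).toNat) := by
      exact_mod_cast h2
    have h4 : (ram E P).toNat ≤ ∑ P ∈ abv E p, (ram E P).toNat := h1
    omega
  have h1 : Algebra.trace E K (z ^ 2 ^ k) ∈ pw p 1 := by
    refine trace_mem_pw E 1 fun P hP => ?_
    have h2 := pw_pow (h P hP) (2 ^ k)
    refine pw_anti ?_ h2
    have := hk P hP
    push_cast
    linarith
  rw [trace_pow, mem_pw_of_ne (pow_ne_zero _ h0), ord_pow] at h1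
  rw [mem_pw_of_ne h0]
  by_contra hcon
  have : (0 : ℤ) < (2 ^ k : ℕ) := by positivity
  nlinarith

end Trace

/-- The conorm of divisors. -/
def con : Dv E →+ Dv K := Finsupp.liftAddHom fun p =>
  { toFun := fun n => ∑ P ∈ abv E p, Finsupp.single P (ram E P * n)
    map_zero' := by simp
    map_add' := fun a b => by
      rw [← Finset.sum_add_distrib]
      exact Finset.sum_congr rfl fun P _ => by rw [mul_add, Finsupp.single_add] }

lemma con_apply (D : Dv E) (P : Pl K) : con E D P = ram E P * D (res E P) := by
  induction D using Finsupp.induction_linear with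
  | zero => simp
  | add D D' h h' => rw [map_add, Finsupp.add_apply, h, h', Finsupp.add_apply, mul_add]
  | single p n =>
    rw [con, Finsupp.liftAddHom_apply_single]
    simp only [AddMonoidHom.coe_mk, ZeroHom.coe_mk, Finsupp.finsetSum_apply, Finsupp.single_apply]
    rw [Finset.sum_ite_eq' (abv E p)]
    by_cases h : p = res E P
    · rw [if_pos ((mem_abv E).2 h.symm), if_pos h]
    · rw [if_neg fun h' => h ((mem_abv E).1 h').symm, if_neg h, mul_zero]

lemma con_dv (y : E) : con E (dv y) = dv (y : K) := by
  ext P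
  rw [con_apply, dv_apply, dv_apply, ord_coe]

lemma con_mono {D D' : Dv E} (h : D ≤ D') : con E D ≤ con E D' := fun P => by
  rw [con_apply, con_apply]
  exact mul_le_mul_of_nonneg_left (h _) (ram_pos E P).le

lemma con_nonneg {D : Dv E} (h : 0 ≤ D) : 0 ≤ con E D := by
  have := con_mono E h
  rwa [map_zero] at this

lemma con_zdv (y : E) : con E (zdv y) = zdv (y : K) := by
  ext P
  rw [con_apply, zdv_apply, zdv_apply, ord_coe]
  rcases le_total 0 (ord (res E P) y) with h | h
  · rw [max_eq_left h, max_eq_left (mul_nonneg (ram_pos E P).le h)]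
  · rw [max_eq_right h, max_eq_right (mul_nonpos_of_nonneg_of_nonpos (ram_pos E P).le h), mul_zero]

lemma mem_Lsp_con {D : Dv E} {y : E} : (y : K) ∈ Lsp (con E D) ↔ y ∈ Lsp D := by
  rw [mem_Lsp, mem_Lsp]
  constructor
  · intro h p
    obtain ⟨P, rfl⟩ := exists_over E p
    have := h P
    rwa [con_apply, ← mul_neg, coe_mem_pw] at this
  · intro h P
    rw [con_apply, ← mul_neg, coe_mem_pw]
    exact h _

end Extensions

section ConormDegree

variable {K : Type} [Field K] [Algebra 𝔽 K] (E : IntermediateField 𝔽 K) [CongFF K] [PosGenus E]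
  [FiniteDimensional E K]

lemma exists_only_pole (p : Pl E) : ∃ y : E, Transcendental 𝔽 y ∧
    ∃ m : ℤ, 0 < m ∧ zdv y = Finsupp.single p m := by
  have h1 := riemann (Finsupp.single p ((gn E : ℤ) + 1))
  rw [degD_single] at h1
  have h2 : (1 : ℤ) ≤ deg p := by exact_mod_cast deg_pos p
  have h3 : 1 < el (Finsupp.single p ((gn E : ℤ) + 1)) := by
    have : (gn E : ℤ) + 1 ≤ (gn E + 1) * deg p := by nlinarith
    omega
  have h4 := card_Lsp (Finsupp.single p ((gn E : ℤ) + 1))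
  obtain ⟨f, hf, hne⟩ : ∃ f ∈ Lsp (Finsupp.single p ((gn E : ℤ) + 1)), f ∉ Lsp (0 : Dv E) := by
    by_contra hcon
    push Not at hcon
    have h5 : Lsp (Finsupp.single p ((gn E : ℤ) + 1)) ≤ Lsp (0 : Dv E) := hcon
    have h6 := Submodule.finrank_mono h5
    rw [← el_eq, ← el_eq, el_zero] at h6
    omega
  have hf0 : f ≠ 0 := by rintro rfl; exact hne (Submodule.zero_mem _)
  have hft : Transcendental 𝔽 f := transcendental_iff.2 ⟨hf0, fun h => hne (mem_Lsp_zero.2 (Or.inr h))⟩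
  have hfi := transcendental_inv hft
  have h7 : ∀ q ≠ p, 0 ≤ ord q f := by
    intro q hq
    have := (mem_Lsp_of_ne hf0).1 hf q
    rwa [Finsupp.add_apply, Finsupp.single_eq_of_ne hq, add_zero] at this
  have h8 : zdv f⁻¹ = Finsupp.single p (max (-ord p f) 0) := by
    ext q
    rw [zdv_apply, ord_inv, Finsupp.single_apply]
    split_ifs with h
    · rw [h]
    · have := h7 q (Ne.symm h)
      rw [max_eq_right]; omega
  refine ⟨f⁻¹, hfi, _, ?_, h8⟩
  obtain ⟨q, hq⟩ := exists_place_pos hfi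
  have h9 := congrArg (fun D => D q) h8
  simp only [zdv_apply, Finsupp.single_apply] at h9
  rw [max_eq_left hq.le] at h9
  split_ifs at h9 with h
  · rw [← h9]; exact hq
  · omega

lemma degD_con (D : Dv E) : degD (con E D) = Module.finrank E K * degD D := by
  induction D using Finsupp.induction_linear with
  | zero => simp
  | add D D' h h' => rw [map_add, map_add, h, h', map_add, mul_add]
  | single p n =>
    obtain ⟨y, hy, m, hm, hD⟩ := exists_only_pole E p
    have h1 := con_zdv E y
    have hyK : Transcendental 𝔽 (y : K) := fun h => hy
      ((isAlgebraic_algebraMap_iff (algebraMap E K).injective).1 h)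
    have h2 := degD_zero' hyK
    rw [dg_coe, ← h1, Nat.cast_mul, ← degD_zero' hy, hD] at h2
    have h3 : ∀ k : ℤ, (Finsupp.single p k : Dv E) = k • Finsupp.single p 1 := fun k => by
      rw [Finsupp.smul_single, smul_eq_mul, mul_one]
    rw [h3, map_zsmul, map_zsmul, map_zsmul, smul_eq_mul, smul_eq_mul] at h2
    have h4 : degD (con E (Finsupp.single p 1)) = Module.finrank E K * degD (Finsupp.single p 1) := by
      refine mul_left_cancel₀ hm.ne' ?_
      linarith
    rw [h3, map_zsmul, map_zsmul, map_zsmul, smul_eq_mul, smul_eq_mul, h4]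
    ring

end ConormDegree

section Counting

variable {K : Type} [Field K] [Algebra 𝔽 K] [CongFF K]

lemma mem_pw_sub_trans {P : Pl K} {n : ℤ} {a b c : K} (h1 : a - b ∈ pw P n) (h2 : b - c ∈ pw P n) :
    a - c ∈ pw P n := by
  simpa using add_mem h1 h2

lemma sub_pow_two_pow (a b : K) (k : ℕ) : (a - b) ^ 2 ^ k = a ^ 2 ^ k - b ^ 2 ^ k := by
  have := charP_K K
  exact sub_pow_char_pow a b k

lemma pow_two_pow_sub_mem {P : Pl K} {a b : K} (h : a - b ∈ pw P 1) (k : ℕ) :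
    a ^ 2 ^ k - b ^ 2 ^ k ∈ pw P 1 := by
  rw [← sub_pow_two_pow]
  rcases mem_pw.1 h with h0 | h0
  · rw [h0, zero_pow (by positivity)]
    exact zero_mem _
  · by_cases h1 : a - b = 0
    · rw [h1, zero_pow (by positivity)]
      exact zero_mem _
    · refine (mem_pw_of_ne (pow_ne_zero _ h1)).2 ?_
      rw [ord_pow]
      have : (1 : ℤ) ≤ ((2 ^ k : ℕ) : ℤ) := by exact_mod_cast Nat.one_le_two_pow
      nlinarith

lemma pow_dvd_sub_mem (P : Pl K) {f : K} (hf : f ∈ P.1) {n : ℕ} (hn : deg P ∣ n) :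
    f ^ 2 ^ n - f ∈ pw P 1 := by
  obtain ⟨k, rfl⟩ := hn
  induction k with
  | zero => simp
  | succ k ih =>
    rw [Nat.mul_succ, pow_add, pow_mul]
    exact mem_pw_sub_trans (pow_two_pow_sub_mem ih _) (pow_card_sub_mem P hf)

lemma pow_sub_ne {x : K} (hx : Transcendental 𝔽 x) {n : ℕ} (hn : n ≠ 0) : x ^ 2 ^ n - x ≠ 0 := by
  intro h
  apply hx
  refine ⟨X ^ 2 ^ n - X, FiniteField.X_pow_card_pow_sub_X_ne_zero 𝔽 hn (by norm_num), ?_⟩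
  simpa using h

lemma finite_deg_dvd {n : ℕ} (hn : n ≠ 0) : {P : Pl K | deg P ∣ n}.Finite := by
  obtain ⟨x, hx⟩ := exists_transcendental K
  have hx0 : x ≠ 0 := (transcendental_iff.1 hx).1
  refine ((finite_pos x⁻¹).union (finite_pos (x ^ 2 ^ n - x))).subset ?_
  intro P hP
  by_cases h : x ∈ P.1
  · right
    exact (mem_pw_of_ne (pow_sub_ne hx hn)).1 (pow_dvd_sub_mem P h hP)
  · left
    rw [mem_iff_ord P hx0] at h
    change 0 < ord P x⁻¹
    rw [ord_inv]
    omega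

lemma finite_deg_le (n : ℕ) : {P : Pl K | deg P ≤ n}.Finite :=
  (finite_deg_dvd (Nat.factorial_ne_zero n)).subset fun P hP =>
    Nat.dvd_factorial (deg_pos P) hP

variable (K) in
/-- The places of degree at most `n`. -/
def placesLE (n : ℕ) : Finset (Pl K) := (finite_deg_le n).toFinset

lemma mem_placesLE {n : ℕ} {P : Pl K} : P ∈ placesLE K n ↔ deg P ≤ n := by simp [placesLE]

variable (K) in
/-- The places whose degree divides `n` (for `n ≠ 0`). -/
def placesDvd (n : ℕ) : Finset (Pl K) := {P ∈ placesLE K n | deg P ∣ n}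

lemma mem_placesDvd {n : ℕ} (hn : n ≠ 0) {P : Pl K} : P ∈ placesDvd K n ↔ deg P ∣ n := by
  simp only [placesDvd, Finset.mem_filter, mem_placesLE, and_iff_right_iff_imp]
  exact fun h => Nat.le_of_dvd (Nat.pos_of_ne_zero hn) h

variable (K) in
/-- The number of rational points over the field with `2 ^ n` elements. -/
def numPts (n : ℕ) : ℕ := ∑ P ∈ placesDvd K n, deg P

lemma finite_eff (n : ℤ) : {D : Dv K | 0 ≤ D ∧ degD D = n}.Finite := by
  refine (Set.finite_Icc (0 : Dv K)
    (∑ P ∈ placesLE K n.toNat, Finsupp.single P n)).subset ?_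
  rintro D ⟨hD, rfl⟩
  refine ⟨hD, fun P => ?_⟩
  have h1 := degD_ge hD P
  have h2 : (1 : ℤ) ≤ deg P := by exact_mod_cast deg_pos P
  have h3 := hD P
  simp only [Finsupp.coe_zero, Pi.zero_apply] at h3
  rw [Finsupp.finsetSum_apply]
  by_cases hP : P ∈ placesLE K (degD D).toNat
  · rw [Finset.sum_eq_single_of_mem P hP (fun Q _ hQ => by simp [hQ])]
    simp only [Finsupp.single_eq_same]
    nlinarith
  · rw [Finset.sum_eq_zero (fun Q hQ => by
      rw [Finsupp.single_apply, if_neg]; rintro rfl; exact hP hQ)]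
    by_contra h4
    push Not at h4
    apply hP
    rw [mem_placesLE]
    have : (deg P : ℤ) ≤ degD D := by nlinarith
    omega

variable (K) in
/-- The effective divisors of degree `n`. -/
def Eff (n : ℤ) : Finset (Dv K) := (finite_eff n).toFinset

lemma mem_Eff {n : ℤ} {D : Dv K} : D ∈ Eff K n ↔ 0 ≤ D ∧ degD D = n := by simp [Eff]

lemma Eff_neg {n : ℤ} (hn : n < 0) : Eff K n = ∅ := by
  ext D
  simp only [mem_Eff, Finset.notMem_empty, iff_false, not_and]
  intro h1 h2
  have := degD_nonneg h1
  omega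

lemma card_Eff_ge (n : ℤ) (P : Pl K) {j : ℤ} (hj : 0 ≤ j) :
    {D ∈ Eff K n | j ≤ D P}.card = (Eff K (n - j * deg P)).card := by
  refine Finset.card_nbij' (fun D => D - Finsupp.single P j) (fun D => D + Finsupp.single P j)
    ?_ ?_ ?_ ?_
  · intro D hD
    simp only [Finset.coe_filter, Set.mem_ofPred_eq, mem_Eff, Finset.mem_coe] at hD ⊢
    refine ⟨fun Q => ?_, ?_⟩
    · have := hD.1.1 Q
      simp only [Finsupp.coe_zero, Pi.zero_apply, Finsupp.coe_sub, Pi.sub_apply,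
        Finsupp.single_apply] at this ⊢
      split_ifs with h
      · subst h; linarith [hD.2]
      · simpa
    · rw [map_sub, degD_single, hD.1.2]
  · intro D hD
    simp only [Finset.coe_filter, Set.mem_ofPred_eq, mem_Eff, Finset.mem_coe] at hD ⊢
    refine ⟨⟨fun Q => ?_, ?_⟩, ?_⟩
    · have := hD.1 Q
      simp only [Finsupp.coe_zero, Pi.zero_apply, Finsupp.coe_add, Pi.add_apply,
        Finsupp.single_apply] at this ⊢
      split_ifs <;> omega
    · rw [map_add, degD_single, hD.2]; ring
    · have := hD.1 P
      simp only [Finsupp.coe_zero, Pi.zero_apply] at this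
      simpa
  · intro D _; simp
  · intro D _; simp

lemma sum_multiples (A : ℤ → ℤ) (hA : ∀ m < 0, A m = 0) (n d : ℕ) (hd : 0 < d) :
    ∑ j ∈ Finset.Icc 1 n, A (n - j * d) = ∑ k ∈ {k ∈ Finset.Icc 1 n | d ∣ k}, A (n - k) := by
  have h1 : ∑ j ∈ Finset.Icc 1 n, A (n - j * d) =
      ∑ j ∈ {j ∈ Finset.Icc 1 n | j * d ≤ n}, A (n - j * d) := by
    rw [Finset.sum_filter]
    refine Finset.sum_congr rfl fun j _ => ?_
    split_ifs with h
    · rfl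
    · refine hA _ ?_
      push Not at h
      have : (n : ℤ) < j * d := by exact_mod_cast h
      omega
  rw [h1]
  refine Finset.sum_nbij' (fun j => j * d) (fun k => k / d) ?_ ?_ ?_ ?_ ?_
  · intro j hj
    simp only [Finset.mem_filter, Finset.mem_Icc] at hj ⊢
    exact ⟨⟨Nat.mul_pos hj.1.1 hd, hj.2⟩, dvd_mul_left _ _⟩
  · intro k hk
    simp only [Finset.mem_filter, Finset.mem_Icc] at hk ⊢
    obtain ⟨⟨h1, h2⟩, c, rfl⟩ := hk
    rw [Nat.mul_div_cancel_left _ hd]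
    refine ⟨⟨Nat.pos_of_ne_zero (by rintro rfl; simp at h1), ?_⟩, by rwa [mul_comm]⟩
    nlinarith
  · intro j _; exact Nat.mul_div_cancel _ hd
  · intro k hk
    simp only [Finset.mem_filter] at hk
    exact Nat.div_mul_cancel hk.2
  · intro j _; push_cast; rfl

lemma card_Eff_recurrence (n : ℕ) : (n : ℤ) * (Eff K n).card =
    ∑ k ∈ Finset.Icc 1 n, (numPts K k : ℤ) * (Eff K (n - k)).card := by
  have h1 : (n : ℤ) * (Eff K n).card = ∑ D ∈ Eff K n, ∑ P ∈ placesLE K n, D P * deg P := by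
    rw [mul_comm, ← nsmul_eq_mul, ← Finset.sum_const]
    refine Finset.sum_congr rfl fun D hD => ?_
    rw [mem_Eff] at hD
    rw [← degD_eq_sum D (placesLE K n), hD.2]
    intro P hP
    rw [mem_placesLE]
    have h2 := degD_ge hD.1 P
    have h3 := hD.1 P
    simp only [Finsupp.mem_support_iff, Finsupp.coe_zero, Pi.zero_apply] at hP h3
    have : (1 : ℤ) ≤ D P := by omega
    rw [hD.2] at h2
    have : (deg P : ℤ) ≤ n := by nlinarith
    exact_mod_cast this
  have h2 : ∀ D ∈ Eff K n, ∀ P, D P = ∑ j ∈ Finset.Icc 1 n, if (j : ℤ) ≤ D P then (1 : ℤ) else 0 := by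
    intro D hD P
    rw [mem_Eff] at hD
    have h3 := hD.1 P
    have h4 := degD_ge hD.1 P
    have h2 : (1 : ℤ) ≤ deg P := by exact_mod_cast deg_pos P
    simp only [Finsupp.coe_zero, Pi.zero_apply] at h3
    obtain ⟨a, ha⟩ := Int.eq_ofNat_of_zero_le h3
    rw [ha]
    have h5 : a ≤ n := by
      rw [hD.2, ha] at h4
      have : (a : ℤ) ≤ n := by nlinarith
      exact_mod_cast this
    rw [← Finset.sum_filter]
    simp only [Nat.cast_le, Finset.sum_const, mul_one,
      nsmul_eq_mul]
    have : {j ∈ Finset.Icc 1 n | j ≤ a} = Finset.Icc 1 a := by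
      ext j; simp only [Finset.mem_filter, Finset.mem_Icc]; omega
    rw [this]; simp
  rw [h1, Finset.sum_comm]
  have h3 : ∀ P ∈ placesLE K n, ∑ D ∈ Eff K n, D P * (deg P : ℤ) =
      ∑ k ∈ {k ∈ Finset.Icc 1 n | deg P ∣ k}, (deg P : ℤ) * (Eff K (n - k)).card := by
    intro P _
    rw [← Finset.sum_mul, Finset.sum_congr rfl fun D hD => h2 D hD P, Finset.sum_comm,
      mul_comm, Finset.mul_sum, ← Finset.mul_sum]
    have := sum_multiples (fun m => ((Eff K m).card : ℤ))
      (fun m hm => by simp [Eff_neg hm]) n (deg P) (deg_pos P)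
    rw [← Finset.mul_sum, ← this]
    congr 1
    refine Finset.sum_congr rfl fun j _ => ?_
    rw [← Finset.sum_filter]
    simp only [Finset.sum_const, mul_one, nsmul_eq_mul]
    rw [card_Eff_ge n P (by positivity)]
  rw [Finset.sum_congr rfl h3]
  simp only [numPts, Nat.cast_sum, Finset.sum_mul]
  rw [Finset.sum_comm' (t' := Finset.Icc 1 n) (s' := fun k => placesDvd K k)]
  intro P k
  simp only [mem_placesLE, Finset.mem_filter, Finset.mem_Icc]
  constructor
  · rintro ⟨h1, h2, h3⟩
    exact ⟨(mem_placesDvd (by omega)).2 h3, h2⟩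
  · rintro ⟨h1, h2⟩
    have h3 := (mem_placesDvd (by omega)).1 h1
    exact ⟨(Nat.le_of_dvd (by omega) h3).trans h2.2, h2, h3⟩

end Counting

/-- Function fields over `𝔽₂` of genus `4` and class number `1`. -/
class GenusFour (K : Type) [Field K] [Algebra 𝔽 K] : Prop extends PosGenus K where
  genus_eq : genus 𝔽 K = 4
  classNumber_eq : classNumber 𝔽 K = 1

section Principal

variable {K : Type} [Field K] [Algebra 𝔽 K] [GenusFour K]

lemma gn_eq : gn K = 4 := GenusFour.genus_eq

lemma exists_eq_dv {D : Dv K} (h : degD D = 0) : ∃ f : K, f ≠ 0 ∧ D = dv f := by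
  have h1 : Subsingleton (ClassGroup0 𝔽 K) :=
    (Nat.card_eq_one_iff_unique.1 (GenusFour.classNumber_eq (K := K))).1
  have h2 : Subsingleton (zeroDivisors 𝔽 K ⧸
      (principalDivisors 𝔽 K).addSubgroupOf (zeroDivisors 𝔽 K)) := h1
  rw [QuotientAddGroup.subsingleton_iff] at h2
  have h3 : (⟨D, h⟩ : zeroDivisors 𝔽 K) ∈
      (principalDivisors 𝔽 K).addSubgroupOf (zeroDivisors 𝔽 K) := h2 ▸ AddSubgroup.mem_top _
  rw [AddSubgroup.mem_addSubgroupOf] at h3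
  refine AddSubgroup.closure_induction (p := fun D _ => ∃ f : K, f ≠ 0 ∧ D = dv f) ?_ ?_ ?_ ?_ h3
  · rintro D ⟨f, hf, h⟩
    exact ⟨f, hf, Finsupp.ext fun P => h P⟩
  · exact ⟨1, one_ne_zero, Finsupp.ext fun P => by simp⟩
  · rintro D E _ _ ⟨f, hf, rfl⟩ ⟨g, hg, rfl⟩
    exact ⟨f * g, mul_ne_zero hf hg, (dv_mul hf hg).symm⟩
  · rintro D _ ⟨f, hf, rfl⟩
    exact ⟨f⁻¹, inv_ne_zero hf, (dv_inv f).symm⟩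

lemma eq_of_dv_eq {f g : K} (hf : f ≠ 0) (hg : g ≠ 0) (h : dv f = dv g) : f = g := by
  have h1 : f * g⁻¹ ∈ Lsp (0 : Dv K) := by
    rw [mem_Lsp_of_ne (mul_ne_zero hf (inv_ne_zero hg)), dv_mul hf (inv_ne_zero hg), dv_inv, h]
    simp
  rcases mem_Lsp_zero.1 h1 with h2 | h2
  · exact absurd h2 (mul_ne_zero hf (inv_ne_zero hg))
  · rwa [mul_inv_eq_one₀ hg] at h2

lemma card_Eff (D : Dv K) : (Eff K (degD D)).card + 1 = 2 ^ el D := by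
  have h1 : Nat.card {f : Lsp D // f ≠ 0} = (Eff K (degD D)).card := by
    rw [← Nat.card_eq_finsetCard]
    refine Nat.card_congr (Equiv.ofBijective
      (fun f => ⟨dv (f.1 : K) + D, mem_Eff.2 ⟨(mem_Lsp_of_ne fun h => f.2 (Subtype.ext h)).1 f.1.2,
        by rw [map_add, degD_dv, zero_add]⟩⟩) ⟨?_, ?_⟩)
    · rintro ⟨⟨f, hf⟩, hf0⟩ ⟨⟨g, hg⟩, hg0⟩ h
      have h2 : dv f + D = dv g + D := congrArg Subtype.val h
      have := eq_of_dv_eq (fun h => hf0 (Subtype.ext h)) (fun h => hg0 (Subtype.ext h))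
        (add_right_cancel h2)
      subst this; rfl
    · rintro ⟨E, hE⟩
      rw [mem_Eff] at hE
      obtain ⟨f, hf, h⟩ := exists_eq_dv (D := E - D) (by rw [map_sub, hE.2, sub_self])
      have hm : f ∈ Lsp D := by
        rw [mem_Lsp_of_ne hf, ← h, sub_add_cancel]; exact hE.1
      refine ⟨⟨⟨f, hm⟩, fun h0 => hf (congrArg Subtype.val h0)⟩, Subtype.ext ?_⟩
      change dv f + D = E
      rw [← h, sub_add_cancel]
  rw [← card_Lsp, ← h1]
  have := Fintype.ofFinite (Lsp D)
  rw [Nat.card_eq_fintype_card, Nat.card_eq_fintype_card, Fintype.card_subtype_compl,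
    Fintype.card_subtype_eq]
  have : 0 < Fintype.card (Lsp D) := Fintype.card_pos
  omega

lemma el_congr {D E : Dv K} (h : degD D = degD E) : el D = el E := by
  have h1 := card_Eff D
  rw [h, card_Eff E] at h1
  exact (Nat.pow_right_injective le_rfl h1).symm

end Principal

section Injectivity

variable {K : Type} [Field K] [Algebra 𝔽 K]

/-- A lift `s` of a generator of the residue field at `P`, with its minimal polynomial. -/
lemma exists_residue_gen [CongFF K] (P : Pl K) : ∃ s ∈ P.1, ∃ f : 𝔽[X], f.Monic ∧ Irreducible f ∧
    f.natDegree = deg P ∧ aeval s f ∈ pw P 1 ∧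
    ∀ w ∈ P.1, ∃ p : 𝔽[X], p.natDegree < deg P ∧ w - aeval s p ∈ pw P 1 := by
  let _ := (residueHom 𝔽 P).toAlgebra
  have hfd : Module.Finite 𝔽 (IsLocalRing.ResidueField P.1) := Module.Finite.of_finite
  obtain ⟨α, hα⟩ := Field.exists_primitive_element_of_finite_top 𝔽 (IsLocalRing.ResidueField P.1)
  obtain ⟨s, hs⟩ := IsLocalRing.residue_surjective α
  have hintegral : IsIntegral 𝔽 α := IsIntegral.of_finite 𝔽 α
  have hdeg : (minpoly 𝔽 α).natDegree = deg P := by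
    rw [← IntermediateField.adjoin.finrank hintegral, hα, IntermediateField.finrank_top']
    rfl
  have h1 : ∀ p : 𝔽[X], IsLocalRing.residue P.1 (eval₂ (constHom 𝔽 P) s p) = aeval α p := by
    intro p
    rw [hom_eval₂, hs]; rfl
  have h2 : ∀ p : 𝔽[X], ((eval₂ (constHom 𝔽 P) s p : P.1) : K) = aeval (s : K) p := by
    intro p
    change P.1.subtype _ = _
    rw [hom_eval₂]; rfl
  refine ⟨s, s.2, minpoly 𝔽 α, minpoly.monic hintegral, minpoly.irreducible hintegral, hdeg, ?_, ?_⟩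
  · have := (residue_eq_iff (eval₂ (constHom 𝔽 P) s (minpoly 𝔽 α)) 0).1 (by
      rw [h1, minpoly.aeval, map_zero])
    simpa [h2] using this
  · intro w hw
    have h3 : IsLocalRing.residue P.1 ⟨w, hw⟩ ∈ 𝔽⟮α⟯ := hα ▸ IntermediateField.mem_top
    rw [← IntermediateField.mem_toSubalgebra,
      IntermediateField.adjoin_simple_toSubalgebra_of_isAlgebraic hintegral.isAlgebraic,
      Algebra.adjoin_singleton_eq_range_aeval] at h3
    obtain ⟨p, hp⟩ := h3
    refine ⟨p %ₘ minpoly 𝔽 α, ?_, ?_⟩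
    · rw [← hdeg]
      exact natDegree_modByMonic_lt _ (minpoly.monic hintegral) (minpoly.ne_one 𝔽 α)
    · rw [← h2]
      refine (residue_eq_iff ⟨w, hw⟩ _).1 ?_
      rw [h1, aeval_modByMonic_eq_self_of_root (minpoly.aeval 𝔽 α)]
      exact hp.symm

lemma isCoprime_map [CongFF K] {f : 𝔽[X]} (hf : f.Monic) (hirr : Irreducible f) {h : K[X]}
    (h0 : h ≠ 0) (hd : h.natDegree < f.natDegree) : IsCoprime h (f.map (algebraMap 𝔽 K)) := by
  refine isCoprime_of_irreducible_dvd (fun h1 => h0 h1.1) fun z hz hzh hzf => ?_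
  have hlc : z.leadingCoeff⁻¹ ≠ 0 := inv_ne_zero (leadingCoeff_ne_zero.2 hz.ne_zero)
  have hu : IsUnit (C z.leadingCoeff⁻¹) := isUnit_C.2 hlc.isUnit
  have hm := monic_mul_leadingCoeff_inv hz.ne_zero
  obtain ⟨g1, hg1⟩ := integralClosure.mem_lifts_of_monic_of_dvd_map K hf hm
    (hu.mul_right_dvd.2 hzf)
  have h2 : z * C z.leadingCoeff⁻¹ ∈ lifts (algebraMap 𝔽 K) := by
    rw [lifts_iff_coeff_lifts]
    intro n
    have := congrArg (fun p => coeff p n) hg1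
    rw [← this]
    simp only [coe_mapRingHom, coeff_map]
    exact CongFF.const _ (g1.coeff n).2.isAlgebraic
  obtain ⟨g, hg, hgd, hgm⟩ := (lifts_and_natDegree_eq_and_monic h2 hm)
  have h3 : g ∣ f := by
    refine (map_dvd_map (algebraMap 𝔽 K) (algebraMap 𝔽 K).injective hgm).1 ?_
    rw [hg]; exact hu.mul_right_dvd.2 hzf
  have h4 : 0 < g.natDegree := by
    rw [hgd, natDegree_mul_C hlc]
    exact hz.natDegree_pos
  have h5 : Associated f g := by
    refine (hirr.dvd_iff.1 h3).resolve_left fun h => ?_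
    have := natDegree_eq_zero_of_isUnit h
    omega
  have h6 : f.natDegree ≤ g.natDegree := natDegree_le_of_dvd h5.dvd hgm.ne_zero
  have h7 : g.natDegree ≤ h.natDegree := by
    rw [hgd, natDegree_mul_C hlc]
    exact natDegree_le_of_dvd hzh h0
  omega

lemma aeval_pow_two_pow (s : K) (p : 𝔽[X]) (b : ℕ) :
    aeval (s ^ 2 ^ b) p = (aeval s p) ^ 2 ^ b := by
  rw [← map_pow, ← expand_aeval]
  congr 1
  induction b with
  | zero => simp
  | succ b ih => rw [pow_succ, expand_mul, ZMod.expand_card, map_pow, ih, ← pow_mul]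

/-- If `h` has coefficients of order at least `-m` and takes a value of large order at an
integral `S`, where `f` also takes a value of large order, then so does the resultant. -/
lemma resultant_mem_pw [CongFF K] (P : Pl K) {h f : K[X]} {m q : ℤ}
    (hh : ∀ j, h.coeff j ∈ pw P (-m)) (hf : ∀ j, f.coeff j ∈ pw P 0) (hd : f.natDegree ≠ 0)
    {S : K} (hS : S ∈ P.1) (h1 : eval S h ∈ pw P (q - m)) (h2 : eval S f ∈ pw P q) :
    resultant h f ∈ pw P (q - f.natDegree * m) := by
  obtain ⟨t, ht0, ht⟩ : ∃ t : K, t ≠ 0 ∧ ord P t = m :=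
    ⟨_, zpow_ne_zero _ (unif_ne P), by rw [ord_zpow, ord_unif, mul_one]⟩
  have htm : t ∈ pw P m := ht ▸ mem_pw_ord P t
  have hth : C t * h ∈ lifts P.1.subtype := by
    rw [lifts_iff_coeff_lifts]
    intro n
    have : t * h.coeff n ∈ pw P 0 := by simpa using pw_mul htm (hh n)
    rw [coeff_C_mul]
    exact ⟨⟨_, (mem_pw_zero).1 this⟩, rfl⟩
  have hfl : f ∈ lifts P.1.subtype := by
    rw [lifts_iff_coeff_lifts]
    intro n
    exact ⟨⟨_, (mem_pw_zero).1 (hf n)⟩, rfl⟩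
  obtain ⟨h', hh', hhd⟩ := exists_natDegree_eq_of_mem_lifts hth
  obtain ⟨f', hf', hfd⟩ := exists_natDegree_eq_of_mem_lifts hfl
  rw [natDegree_C_mul ht0] at hhd
  obtain ⟨a, b, -, -, hab⟩ := exists_mul_add_mul_eq_C_resultant (m := h.natDegree)
    (n := f.natDegree) h' f' hhd.le hfd.le (Or.inr hd)
  have h3 := congrArg (fun p => eval S (p.map P.1.subtype)) hab
  simp only [Polynomial.map_add, Polynomial.map_mul, hh', hf', eval_add, eval_mul, map_C,
    eval_C] at h3
  rw [← resultant_map_map, hh', hf', resultant_C_mul_left] at h3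
  have hintegral : ∀ a : P.1[X], eval S (a.map P.1.subtype) ∈ pw P 0 := by
    intro a
    have : eval S (a.map P.1.subtype) = P.1.subtype (eval ⟨S, hS⟩ a) := by
      rw [eval_map, ← eval₂_at_apply]; rfl
    rw [this, mem_pw_zero]
    exact Subtype.mem _
  have h4 : t ^ f.natDegree * resultant h f ∈ pw P q := by
    rw [← h3]
    refine add_mem ?_ ?_
    · simpa using pw_mul (pw_mul htm h1) (hintegral a)
    · simpa using pw_mul h2 (hintegral b)
  rcases mem_pw.1 h4 with h5 | h5
  · rw [(mul_eq_zero.1 h5).resolve_left (pow_ne_zero _ ht0)]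
    exact zero_mem _
  · by_cases h6 : resultant h f = 0
    · rw [h6]; exact zero_mem _
    · rw [ord_mul P (pow_ne_zero _ ht0) h6, ord_pow, ht] at h5
      rw [mem_pw_of_ne h6]
      linarith

/-- Elements of `L(m P)` which are independent over the constants stay independent over
`2 ^ b`-th powers as long as `m * deg P < 2 ^ b`. -/
lemma sum_mul_pow_ne_zero [CongFF K] (P : Pl K) {ι : Type*} [Fintype ι] {e : ι → K}
    (he : LinearIndependent 𝔽 e) {m : ℕ} (hem : ∀ k, e k ∈ Lsp (Finsupp.single P (m : ℤ)))
    {b : ℕ} (hb : m * deg P < 2 ^ b) {w : ι → K} (hw : w ≠ 0) :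
    ∑ k, e k * w k ^ 2 ^ b ≠ 0 := by
  intro hsum
  obtain ⟨k0, hk0, hmin⟩ : ∃ k0, w k0 ≠ 0 ∧ ∀ k, w k ≠ 0 → ord P (w k0) ≤ ord P (w k) := by
    obtain ⟨k1, hk1⟩ := Function.ne_iff.1 hw
    obtain ⟨k0, h1, h2⟩ := Finset.exists_min_image {k | w k ≠ 0} (fun k => ord P (w k))
      ⟨k1, by simpa using hk1⟩
    exact ⟨k0, by simpa using h1, fun k hk => h2 k (by simpa using hk)⟩
  obtain ⟨s, hs, f, hfm, hfi, hfd, hfs, hall⟩ := exists_residue_gen P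
  have hwO : ∀ k, w k / w k0 ∈ P.1 := by
    intro k
    by_cases h : w k = 0
    · rw [h, zero_div]; exact zero_mem _
    · rw [mem_iff_ord P (div_ne_zero h hk0), ord_div P h hk0]
      have := hmin k h
      omega
  choose p hpd hp using fun k => hall _ (hwO k)
  have hp0 : p k0 ≠ 0 := by
    intro h
    have := hp k0
    rw [h, map_zero, sub_zero, div_self hk0] at this
    exact one_not_mem_pw P this
  set h : K[X] := ∑ k, C (e k) * (p k).map (algebraMap 𝔽 K) with hh
  have hcoeff : ∀ j, h.coeff j = ∑ k, (p k).coeff j • e k := by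
    intro j
    simp only [hh, finsetSum_coeff, coeff_C_mul, coeff_map, Algebra.smul_def]
    exact Finset.sum_congr rfl fun k _ => mul_comm _ _
  have hne : h ≠ 0 := by
    intro h0
    apply hp0
    ext j
    have h1 := hcoeff j
    rw [h0, coeff_zero] at h1
    simpa using Fintype.linearIndependent_iff.1 he _ h1.symm k0
  have hdeg : h.natDegree < f.natDegree := by
    rw [hfd]
    have : h.natDegree ≤ deg P - 1 := by
      refine natDegree_sum_le_of_forall_le _ _ fun k _ => ?_
      refine (natDegree_C_mul_le _ _).trans ?_
      rw [natDegree_map]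
      have := hpd k
      omega
    have := deg_pos P
    omega
  have hcop := isCoprime_map hfm hfi hne hdeg
  have hfd' : (f.map (algebraMap 𝔽 K)).natDegree = deg P := by rw [natDegree_map, hfd]
  have hem' : ∀ k Q, e k ∈ pw Q (-(Finsupp.single P (m : ℤ) : Dv K) Q) := fun k => mem_Lsp.1 (hem k)
  have hfc : ∀ Q j, (f.map (algebraMap 𝔽 K)).coeff j ∈ pw Q 0 := by
    intro Q j
    rw [coeff_map, mem_pw_zero]
    exact Q.2.2 _
  have hhc : ∀ Q j, h.coeff j ∈ pw Q (-(Finsupp.single P (m : ℤ) : Dv K) Q) := by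
    intro Q j
    rw [hcoeff]
    exact sum_mem fun k _ => Submodule.smul_mem _ _ (hem' k Q)
  have hS : s ^ 2 ^ b ∈ P.1 := pow_mem hs _
  have h1 : eval (s ^ 2 ^ b) (f.map (algebraMap 𝔽 K)) ∈ pw P (2 ^ b : ℕ) := by
    rw [eval_map_algebraMap, aeval_pow_two_pow]
    simpa using pw_pow hfs (2 ^ b)
  have h2 : eval (s ^ 2 ^ b) h ∈ pw P ((2 ^ b : ℕ) - (m : ℤ)) := by
    have h3 : eval (s ^ 2 ^ b) h = -∑ k, e k * (w k / w k0 - aeval s (p k)) ^ 2 ^ b := by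
      have h4 : ∑ k, e k * (w k / w k0) ^ 2 ^ b = 0 := by
        simp only [div_pow, ← mul_div_assoc, ← Finset.sum_div, hsum, zero_div]
      simp only [sub_pow_two_pow, mul_sub, Finset.sum_sub_distrib, h4, zero_sub, neg_neg, hh,
        eval_finsetSum, eval_mul, eval_C, eval_map_algebraMap, aeval_pow_two_pow]
    rw [h3]
    refine neg_mem (sum_mem fun k _ => ?_)
    have h5 := pw_mul (hem' k P) (pw_pow (hp k) (2 ^ b))
    rw [Finsupp.single_eq_same, mul_one, neg_add_eq_sub] at h5
    exact h5
  have hres : resultant h (f.map (algebraMap 𝔽 K)) ∈ Lsp (-Finsupp.single P 1 : Dv K) := by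
    rw [mem_Lsp]
    intro Q
    by_cases hQ : Q = P
    · subst hQ
      have h3 := resultant_mem_pw Q (m := m) (q := (2 ^ b : ℕ)) (fun j => by simpa using hhc Q j)
        (hfc Q) (by rw [hfd']; exact (deg_pos Q).ne') hS h2 h1
      refine pw_anti ?_ h3
      rw [hfd']
      have : (m * deg Q : ℤ) < (2 ^ b : ℕ) := by exact_mod_cast hb
      simp only [Finsupp.coe_neg, Pi.neg_apply, Finsupp.single_eq_same, neg_neg]
      linarith
    · have h3 := resultant_mem_pw Q (m := 0) (q := 0) (S := 0)
        (fun j => by simpa [Finsupp.single_apply, Ne.symm hQ] using hhc Q j)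
        (hfc Q) (by rw [hfd']; exact (deg_pos P).ne') (zero_mem _)
        (by simpa [← coeff_zero_eq_eval_zero, Finsupp.single_apply, Ne.symm hQ] using hhc Q 0)
        (by rw [← coeff_zero_eq_eval_zero]; exact hfc Q 0)
      simpa [Finsupp.single_apply, Ne.symm hQ] using h3
  have hres0 : resultant h (f.map (algebraMap 𝔽 K)) = 0 := by
    have h3 : resultant h (f.map (algebraMap 𝔽 K)) ∈ Lsp (0 : Dv K) :=
      Lsp_mono (neg_nonpos.2 (single_nonneg' P)) hres
    refine (mem_Lsp_zero.1 h3).resolve_right fun h4 => ?_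
    have h5 := mem_Lsp.1 hres P
    rw [h4] at h5
    exact one_not_mem_pw P (by simpa using h5)
  exact (resultant_eq_zero_iff.1 hres0).2 hcop

end Injectivity

section Stepanov

variable {K : Type} [Field K] [Algebra 𝔽 K] [PosGenus K]

lemma sum_mul_basis_pow_ne_zero (P : Pl K) {k m b : ℕ} {v : Fin k → K}
    (hv : LinearIndependent 𝔽 v) (hb : m * deg P < 2 ^ b) {u : Fin k → K}
    (hu : ∀ i, u i ∈ Lsp (Finsupp.single P (m : ℤ))) (hu0 : u ≠ 0) :
    ∑ i, u i * v i ^ 2 ^ b ≠ 0 := by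
  let B := Module.finBasis 𝔽 (Lsp (Finsupp.single P (m : ℤ)))
  let c : Fin k → _ → 𝔽 := fun i j => B.repr ⟨u i, hu i⟩ j
  have hc : ∀ i, u i = ∑ j, c i j • (B j : K) := by
    intro i
    have := congrArg (Submodule.subtype _) (B.sum_repr ⟨u i, hu i⟩)
    rw [map_sum] at this
    exact this.symm
  have he : LinearIndependent 𝔽 (fun j => (B j : K)) :=
    B.linearIndependent.map' (Submodule.subtype _) (Submodule.ker_subtype _)
  have h1 : ∑ i, u i * v i ^ 2 ^ b = ∑ j, (B j : K) * (∑ i, c i j • v i) ^ 2 ^ b := by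
    have h2 : ∀ j, (∑ i, c i j • v i) ^ 2 ^ b = ∑ i, c i j • v i ^ 2 ^ b := by
      intro j
      have := charP_K K
      rw [sum_pow_char_pow]
      refine Finset.sum_congr rfl fun i _ => ?_
      rcases zmod_two_cases (c i j) with h | h <;> rw [h] <;> simp
    simp only [h2, Finset.mul_sum, mul_smul_comm]
    rw [Finset.sum_comm]
    refine Finset.sum_congr rfl fun i _ => ?_
    rw [hc i, Finset.sum_mul]
    simp
  rw [h1]
  refine sum_mul_pow_ne_zero P he (fun j => (B j).2) hb ?_
  intro hw
  apply hu0
  ext i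
  rw [hc i]
  refine Finset.sum_eq_zero fun j _ => ?_
  have h3 := Fintype.linearIndependent_iff.1 hv (fun i => c i j) (congrFun hw j) i
  rw [h3, zero_smul]

lemma exists_ne_zero_map_eq_zero {k κ : ℕ} (D E : Dv K) (hlt : κ * el E < k * el D)
    (Λ : Fin κ → (Fin k → K) →+ K)
    (hΛ : ∀ u : Fin k → K, (∀ i, u i ∈ Lsp D) → ∀ j, Λ j u ∈ Lsp E) :
    ∃ u : Fin k → K, u ≠ 0 ∧ (∀ i, u i ∈ Lsp D) ∧ ∀ j, Λ j u = 0 := by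
  by_contra hcon
  push Not at hcon
  let φ : (Fin k → Lsp D) → (Fin κ → Lsp E) :=
    fun u j => ⟨Λ j fun i => u i, hΛ _ (fun i => (u i).2) j⟩
  have hinj : Function.Injective φ := by
    intro u u' h
    by_contra hne
    obtain ⟨j, hj⟩ := hcon (fun i => (u i : K) - u' i)
      (fun h0 => hne (funext fun i => Subtype.ext (sub_eq_zero.1 (congrFun h0 i))))
      (fun i => sub_mem (u i).2 (u' i).2)
    apply hj
    have h1 : Λ j (fun i => (u i : K)) = Λ j (fun i => (u' i : K)) :=
      congrArg Subtype.val (congrFun h j)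
    have h2 : (fun i => (u i : K) - u' i) = (fun i => (u i : K)) - fun i => (u' i : K) := rfl
    rw [h2, map_sub, h1, sub_self]
  have h1 := Nat.card_le_card_of_injective φ hinj
  rw [Nat.card_fun, Nat.card_fun, card_Lsp, card_Lsp, Nat.card_fin, Nat.card_fin, ← pow_mul,
    ← pow_mul] at h1
  have h2 := (Nat.pow_le_pow_iff_right (by norm_num)).1 h1
  nlinarith

lemma sum_deg_le (P : Pl K) {f : K} (hf : f ≠ 0) {N : ℕ}
    (h : f ∈ Lsp (Finsupp.single P (N : ℤ))) (X : Finset (Pl K)) (hP : P ∉ X)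
    (hX : ∀ Q ∈ X, f ∈ pw Q 1) : ∑ Q ∈ X, deg Q ≤ N * deg P := by
  have h1 : (0 : Dv K) ≤ dv f + Finsupp.single P (N : ℤ) - ∑ Q ∈ X, Finsupp.single Q 1 := by
    intro R
    have h2 := (mem_Lsp_of_ne hf).1 h R
    simp only [Finsupp.coe_zero, Pi.zero_apply, Finsupp.coe_add, Pi.add_apply, dv_apply,
      Finsupp.coe_sub, Pi.sub_apply, Finsupp.finsetSum_apply] at h2 ⊢
    by_cases hR : R ∈ X
    · rw [Finset.sum_eq_single_of_mem R hR (fun Q _ hQ => by simp [hQ])]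
      have h3 := (mem_pw_of_ne hf).1 (hX R hR)
      have h4 : P ≠ R := by rintro rfl; exact hP hR
      rw [Finsupp.single_eq_same, Finsupp.single_apply, if_neg h4]
      omega
    · rw [Finset.sum_eq_zero (fun Q hQ => by
        rw [Finsupp.single_apply, if_neg]; rintro rfl; exact hR hQ)]
      simpa using h2
  have h2 := degD_nonneg h1
  simp only [map_sub, map_add, degD_dv, degD_single, map_sum, one_mul, zero_add] at h2
  have h3 : ((∑ Q ∈ X, deg Q : ℕ) : ℤ) ≤ (N * deg P : ℕ) := by push_cast; linarith
  exact_mod_cast h3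

/-- The abstract form of the Stepanov–Bombieri method. -/
theorem stepanov (P : Pl K) (κ C₀ : ℕ) : ∃ C n₀ : ℕ, ∀ a b : ℕ, n₀ ≤ a → a ≤ b →
    ∀ X : Finset (Pl K), P ∉ X →
    (∀ (m l k : ℕ) (v : Fin k → K), (∀ i, v i ∈ Lsp (Finsupp.single P (l : ℤ))) →
      ∃ (E : Dv K) (Λ : Fin κ → (Fin k → K) →+ K), 0 ≤ E ∧
        degD E ≤ 2 ^ a * m * deg P + C₀ * (l + 1) ∧
        (∀ u : Fin k → K, (∀ i, u i ∈ Lsp (Finsupp.single P (m : ℤ))) → ∀ j, Λ j u ∈ Lsp E) ∧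
        ∀ u : Fin k → K, (∀ i, u i ∈ Lsp (Finsupp.single P (m : ℤ))) → (∀ j, Λ j u = 0) →
          ∀ Q ∈ X, ∑ i, u i * v i ^ 2 ^ b ∈ pw Q 1) →
    ∑ Q ∈ X, deg Q ≤ κ * 2 ^ (a + b) + C * 2 ^ b := by
  set γ := deg P with hγ
  have hγ0 : 0 < γ := deg_pos P
  set g := gn K with hg
  obtain ⟨c, hc⟩ : ∃ c : ℕ, c = g + κ * (g + κ * C₀ + κ + 1) + 1 := ⟨_, rfl⟩
  obtain ⟨n₀, hn₀⟩ : ∃ n₀ : ℕ,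
      n₀ = γ * c + g + (g + κ * C₀ + κ + 1) * (c + γ + γ + 2) + γ := ⟨_, rfl⟩
  refine ⟨1 + c + γ, n₀, fun a b ha hab X hPX H => ?_⟩
  set r := 2 ^ a with hr
  set q := 2 ^ b with hq
  have hr0 : n₀ < r := ha.trans_lt Nat.lt_two_pow_self
  have hrq : r ≤ q := Nat.pow_le_pow_right (by norm_num) hab
  obtain ⟨m, hm1, hm2⟩ : ∃ m : ℕ, m * γ < q ∧ q ≤ m * γ + γ := by
    refine ⟨(q - 1) / γ, ?_, ?_⟩
    · have := Nat.div_mul_le_self (q - 1) γ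
      have : 0 < q := by positivity
      omega
    · have := Nat.lt_div_mul_add (a := q - 1) hγ0
      omega
  obtain ⟨l, hl1, hl2⟩ : ∃ l : ℕ, κ * r + c ≤ l * γ ∧ l * γ ≤ κ * r + c + γ := by
    refine ⟨(κ * r + c) / γ + 1, ?_, ?_⟩
    · have := Nat.lt_div_mul_add (a := κ * r + c) hγ0
      rw [add_mul, one_mul]; omega
    · have := Nat.div_mul_le_self (κ * r + c) γ
      rw [add_mul, one_mul]; omega
  let B := Module.finBasis 𝔽 (Lsp (Finsupp.single P (l : ℤ)))
  rw [← el_eq] at B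
  obtain ⟨E, Λ, hE, hdE, hΛ, hker⟩ := H m l _ (fun i => (B i : K)) (fun i => (B i).2)
  have hv : LinearIndependent 𝔽 (fun j => (B j : K)) :=
    B.linearIndependent.map' (Submodule.subtype _) (Submodule.ker_subtype _)
  have hlt : κ * el E < el (Finsupp.single P (l : ℤ)) * el (Finsupp.single P (m : ℤ)) := by
    have h1 := riemann (Finsupp.single P (l : ℤ))
    have h2 := riemann (Finsupp.single P (m : ℤ))
    have h3 := el_le hE
    rw [degD_single] at h1 h2
    obtain ⟨G, hG⟩ : ∃ G : ℕ, G = g + κ * C₀ + κ + 1 := ⟨_, rfl⟩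
    rw [← hG] at hc hn₀
    set el1 := el (Finsupp.single P (l : ℤ))
    set el2 := el (Finsupp.single P (m : ℤ))
    set el3 := el E
    rw [← hγ] at h1 h2
    clear_value el1 el2 el3 r q g γ
    have e1 : (κ * el3 : ℤ) ≤ κ * (r * m * γ + C₀ * (l + 1) + 1) := by
      have : (el3 : ℤ) ≤ r * m * γ + C₀ * (l + 1) + 1 := by push_cast [hr] at hdE ⊢; linarith
      exact mul_le_mul_of_nonneg_left this (by positivity)
    obtain ⟨M, hM⟩ : ∃ M : ℤ, M = m * γ := ⟨_, rfl⟩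
    obtain ⟨L, hL⟩ : ∃ L : ℤ, L = l * γ := ⟨_, rfl⟩
    have b1 : (r : ℤ) ≤ M + γ := by rw [hM]; exact_mod_cast hrq.trans hm2
    have b2 : (κ * r + c : ℤ) ≤ L := by rw [hL]; exact_mod_cast hl1
    have b3 : L ≤ κ * r + c + γ := by rw [hL]; exact_mod_cast hl2
    have b4 : (l : ℤ) ≤ L := by
      rw [hL]
      have : (1 : ℤ) ≤ γ := by exact_mod_cast hγ0
      nlinarith
    have c1 : (c : ℤ) = g + κ * G + 1 := by exact_mod_cast hc
    have c2 : (n₀ : ℤ) = γ * c + g + G * (c + γ + γ + 2) + γ := by exact_mod_cast hn₀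
    have c3 : (n₀ : ℤ) < r := by exact_mod_cast hr0
    have c4 : (G : ℤ) = g + κ * C₀ + κ + 1 := by exact_mod_cast hG
    have p1 : (0 : ℤ) ≤ κ * G := by positivity
    have p2 : (0 : ℤ) ≤ κ * r := by positivity
    have p3 : (0 : ℤ) ≤ G * (c + γ + γ + 2) := by positivity
    have p4 : (0 : ℤ) ≤ γ * (κ * G) := by positivity
    have p6 : (1 : ℤ) ≤ γ := by exact_mod_cast hγ0
    have p7 : (γ : ℤ) * c = γ * g + γ * (κ * G) + γ := by rw [c1]; ring
    have p8 : (0 : ℤ) ≤ γ * g := by positivity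
    have hM0 : (g : ℤ) ≤ M := by
      have : (γ : ℤ) + g ≤ r := by linarith
      linarith
    have hL0 : (g : ℤ) ≤ L := by linarith
    have e2 : (L + 1 - g) * (M + 1 - g) ≤ el1 * el2 := by
      apply mul_le_mul <;> linarith
    have e3 : (κ * G + 2 : ℤ) * (r - γ) ≤ (κ * G + 2) * M :=
      mul_le_mul_of_nonneg_left (by linarith) (by positivity)
    have e4 : (G : ℤ) * (L + 1) ≤ G * (κ * r + c + γ + 1) :=
      mul_le_mul_of_nonneg_left (by linarith) (by positivity)
    have e5 : (κ * C₀ : ℤ) * (l + 1) ≤ κ * C₀ * (L + 1) :=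
      mul_le_mul_of_nonneg_left (by linarith) (by positivity)
    have e6 : (κ : ℤ) ≤ κ * (L + 1) := le_mul_of_one_le_right (by positivity) (by linarith)
    have e7 : (κ * r + (κ * G + 2)) * M ≤ (L + 1 - g) * M :=
      mul_le_mul_of_nonneg_right (by linarith) (by linarith)
    have e8 : (0 : ℤ) ≤ G * (γ + 1) := by positivity
    have e9 : (0 : ℤ) ≤ (g : ℤ) * g := by positivity
    have key : (κ * (r * m * γ + C₀ * (l + 1) + 1) : ℤ) < (L + 1 - g) * (M + 1 - g) := by
      have k1 : (κ * (r * m * γ + C₀ * (l + 1) + 1) : ℤ) = κ * r * M + κ * C₀ * (l + 1) + κ := by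
        rw [hM]; ring
      have k2 : (G : ℤ) * (L + 1) = g * (L + 1) + κ * C₀ * (L + 1) + κ * (L + 1) + (L + 1) := by
        rw [c4]; ring
      rw [k1]
      nlinarith
    have : (κ * el3 : ℤ) < el1 * el2 := by linarith
    exact_mod_cast this
  obtain ⟨u, hu0, hu, huΛ⟩ := exists_ne_zero_map_eq_zero _ E hlt Λ hΛ
  have hne := sum_mul_basis_pow_ne_zero P hv hm1 hu hu0
  have hmem : ∑ i, u i * (B i : K) ^ q ∈ Lsp (Finsupp.single P ((m + q * l : ℕ) : ℤ)) := by
    refine sum_mem fun i _ => mem_Lsp.2 fun Q => ?_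
    have h1 := pw_mul (mem_Lsp.1 (hu i) Q) (pw_pow (mem_Lsp.1 (B i).2 Q) q)
    refine pw_anti (le_of_eq ?_) h1
    by_cases h : P = Q
    · subst h; simp; ring
    · simp [h]
  have h1 := sum_deg_le P hne hmem X hPX (hker u hu huΛ)
  refine h1.trans ?_
  rw [← hγ, pow_add, ← hr, ← hq]
  nlinarith

end Stepanov

section Upper

variable {K : Type} [Field K] [Algebra 𝔽 K] [CongFF K]

/-- The additive map `u ↦ ∑ uᵢ ^ (2 ^ a) vᵢ`. -/
def frobSum (a : ℕ) {k : ℕ} (v : Fin k → K) : (Fin k → K) →+ K where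
  toFun u := ∑ i, u i ^ 2 ^ a * v i
  map_zero' := by simp
  map_add' u w := by
    have := charP_K K
    simp only [Pi.add_apply, add_pow_char_pow, add_mul, Finset.sum_add_distrib]

lemma frobSum_apply (a : ℕ) {k : ℕ} (v u : Fin k → K) :
    frobSum a v u = ∑ i, u i ^ 2 ^ a * v i := rfl

lemma frobSum_mem (a : ℕ) {k : ℕ} {v u : Fin k → K} {D E : Dv K} (hu : ∀ i, u i ∈ Lsp D)
    (hv : ∀ i, v i ∈ Lsp E) : frobSum a v u ∈ Lsp ((2 ^ a : ℕ) • D + E) := by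
  rw [frobSum_apply]
  refine sum_mem fun i _ => mem_Lsp.2 fun Q => ?_
  have h1 := pw_mul (pw_pow (mem_Lsp.1 (hu i) Q) (2 ^ a)) (mem_Lsp.1 (hv i) Q)
  refine pw_anti (le_of_eq ?_) h1
  simp
  ring

lemma mem_pw_one_of_pow {P : Pl K} {f : K} {k : ℕ} (h : f ^ k ∈ pw P 1) : f ∈ pw P 1 := by
  by_cases hf : f = 0
  · rw [hf]; exact zero_mem _
  rw [mem_pw_of_ne (pow_ne_zero _ hf), ord_pow] at h
  rw [mem_pw_of_ne hf]
  by_contra h1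
  push Not at h1
  have : (k : ℤ) * ord P f ≤ 0 := mul_nonpos_of_nonneg_of_nonpos (by positivity) (by omega)
  omega

lemma mem_valuation_of_Lsp_single {P Q : Pl K} (h : Q ≠ P) {n : ℤ} {f : K}
    (hf : f ∈ Lsp (Finsupp.single P n : Dv K)) : f ∈ Q.1 := by
  have := mem_Lsp.1 hf Q
  rw [Finsupp.single_apply, if_neg (Ne.symm h), neg_zero] at this
  exact mem_pw_zero.1 this

lemma mul_mem_pw_one {P : Pl K} {f g : K} (hf : f ∈ P.1) (hg : g ∈ pw P 1) : f * g ∈ pw P 1 := by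
  simpa using pw_mul (mem_pw_zero.2 hf) hg

lemma sum_mul_pow_pow (a b : ℕ) {k : ℕ} (u v : Fin k → K) :
    (∑ i, u i * v i ^ 2 ^ b) ^ 2 ^ a = ∑ i, u i ^ 2 ^ a * v i ^ 2 ^ (a + b) := by
  have := charP_K K
  rw [sum_pow_char_pow]
  refine Finset.sum_congr rfl fun i _ => ?_
  rw [mul_pow, ← pow_mul, ← pow_add, add_comm b a]

/-- The upper bound for the number of points. -/
theorem numPts_le (K : Type) [Field K] [Algebra 𝔽 K] [PosGenus K] : ∃ C n₀ : ℕ, ∀ n ≥ n₀,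
    numPts K n ≤ 2 ^ n + C * 2 ^ (n - n / 2) := by
  obtain ⟨x, hx⟩ := exists_transcendental K
  obtain ⟨P, -⟩ := exists_place_pos hx
  obtain ⟨C, n₀, h⟩ := stepanov P 1 (deg P)
  refine ⟨C + deg P, 2 * n₀ + 1, fun n hn => ?_⟩
  have hab : n / 2 + (n - n / 2) = n := by omega
  have h1 := h (n / 2) (n - n / 2) (by omega) (by omega) ((placesDvd K n).erase P) (by simp) ?_
  · rw [hab, one_mul] at h1
    have h2 : numPts K n ≤ ∑ Q ∈ (placesDvd K n).erase P, deg Q + deg P := by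
      rw [numPts]
      by_cases hP : P ∈ placesDvd K n
      · rw [Finset.sum_erase_add _ _ hP]
      · rw [Finset.erase_eq_of_notMem hP]; omega
    have h3 : 1 ≤ 2 ^ (n - n / 2) := Nat.one_le_two_pow
    nlinarith
  · intro m l k v hv
    refine ⟨(2 ^ (n / 2) : ℕ) • Finsupp.single P (m : ℤ) + Finsupp.single P (l : ℤ),
      fun _ => frobSum (n / 2) v, ?_, ?_, fun u hu _ => frobSum_mem _ hu hv, ?_⟩
    · refine add_nonneg (nsmul_nonneg ?_ _) ?_ <;> simp
    · rw [map_add, map_nsmul, degD_single, degD_single, nsmul_eq_mul]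
      have : (0 : ℤ) ≤ deg P := by positivity
      push_cast
      nlinarith
    · intro u hu h0 Q hQ
      rw [Finset.mem_erase, mem_placesDvd (by omega)] at hQ
      refine mem_pw_one_of_pow (k := 2 ^ (n / 2)) ?_
      have h2 : ∑ i, u i ^ 2 ^ (n / 2) * v i = 0 := h0 0
      rw [sum_mul_pow_pow, hab, ← sub_zero (∑ i, _), ← h2, ← Finset.sum_sub_distrib]
      refine sum_mem fun i _ => ?_
      rw [← mul_sub]
      exact mul_mem_pw_one (pow_mem (mem_valuation_of_Lsp_single hQ.1 (hu i)) _)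
        (pow_dvd_sub_mem Q (mem_valuation_of_Lsp_single hQ.1 (hv i)) hQ.2)

end Upper

section RationalSubfield

variable {K : Type} [Field K] [Algebra 𝔽 K] [CongFF K]

lemma aeval_mem {P : Pl K} {x : K} (hx : x ∈ P.1) (A : 𝔽[X]) : aeval x A ∈ P.1 := by
  rw [aeval_eq_sum_range]
  exact sum_mem fun i _ => by
    rw [Algebra.smul_def]
    exact mul_mem (P.2.2 _) (pow_mem hx _)

lemma mul_mem_pw_one' {P : Pl K} {f g : K} (hf : f ∈ pw P 1) (hg : g ∈ P.1) : f * g ∈ pw P 1 :=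
  mul_comm f g ▸ mul_mem_pw_one hg hf

lemma mem_pw_one_of_mul {P : Pl K} {f g : K} (h : f * g ∈ pw P 1)
    (hg1 : g ∉ pw P 1) : f ∈ pw P 1 := by
  by_cases hf : f = 0
  · rw [hf]; exact zero_mem _
  have hg0 : g ≠ 0 := fun h => hg1 (h ▸ zero_mem _)
  rw [mem_pw_of_ne (mul_ne_zero hf hg0), ord_mul P hf hg0] at h
  rw [mem_pw_of_ne hg0] at hg1
  rw [mem_pw_of_ne hf]
  omega

lemma ord_eq_zero_iff {P : Pl K} {g : K} (hg : g ∈ P.1) (hg1 : g ∉ pw P 1) : ord P g = 0 := by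
  have hg0 : g ≠ 0 := fun h => hg1 (h ▸ zero_mem _)
  rw [mem_pw_of_ne hg0] at hg1
  rw [mem_iff_ord P hg0] at hg
  omega

lemma not_both_mem {P : Pl K} {x : K} (hx : x ∈ P.1) {A B : 𝔽[X]} (h : IsCoprime A B)
    (hA : aeval x A ∈ pw P 1) : aeval x B ∉ pw P 1 := by
  intro hB
  obtain ⟨u, v, huv⟩ := h
  have h1 := congrArg (aeval x) huv
  rw [map_add, map_mul, map_mul, map_one] at h1
  apply one_not_mem_pw P
  rw [← h1]
  exact add_mem (mul_mem_pw_one (aeval_mem hx u) hA) (mul_mem_pw_one (aeval_mem hx v) hB)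

lemma exists_num_den {P : Pl K} {x z : K} (hx : x ∈ P.1) (hz : z ∈ 𝔽⟮x⟯) (hzP : z ∈ P.1) :
    ∃ A B : 𝔽[X], z * aeval x B = aeval x A ∧ aeval x B ∉ pw P 1 := by
  by_cases hz0 : z = 0
  · exact ⟨0, 1, by simp [hz0], by rw [map_one]; exact one_not_mem_pw P⟩
  obtain ⟨A, B, rfl⟩ := (IntermediateField.mem_adjoin_simple_iff 𝔽 z).1 hz
  have hB : aeval x B ≠ 0 := fun h => hz0 (by rw [h, div_zero])
  have hB0 : B ≠ 0 := fun h => hB (by rw [h, map_zero])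
  have hg : gcd A B ≠ 0 := fun h => hB0 ((gcd_eq_zero_iff _ _).1 h).2
  obtain ⟨A', hA'⟩ := gcd_dvd_left A B
  obtain ⟨B', hB'⟩ := gcd_dvd_right A B
  have hcop : IsCoprime A' B' := by
    have h1 : gcd A B * gcd A' B' ∣ gcd A B := by
      refine dvd_gcd ?_ ?_
      · conv_rhs => rw [hA']
        exact mul_dvd_mul_left _ (gcd_dvd_left _ _)
      · conv_rhs => rw [hB']
        exact mul_dvd_mul_left _ (gcd_dvd_right _ _)
    rw [← gcd_isUnit_iff]
    obtain ⟨c, hc⟩ := h1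
    refine IsUnit.of_mul_eq_one c (mul_left_cancel₀ hg ?_)
    rw [← mul_assoc, ← hc, mul_one]
  have hgx : aeval x (gcd A B) ≠ 0 := by
    intro h
    apply hB
    rw [hB', map_mul, h, zero_mul]
  have hBx : aeval x B' ≠ 0 := by
    intro h
    apply hB
    rw [hB', map_mul, h, mul_zero]
  have hquot : aeval x A / aeval x B * aeval x B' = aeval x A' := by
    have h1 : aeval x A = aeval x (gcd A B) * aeval x A' := by rw [← map_mul, ← hA']
    have h2 : aeval x B = aeval x (gcd A B) * aeval x B' := by rw [← map_mul, ← hB']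
    rw [h1, h2, mul_div_mul_left _ _ hgx, div_mul_cancel₀ _ hBx]
  refine ⟨A', B', hquot, fun h => ?_⟩
  refine not_both_mem hx hcop.symm h ?_
  rw [← hquot]
  exact mul_mem_pw_one hzP h

lemma aeval_pow_sub_mem {P : Pl K} {x : K} (hx : x ∈ P.1) {n : ℕ} (h : x ^ 2 ^ n - x ∈ pw P 1)
    (A : 𝔽[X]) : (aeval x A) ^ 2 ^ n - aeval x A ∈ pw P 1 := by
  rw [← aeval_pow_two_pow]
  have h2 : ∀ (k : ℕ), (x ^ 2 ^ n) ^ k - x ^ k ∈ pw P 1 := by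
    intro k
    induction k with
    | zero => simp
    | succ k ih =>
      have : (x ^ 2 ^ n) ^ (k + 1) - x ^ (k + 1) =
          (x ^ 2 ^ n) ^ k * (x ^ 2 ^ n - x) + ((x ^ 2 ^ n) ^ k - x ^ k) * x := by ring
      rw [this]
      exact add_mem (mul_mem_pw_one (pow_mem (pow_mem hx _) _) h) (mul_mem_pw_one' ih hx)
  rw [aeval_eq_sum_range, aeval_eq_sum_range, ← Finset.sum_sub_distrib]
  refine sum_mem fun k _ => ?_
  rw [← smul_sub]
  exact Submodule.smul_mem _ _ (h2 k)

lemma pow_sub_mem_of_mem_adjoin {P : Pl K} {x z : K} (hx : x ∈ P.1) {n : ℕ}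
    (h : x ^ 2 ^ n - x ∈ pw P 1) (hz : z ∈ 𝔽⟮x⟯) (hzP : z ∈ P.1) : z ^ 2 ^ n - z ∈ pw P 1 := by
  obtain ⟨A, B, hAB, hB⟩ := exists_num_den hx hz hzP
  refine mem_pw_one_of_mul ?_ hB
  have h1 : (z ^ 2 ^ n - z) * aeval x B =
      ((aeval x A) ^ 2 ^ n - aeval x A) - z ^ 2 ^ n * ((aeval x B) ^ 2 ^ n - aeval x B) := by
    rw [← hAB]; ring
  rw [h1]
  exact sub_mem (aeval_pow_sub_mem hx h A)
    (mul_mem_pw_one (pow_mem hzP _) (aeval_pow_sub_mem hx h B))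

lemma ord_pow_sub_le {P : Pl K} {x : K} (hx : x ∈ P.1) {n : ℕ} (hn : n ≠ 0)
    (h : x ^ 2 ^ n - x ∈ pw P 1) {A : 𝔽[X]} (hA : aeval x A ∈ pw P 1) (hA0 : aeval x A ≠ 0) :
    ord P (x ^ 2 ^ n - x) ≤ ord P (aeval x A) := by
  by_cases h0 : x ^ 2 ^ n - x = 0
  · rw [h0, ord_zero]
    have := (mem_pw_of_ne hA0).1 hA
    omega
  set Q : 𝔽[X] := X ^ 2 ^ n - X with hQ
  have hQx : aeval x Q = x ^ 2 ^ n - x := by simp [hQ]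
  have hsep : Q.Separable := galois_poly_separable 2 (2 ^ n) (dvd_pow_self 2 hn)
  obtain ⟨A', hA'⟩ := gcd_dvd_left A Q
  obtain ⟨M, hM⟩ := gcd_dvd_right A Q
  have hg : aeval x (gcd A Q) ∈ pw P 1 := by
    obtain ⟨u, v, huv⟩ := exists_gcd_eq_mul_add_mul A Q
    rw [huv, map_add, map_mul, map_mul]
    exact add_mem (mul_mem_pw_one' hA (aeval_mem hx u)) (mul_mem_pw_one' (hQx ▸ h) (aeval_mem hx v))
  have hcop : IsCoprime (gcd A Q) M := by
    rw [hM] at hsep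
    exact hsep.isCoprime
  have hM1 := not_both_mem hx hcop hg
  have hMx : aeval x (gcd A Q) * aeval x M = x ^ 2 ^ n - x := by rw [← map_mul, ← hM, hQx]
  have hAx : aeval x (gcd A Q) * aeval x A' = aeval x A := by rw [← map_mul, ← hA']
  rw [← hMx] at h0 ⊢
  rw [← hAx] at hA0 ⊢
  rw [ord_mul P (left_ne_zero_of_mul h0) (right_ne_zero_of_mul h0),
    ord_mul P (left_ne_zero_of_mul hA0) (right_ne_zero_of_mul hA0),
    ord_eq_zero_iff (aeval_mem hx M) hM1]
  have := (mem_iff_ord P (right_ne_zero_of_mul hA0)).1 (aeval_mem hx A')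
  omega

lemma ord_pow_sub_eq_one {P : Pl K} {x t : K} (hx : x ∈ P.1) {n : ℕ} (hn : n ≠ 0)
    (h : x ^ 2 ^ n - x ∈ pw P 1) (h0 : x ^ 2 ^ n - x ≠ 0) (ht : t ∈ 𝔽⟮x⟯) (ht1 : ord P t = 1) :
    ord P (x ^ 2 ^ n - x) = 1 := by
  have ht0 : t ≠ 0 := by rintro rfl; simp at ht1
  obtain ⟨A, B, hAB, hB⟩ := exists_num_den hx ht ((mem_iff_ord P ht0).2 (by omega))
  have hBx : aeval x B ≠ 0 := fun h => hB (h ▸ zero_mem _)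
  have hA : ord P (aeval x A) = 1 := by
    rw [← hAB, ord_mul P ht0 hBx, ht1, ord_eq_zero_iff (aeval_mem hx B) hB, add_zero]
  have hA0 : aeval x A ≠ 0 := hAB ▸ mul_ne_zero ht0 hBx
  have h1 := ord_pow_sub_le hx hn h ((mem_pw_of_ne hA0).2 hA.ge) hA0
  have h2 := (mem_pw_of_ne h0).1 h
  omega

/-- If every integral element at `P` is fixed by the `2 ^ n`-Frobenius modulo `P`, then the
degree of `P` divides `n`. -/
lemma deg_dvd_of_forall {P : Pl K} {n : ℕ} (h : ∀ z ∈ P.1, z ^ 2 ^ n - z ∈ pw P 1) :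
    deg P ∣ n := by
  obtain ⟨s, hs, f, hfm, hfi, hfd, hfs, -⟩ := exists_residue_gen P
  rw [← hfd]
  refine hfi.natDegree_dvd_of_dvd_X_pow_card_pow_sub_X ?_
  rw [Nat.card_zmod]
  by_contra hnd
  have hcop : IsCoprime f (X ^ 2 ^ n - X) := (EuclideanDomain.dvd_or_coprime f _ hfi).resolve_left hnd
  refine not_both_mem hs hcop hfs ?_
  simpa using h s hs

/-- The degree count for `x ^ 2 ^ n - x`. -/
lemma degD_pow_sub {x : K} (hx : Transcendental 𝔽 x) {n : ℕ} (hn : n ≠ 0) :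
    degD (zdv (x ^ 2 ^ n - x)) = 2 ^ n * dg x := by
  have h2 : Transcendental 𝔽 (x ^ 2 ^ n - x) := by
    rw [transcendental_iff]
    refine ⟨pow_sub_ne hx hn, fun h => hx ⟨X ^ 2 ^ n - X - 1, ?_, by simp [h]⟩⟩
    have hd : (X ^ 2 ^ n - X : 𝔽[X]).natDegree = 2 ^ n :=
      FiniteField.X_pow_card_pow_sub_X_natDegree_eq 𝔽 hn (by norm_num)
    intro h0
    rw [sub_eq_zero.1 h0, natDegree_one] at hd
    exact absurd hd (by positivity)
  have hx0 : x ≠ 0 := (transcendental_iff.1 hx).1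
  have h3 : zdv (x ^ 2 ^ n - x)⁻¹ = 2 ^ n • zdv x⁻¹ := by
    ext P
    simp only [zdv_apply, Finsupp.coe_smul, Pi.smul_apply, ord_inv, nsmul_eq_mul, Nat.cast_pow,
      Nat.cast_ofNat]
    by_cases hP : x ∈ P.1
    · have h4 : x ^ 2 ^ n - x ∈ P.1 := sub_mem (pow_mem hP _) hP
      rw [mem_iff_ord P hx0] at hP
      rw [mem_iff_ord P (pow_sub_ne hx hn)] at h4
      rw [max_eq_right (by omega), max_eq_right (by omega), mul_zero]
    · rw [mem_iff_ord P hx0] at hP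
      have hpow : (2 : ℤ) ≤ 2 ^ n := by
        calc (2 : ℤ) = 2 ^ 1 := by norm_num
          _ ≤ 2 ^ n := pow_le_pow_right₀ (by norm_num) (by omega)
      have h5 := ord_add_of_ord_lt P (f := x ^ 2 ^ n) (g := x) (pow_ne_zero _ hx0) hx0 (by
        rw [ord_pow]
        push_cast
        nlinarith)
      rw [sub_K, h5.2, ord_pow, max_eq_left (by nlinarith), max_eq_left]
      · push_cast; ring
      · nlinarith
  rw [degD_zero' h2, ← degD_pole h2, h3, map_nsmul, degD_pole hx, nsmul_eq_mul]
  push_cast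
  ring

open scoped IntermediateField.algebraAdjoinAdjoin in
/-- A separating transcendental element. -/
lemma exists_separating (K : Type) [Field K] [Algebra 𝔽 K] [CongFF K] :
    ∃ x : K, Transcendental 𝔽 x ∧ Algebra.IsSeparable 𝔽⟮x⟯ K := by
  obtain ⟨y, hy⟩ := exists_transcendental K
  have hfin := finite_over_adjoin hy
  have : Algebra.EssFiniteType 𝔽 K := by
    have h1 : Algebra.EssFiniteType 𝔽 𝔽⟮y⟯ :=
      IntermediateField.essFiniteType_iff.2 ⟨{y}, by simp⟩
    exact Algebra.EssFiniteType.comp 𝔽 𝔽⟮y⟯ K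
  obtain ⟨s, hs, hsep⟩ := exists_isTranscendenceBasis_and_isSeparable_of_perfectField 𝔽 K
  have hcard : s.card = 1 := by
    have h1 : Algebra.trdeg 𝔽 K = s.card := by
      rw [← hs.cardinalMk_eq_trdeg]
      simp
    have h2 : IsTranscendenceBasis 𝔽 (fun _ : Unit => y) := by
      refine isTranscendenceBasis_iff_algebraicIndependent_isAlgebraic.2 ⟨?_, ?_⟩
      · exact algebraicIndependent_unique_type_iff.2 hy
      · rw [Set.range_const]
        have : Algebra.IsAlgebraic 𝔽⟮y⟯ K := inferInstance
        exact (IsFractionRing.comap_isAlgebraic_iff (A := Algebra.adjoin 𝔽 {y}) (K := 𝔽⟮y⟯)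
          (C := K)).2 this
    have h3 := h2.cardinalMk_eq_trdeg
    rw [h1] at h3
    simpa using h3.symm
  obtain ⟨x, rfl⟩ := Finset.card_eq_one.1 hcard
  refine ⟨x, ?_, by rw [Finset.coe_singleton] at hsep; exact hsep⟩
  have := hs.1.transcendental ⟨x, by simp⟩
  exact this

end RationalSubfield

section Complement

variable {K : Type} [Field K] [Algebra 𝔽 K]

section FixedSubring

variable [CongFF K]

/-- The elements integral at `P` whose residue is fixed by the `2 ^ n`-Frobenius. -/
def fixSub (P : Pl K) (n : ℕ) : Subring K where
  carrier := {z | z ∈ P.1 ∧ z ^ 2 ^ n - z ∈ pw P 1}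
  mul_mem' := by
    rintro a b ⟨ha, ha'⟩ ⟨hb, hb'⟩
    refine ⟨mul_mem ha hb, ?_⟩
    have : (a * b) ^ 2 ^ n - a * b = a ^ 2 ^ n * (b ^ 2 ^ n - b) + b * (a ^ 2 ^ n - a) := by ring
    rw [this]
    exact add_mem (mul_mem_pw_one (pow_mem ha _) hb') (mul_mem_pw_one hb ha')
  one_mem' := ⟨one_mem _, by simp⟩
  add_mem' := by
    rintro a b ⟨ha, ha'⟩ ⟨hb, hb'⟩
    have := charP_K K
    refine ⟨add_mem ha hb, ?_⟩
    rw [add_pow_char_pow, add_sub_add_comm]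
    exact add_mem ha' hb'
  zero_mem' := ⟨zero_mem _, by simp⟩
  neg_mem' := by
    rintro a ha
    rwa [neg_K]

lemma mem_fixSub {P : Pl K} {n : ℕ} {z : K} :
    z ∈ fixSub P n ↔ z ∈ P.1 ∧ z ^ 2 ^ n - z ∈ pw P 1 := Iff.rfl

lemma mem_of_pow_sub_mem {P : Pl K} {x : K} {n : ℕ} (hn : n ≠ 0) (h : x ^ 2 ^ n - x ∈ P.1) :
    x ∈ P.1 := by
  by_contra hP
  have hx0 : x ≠ 0 := by rintro rfl; exact hP (zero_mem _)
  rw [mem_iff_ord P hx0] at hP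
  have hpow : (2 : ℤ) ≤ 2 ^ n := by
    calc (2 : ℤ) = 2 ^ 1 := by norm_num
      _ ≤ 2 ^ n := pow_le_pow_right₀ (by norm_num) (by omega)
  have h5 := ord_add_of_ord_lt P (f := x ^ 2 ^ n) (g := x) (pow_ne_zero _ hx0) hx0 (by
    rw [ord_pow]
    push_cast
    nlinarith)
  rw [sub_K, mem_iff_ord P h5.1, h5.2, ord_pow] at h
  push_cast at h
  nlinarith

end FixedSubring

section Trace

variable (E : IntermediateField 𝔽 K) [CongFF K] [CongFF E] [FiniteDimensional E K]
  [Algebra.IsSeparable E K]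

lemma trace_mem_Lsp {D : Dv E} {z : K} (h : z ∈ Lsp (con E D)) :
    Algebra.trace E K z ∈ Lsp D := by
  refine mem_Lsp.2 fun p => trace_mem_pw E _ fun P hP => ?_
  have := mem_Lsp.1 h P
  rw [con_apply, (mem_abv E).1 hP] at this
  rwa [mul_neg]

omit [Algebra.IsSeparable E K] in
lemma exists_con_ge (D : Dv K) : ∃ D' : Dv E, 0 ≤ D' ∧ D ≤ con E D' := by
  refine ⟨∑ P ∈ D.support, Finsupp.single (res E P) |D P|, ?_, fun P => ?_⟩
  · exact Finset.sum_nonneg fun P _ => Finsupp.single_nonneg.2 (abs_nonneg _)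
  · rw [con_apply]
    by_cases hP : P ∈ D.support
    · have h1 : |D P| ≤ (∑ Q ∈ D.support, Finsupp.single (res E Q) |D Q| : Dv E) (res E P) := by
        rw [Finsupp.finsetSum_apply]
        have h2 := Finset.single_le_sum (s := D.support)
          (f := fun Q => (Finsupp.single (res E Q) |D Q| : Dv E) (res E P))
          (fun Q _ => by
            rw [Finsupp.single_apply]
            split_ifs
            · exact abs_nonneg _
            · exact le_rfl) hP
        simpa using h2
      have h3 := ram_pos E P
      have h4 := le_abs_self (D P)
      have h5 := abs_nonneg (D P)
      nlinarith
    · rw [Finsupp.notMem_support_iff.1 hP]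
      refine mul_nonneg (ram_pos E P).le ?_
      rw [Finsupp.finsetSum_apply]
      refine Finset.sum_nonneg fun Q _ => ?_
      rw [Finsupp.single_apply]
      split_ifs
      · exact abs_nonneg _
      · exact le_rfl

omit [CongFF K] [CongFF E] in
/-- A power basis together with its dual basis for the trace form. -/
lemma exists_trace_basis : ∃ (y : K) (e : Fin (Module.finrank E K) → K),
    (∀ z, z = ∑ b : Fin (Module.finrank E K), (Algebra.trace E K (z * e b) : K) * y ^ (b : ℕ)) ∧
    ∀ z, z = ∑ b : Fin (Module.finrank E K), (Algebra.trace E K (z * y ^ (b : ℕ)) : K) * e b := by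
  let pb := Field.powerBasisOfFiniteOfSeparable E K
  rw [pb.finrank]
  refine ⟨pb.gen, pb.basis.traceDual, fun z => ?_, fun z => ?_⟩
  · have h := pb.basis.sum_repr z
    conv_lhs => rw [← h]
    refine Finset.sum_congr rfl fun b _ => ?_
    rw [Algebra.smul_def, pb.coe_basis]
    congr 1
    have h2 := pb.basis.traceDual.traceDual_repr_apply z b
    rw [pb.basis.traceDual_traceDual] at h2
    rw [h2]
    rfl
  · have h := pb.basis.traceDual.sum_repr z
    conv_lhs => rw [← h]
    refine Finset.sum_congr rfl fun b _ => ?_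
    rw [Algebra.smul_def, pb.basis.traceDual_repr_apply, pb.coe_basis]
    rfl

end Trace

end Complement

section Kernel

variable {K : Type} [Field K] [Algebra 𝔽 K] [CongFF K]

section Good

variable (E : IntermediateField 𝔽 K) [CongFF E] [FiniteDimensional E K] {d : ℕ}

/-- The basis `yᵇ` and its dual `e` are integral over the place of `E` below `P`. -/
def IsGood (y : K) (e : Fin d → K) (P : Pl K) : Prop :=
  ∀ P' ∈ abv E (res E P), y ∈ P'.1 ∧ ∀ b, e b ∈ P'.1

lemma self_mem_abv (P : Pl K) : P ∈ abv E (res E P) := (mem_abv E).2 rfl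

lemma finite_not_good (y : K) (e : Fin d → K) : {P : Pl K | ¬ IsGood E y e P}.Finite := by
  have h1 : ({P : Pl K | y ∉ P.1} ∪ ⋃ b, {P : Pl K | e b ∉ P.1}).Finite :=
    (finite_not_mem y).union (Set.finite_iUnion fun b => finite_not_mem (e b))
  refine (h1.biUnion fun P' _ => (abv E (res E P')).finite_toSet).subset fun P hP => ?_
  rw [Set.mem_ofPred_eq, IsGood] at hP
  push Not at hP
  obtain ⟨P', hP', h⟩ := hP
  simp only [Set.mem_iUnion]
  refine ⟨P', ?_, by simp [(mem_abv E).1 hP']⟩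
  by_cases hy : y ∈ P'.1
  · obtain ⟨b, hb⟩ := h hy
    exact Or.inr (Set.mem_iUnion.2 ⟨b, hb⟩)
  · exact Or.inl hy

variable [Algebra.IsSeparable E K]

omit [Algebra.IsSeparable E K] in
lemma trace_mem_of_forall {P : Pl K} {z : K}
    (hz : ∀ P' ∈ abv E (res E P), z ∈ P'.1) :
    (Algebra.trace E K z : K) ∈ P.1 := (mem_res E).1 (trace_mem E hz)

lemma ram_eq_one_of_good {y : K} {e : Fin d → K} {P : Pl K} (h : IsGood E y e P)
    (hy : ∀ z, z = ∑ b : Fin d, (Algebra.trace E K (z * y ^ (b : ℕ)) : K) * e b) :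
    ram E P = 1 := by
  obtain ⟨t, ht0, ht⟩ := approx_ord (abv E (res E P)) (abv_nonempty E _) (fun _ => 1)
  have h1 : t ∈ pw P (ram E P) := by
    rw [hy t]
    refine sum_mem fun b _ => ?_
    have h2 : Algebra.trace E K (t * y ^ (b : ℕ)) ∈ pw (res E P) 1 := by
      refine trace_mem_max E fun P' hP' => ?_
      exact mul_mem_pw_one' ((mem_pw_of_ne ht0).2 (ht P' hP').ge) (pow_mem (h P' hP').1 _)
    rw [← coe_mem_pw, mul_one] at h2
    simpa using pw_mul h2 (mem_pw_zero.2 ((h P (self_mem_abv E P)).2 b))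
  rw [mem_pw_of_ne ht0, ht P (self_mem_abv E P)] at h1
  have := ram_pos E P
  omega

end Good

variable {x : K} [CongFF 𝔽⟮x⟯] [FiniteDimensional 𝔽⟮x⟯ K] [Algebra.IsSeparable 𝔽⟮x⟯ K]
  {d : ℕ} {y : K} {e : Fin d → K} {P : Pl K} {n : ℕ}

lemma coe_mem_fixSub (hx : x ∈ fixSub P n) {t : 𝔽⟮x⟯} (ht : (t : K) ∈ P.1) :
    (t : K) ∈ fixSub P n := ⟨ht, pow_sub_mem_of_mem_adjoin hx.1 hx.2 t.2 ht⟩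

lemma mem_fixSub_of_good (hx : x ∈ fixSub P n) (h : IsGood 𝔽⟮x⟯ y e P) (hyn : y ∈ fixSub P n)
    (hy : ∀ z, z = ∑ b : Fin d, (Algebra.trace 𝔽⟮x⟯ K (z * e b) : K) * y ^ (b : ℕ))
    {z : K} (hz : z ∈ P.1) : z ∈ fixSub P n := by
  obtain ⟨z', hz'⟩ := approx (abv 𝔽⟮x⟯ (res 𝔽⟮x⟯ P)) (fun P' => if P' = P then z else 0) fun _ => 1
  have h1 : z' ∈ fixSub P n := by
    rw [hy z']
    refine sum_mem fun b _ => mul_mem (coe_mem_fixSub hx ?_) (pow_mem hyn _)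
    refine trace_mem_of_forall 𝔽⟮x⟯ fun P' hP' => mul_mem ?_ ((h P' hP').2 b)
    have h2 := hz' P' hP'
    rw [← sub_add_cancel z' (if P' = P then z else 0)]
    refine add_mem (mem_pw_zero.1 (pw_anti (by norm_num) h2)) ?_
    split_ifs with h3
    · rwa [h3]
    · exact zero_mem _
  have h2 := hz' P (self_mem_abv _ P)
  rw [if_pos rfl] at h2
  have h3 : z' - z ∈ fixSub P n := by
    refine ⟨sub_mem h1.1 hz, sub_mem ?_ h2⟩
    rw [← Nat.sub_add_cancel (Nat.one_le_two_pow (n := n)), pow_succ]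
    exact mul_mem_pw_one (pow_mem (sub_mem h1.1 hz) _) h2
  have := sub_mem h1 h3
  rwa [sub_sub_cancel] at this

lemma sum_mul_pow_mem_pw_one (hx : x ∈ fixSub P n) (h : IsGood 𝔽⟮x⟯ y e P)
    (hyn : y ∉ fixSub P n)
    (hy : ∀ z, z = ∑ b : Fin d, (Algebra.trace 𝔽⟮x⟯ K (z * e b) : K) * y ^ (b : ℕ))
    (he : ∀ z, z = ∑ b : Fin d, (Algebra.trace 𝔽⟮x⟯ K (z * y ^ (b : ℕ)) : K) * e b) :
    ∑ b : Fin d, y ^ (b : ℕ) * e b ^ 2 ^ n ∈ pw P 1 := by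
  have hP := h P (self_mem_abv _ P)
  set q := 2 ^ n with hq
  let M : Fin d → Fin d → K := fun a b => (Algebra.trace 𝔽⟮x⟯ K (y * e b * y ^ (a : ℕ)) : K)
  have hM : ∀ a b, M a b ^ q - M a b ∈ pw P 1 := fun a b => (coe_mem_fixSub hx
    (trace_mem_of_forall 𝔽⟮x⟯ fun P' hP' =>
      mul_mem (mul_mem (h P' hP').1 ((h P' hP').2 b)) (pow_mem (h P' hP').1 _))).2
  have h1 : y ^ q * ∑ b : Fin d, y ^ (b : ℕ) * e b ^ q =
      ∑ b : Fin d, ∑ a : Fin d, y ^ (b : ℕ) * M a b ^ q * e a ^ q := by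
    have := charP_K K
    rw [Finset.mul_sum]
    refine Finset.sum_congr rfl fun b _ => ?_
    have h2 : y ^ q * (y ^ (b : ℕ) * e b ^ q) = y ^ (b : ℕ) * (y * e b) ^ q := by ring
    rw [h2, he (y * e b), hq, sum_pow_char_pow, Finset.mul_sum]
    exact Finset.sum_congr rfl fun a _ => by rw [mul_pow, ← mul_assoc]
  have h2 : y * ∑ b : Fin d, y ^ (b : ℕ) * e b ^ q =
      ∑ b : Fin d, ∑ a : Fin d, y ^ (b : ℕ) * M a b * e a ^ q := by
    rw [Finset.sum_comm, Finset.mul_sum]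
    refine Finset.sum_congr rfl fun a _ => ?_
    rw [← Finset.sum_mul, ← mul_assoc]
    congr 1
    rw [← pow_succ', hy (y ^ ((a : ℕ) + 1))]
    refine Finset.sum_congr rfl fun b _ => ?_
    rw [mul_comm]
    congr 3
    ring
  refine mem_pw_one_of_mul (g := y ^ q - y) ?_ fun h => hyn ⟨hP.1, h⟩
  rw [mul_comm, sub_mul, h1, h2, ← Finset.sum_sub_distrib]
  refine sum_mem fun b _ => ?_
  rw [← Finset.sum_sub_distrib]
  refine sum_mem fun a _ => ?_
  have h3 : y ^ (b : ℕ) * M a b ^ q * e a ^ q - y ^ (b : ℕ) * M a b * e a ^ q =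
    (y ^ (b : ℕ) * e a ^ q) * (M a b ^ q - M a b) := by ring
  rw [h3]
  exact mul_mem_pw_one (mul_mem (pow_mem hP.1 _) (pow_mem (hP.2 a) _)) (hM a b)

lemma not_mem_fixSub_of_not_dvd (hx : x ∈ fixSub P n) (h : IsGood 𝔽⟮x⟯ y e P)
    (hn : ¬ deg P ∣ n)
    (hy : ∀ z, z = ∑ b : Fin d, (Algebra.trace 𝔽⟮x⟯ K (z * e b) : K) * y ^ (b : ℕ)) :
    y ∉ fixSub P n := fun hyn =>
  hn (deg_dvd_of_forall fun _ hz => (mem_fixSub_of_good hx h hyn hy hz).2)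

/-- Vanishing at the points which are rational over `𝔽⟮x⟯` only. -/
lemma sum_mul_pow_mem_of_kernel (a b : ℕ) (hx : x ∈ fixSub P (a + b)) (h : IsGood 𝔽⟮x⟯ y e P)
    (hn : ¬ deg P ∣ a + b)
    (hy : ∀ z, z = ∑ c : Fin d, (Algebra.trace 𝔽⟮x⟯ K (z * e c) : K) * y ^ (c : ℕ))
    (he : ∀ z, z = ∑ c : Fin d, (Algebra.trace 𝔽⟮x⟯ K (z * y ^ (c : ℕ)) : K) * e c)
    {k : ℕ} {u v : Fin k → K} (hu : ∀ i, u i ∈ P.1)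
    (hv : ∀ i, ∀ P' ∈ abv 𝔽⟮x⟯ (res 𝔽⟮x⟯ P), v i ∈ P'.1) (W : K)
    (hW : ∀ c : Fin d,
      ∑ i, u i ^ 2 ^ a * (Algebra.trace 𝔽⟮x⟯ K (v i * y ^ (c : ℕ)) : K) = W * y ^ (c : ℕ))
    (hWP : W ∈ P.1) :
    ∑ i, u i * v i ^ 2 ^ b ∈ pw P 1 := by
  refine mem_pw_one_of_pow (k := 2 ^ a) ?_
  rw [sum_mul_pow_pow]
  have hP := h P (self_mem_abv _ P)
  let t : Fin k → Fin d → K := fun i c => (Algebra.trace 𝔽⟮x⟯ K (v i * y ^ (c : ℕ)) : K)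
  have ht : ∀ i c, t i c ^ 2 ^ (a + b) - t i c ∈ pw P 1 := fun i c => (coe_mem_fixSub hx
    (trace_mem_of_forall 𝔽⟮x⟯ fun P' hP' =>
      mul_mem (hv i P' hP') (pow_mem (h P' hP').1 _))).2
  have h1 : ∑ i, u i ^ 2 ^ a * v i ^ 2 ^ (a + b) =
      ∑ i, ∑ c, u i ^ 2 ^ a * (t i c ^ 2 ^ (a + b) * e c ^ 2 ^ (a + b)) := by
    have := charP_K K
    refine Finset.sum_congr rfl fun i _ => ?_
    conv_lhs => rw [he (v i)]
    rw [sum_pow_char_pow, Finset.mul_sum]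
    exact Finset.sum_congr rfl fun c _ => by rw [mul_pow]
  have h2 : W * ∑ c : Fin d, y ^ (c : ℕ) * e c ^ 2 ^ (a + b) =
      ∑ i, ∑ c, u i ^ 2 ^ a * (t i c * e c ^ 2 ^ (a + b)) := by
    rw [Finset.sum_comm, Finset.mul_sum]
    refine Finset.sum_congr rfl fun c _ => ?_
    rw [← mul_assoc, ← hW c, Finset.sum_mul]
    exact Finset.sum_congr rfl fun i _ => by rw [mul_assoc]
  have h3 := mul_mem_pw_one hWP (sum_mul_pow_mem_pw_one hx h
    (not_mem_fixSub_of_not_dvd hx h hn hy) hy he)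
  rw [h2] at h3
  rw [h1, ← sub_add_cancel (∑ i, ∑ c, _) (∑ i, ∑ c, u i ^ 2 ^ a * (t i c * e c ^ 2 ^ (a + b)))]
  refine add_mem ?_ h3
  rw [← Finset.sum_sub_distrib]
  refine sum_mem fun i _ => ?_
  rw [← Finset.sum_sub_distrib]
  refine sum_mem fun c _ => ?_
  have h4 : u i ^ 2 ^ a * (t i c ^ 2 ^ (a + b) * e c ^ 2 ^ (a + b)) -
      u i ^ 2 ^ a * (t i c * e c ^ 2 ^ (a + b)) =
      (u i ^ 2 ^ a * e c ^ 2 ^ (a + b)) * (t i c ^ 2 ^ (a + b) - t i c) := by ring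
  rw [h4]
  exact mul_mem_pw_one (mul_mem (pow_mem (hu i) _) (pow_mem (hP.2 c) _)) (ht i c)

end Kernel

section Lower

variable {K : Type} [Field K] [Algebra 𝔽 K] [PosGenus K]

theorem sum_deg_complement_le {x : K} (hx : Transcendental 𝔽 x) [CongFF 𝔽⟮x⟯]
    [FiniteDimensional 𝔽⟮x⟯ K] [Algebra.IsSeparable 𝔽⟮x⟯ K] :
    ∃ (C n₀ : ℕ) (S : Finset (Pl K)), (∀ P, P ∉ S → ram 𝔽⟮x⟯ P = 1) ∧
      ∀ n ≥ n₀, ∀ X : Finset (Pl K), (∀ P ∈ X, P ∉ S ∧ x ∈ fixSub P n ∧ ¬ deg P ∣ n) →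
        ∑ P ∈ X, deg P ≤ (dg x - 1) * 2 ^ n + C * 2 ^ (n - n / 2) := by
  obtain ⟨κ, hκ⟩ : ∃ κ, Module.finrank 𝔽⟮x⟯ K = κ + 1 :=
    Nat.exists_eq_succ_of_ne_zero Module.finrank_pos.ne'
  have hbasis := exists_trace_basis 𝔽⟮x⟯
  rw [hκ] at hbasis
  obtain ⟨y, e, hy, he⟩ := hbasis
  obtain ⟨P₀, hP₀⟩ := exists_place_pos (transcendental_inv hx)
  let x' : 𝔽⟮x⟯ := ⟨x, mem_adjoin_simple_self 𝔽 x⟩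
  set I : Dv 𝔽⟮x⟯ := zdv x'⁻¹ with hI
  have hconI : con 𝔽⟮x⟯ I = zdv x⁻¹ := con_zdv _ _
  have hI0 : (0 : Dv K) ≤ con 𝔽⟮x⟯ I := hconI ▸ zdv_nonneg _
  have hdegI : degD (con 𝔽⟮x⟯ I) = κ + 1 := by
    rw [hconI, degD_pole hx, dg, hκ]
    push_cast
    rfl
  have hPI : (Finsupp.single P₀ 1 : Dv K) ≤ con 𝔽⟮x⟯ I := by
    intro Q
    rw [Finsupp.single_apply]
    split_ifs with h
    · rw [← h, hconI, zdv_apply]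
      exact le_trans hP₀ (le_max_left _ _)
    · exact hI0 Q
  obtain ⟨D, hD0, hD⟩ := exists_con_ge 𝔽⟮x⟯ (∑ b ∈ Finset.range (κ + 1), zdv (y ^ b)⁻¹)
  have hyD : ∀ b < κ + 1, y ^ b ∈ Lsp (con 𝔽⟮x⟯ D) := by
    intro b hb
    refine Lsp_mono ((Finset.single_le_sum (f := fun b => zdv (y ^ b)⁻¹)
      (fun b _ => zdv_nonneg _) (Finset.mem_range.2 hb)).trans hD) (mem_Lsp.2 fun Q => ?_)
    by_cases h0 : y ^ b = 0
    · rw [h0]; exact zero_mem _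
    rw [mem_pw_of_ne h0, zdv_apply, ord_inv]
    have := le_max_left (-ord Q (y ^ b)) 0
    omega
  have hcD0 : 0 ≤ con 𝔽⟮x⟯ D := con_nonneg _ hD0
  obtain ⟨C, n₀, h⟩ := stepanov P₀ κ (κ + 1 + 2 * (degD (con 𝔽⟮x⟯ D)).toNat)
  set S : Finset (Pl K) := (finite_not_good 𝔽⟮x⟯ y e).toFinset ∪ abv 𝔽⟮x⟯ (res 𝔽⟮x⟯ P₀) with hS
  have hSgood : ∀ P, P ∉ S → IsGood 𝔽⟮x⟯ y e P := by
    intro P hP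
    simp only [hS, Finset.mem_union, Set.Finite.mem_toFinset, Set.mem_ofPred_eq, not_or,
      not_not] at hP
    exact hP.1
  refine ⟨C, 2 * n₀ + 1, S, fun P hP => ram_eq_one_of_good _ (hSgood P hP) he,
    fun n hn X hX => ?_⟩
  have hab : n / 2 + (n - n / 2) = n := by omega
  have hSP : ∀ P ∈ X, P ∉ abv 𝔽⟮x⟯ (res 𝔽⟮x⟯ P₀) := fun P hP h => (hX P hP).1
    (Finset.mem_union_right _ h)
  have h1 := h (n / 2) (n - n / 2) (by omega) (by omega) X
    (fun hP => hSP P₀ hP (self_mem_abv _ _)) ?_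
  · rw [hab] at h1
    have : dg x - 1 = κ := by rw [dg, hκ]; rfl
    rwa [this]
  intro m l k v hv
  let J : Dv 𝔽⟮x⟯ := l • I + D
  have hvJ : ∀ i (c : Fin (κ + 1)), (Algebra.trace 𝔽⟮x⟯ K (v i * y ^ (c : ℕ)) : K) ∈
      Lsp (con 𝔽⟮x⟯ J) := by
    intro i c
    refine (mem_Lsp_con _).2 (trace_mem_Lsp _ (mem_Lsp.2 fun Q => ?_))
    have h2 := pw_mul (mem_Lsp.1 (hv i) Q) (mem_Lsp.1 (hyD c c.2) Q)
    refine pw_anti ?_ h2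
    have h3 : (Finsupp.single P₀ (l : ℤ) : Dv K) Q ≤ l * con 𝔽⟮x⟯ I Q := by
      have h4 : (Finsupp.single P₀ (l : ℤ) : Dv K) = l • Finsupp.single P₀ 1 := by simp
      rw [h4, Finsupp.smul_apply, nsmul_eq_mul]
      exact mul_le_mul_of_nonneg_left (hPI Q) (by positivity)
    have h4 : con 𝔽⟮x⟯ J = l • con 𝔽⟮x⟯ I + con 𝔽⟮x⟯ D := by simp only [J, map_add, map_nsmul]
    rw [h4, Finsupp.add_apply, Finsupp.smul_apply, nsmul_eq_mul]
    linarith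
  refine ⟨(2 ^ (n / 2) : ℕ) • Finsupp.single P₀ (m : ℤ) + (con 𝔽⟮x⟯ J + con 𝔽⟮x⟯ D),
    fun j => frobSum (n / 2) fun i => (Algebra.trace 𝔽⟮x⟯ K (v i * y ^ (j.succ : ℕ)) : K) -
      (Algebra.trace 𝔽⟮x⟯ K (v i * y ^ (0 : ℕ)) : K) * y ^ (j.succ : ℕ), ?_, ?_, ?_, ?_⟩
  · refine add_nonneg (nsmul_nonneg (Finsupp.single_nonneg.2 (by positivity)) _)
      (add_nonneg (con_nonneg _ (add_nonneg (nsmul_nonneg ?_ _) hD0)) hcD0)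
    exact zdv_nonneg _
  · have h0 := degD_nonneg hcD0
    simp only [J, map_add, map_nsmul, degD_single, hdegI, nsmul_eq_mul]
    push_cast
    rw [Int.toNat_of_nonneg h0]
    nlinarith [mul_nonneg h0 (Int.natCast_nonneg l)]
  · intro u hu j
    refine frobSum_mem _ hu fun i => sub_mem (Lsp_mono (le_add_of_nonneg_right hcD0) (hvJ i _)) ?_
    refine mem_Lsp.2 fun Q => ?_
    refine pw_anti ?_ (pw_mul (mem_Lsp.1 (hvJ i 0) Q) (mem_Lsp.1 (hyD j.succ j.succ.2) Q))
    rw [Finsupp.add_apply, neg_add]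
  · intro u hu h0 P hP
    have hgood := hSgood P (hX P hP).1
    have hne : ∀ P' ∈ abv 𝔽⟮x⟯ (res 𝔽⟮x⟯ P), P' ≠ P₀ := by
      rintro P' hP' rfl
      exact hSP P hP ((mem_abv _).2 ((mem_abv _).1 hP').symm)
    have hvi : ∀ i, ∀ P' ∈ abv 𝔽⟮x⟯ (res 𝔽⟮x⟯ P), v i ∈ P'.1 := fun i P' hP' =>
      mem_valuation_of_Lsp_single (hne P' hP') (hv i)
    have hui : ∀ i, u i ∈ P.1 := fun i =>
      mem_valuation_of_Lsp_single (hne P (self_mem_abv _ P)) (hu i)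
    refine sum_mul_pow_mem_of_kernel (n / 2) (n - n / 2) (hab.symm ▸ (hX P hP).2.1) hgood
      (hab.symm ▸ (hX P hP).2.2) hy he hui hvi
      (∑ i, u i ^ 2 ^ (n / 2) * (Algebra.trace 𝔽⟮x⟯ K (v i * y ^ (0 : ℕ)) : K)) (fun c => ?_) ?_
    · refine Fin.cases ?_ (fun j => ?_) c
      · simp
      · have h2 := h0 j
        rw [frobSum_apply] at h2
        rw [← sub_eq_zero, Finset.sum_mul, ← Finset.sum_sub_distrib, ← h2]
        exact Finset.sum_congr rfl fun i _ => by ring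
    · refine sum_mem fun i _ => mul_mem (pow_mem (hui i) _) (trace_mem_of_forall _ fun P' hP' => ?_)
      rw [pow_zero, mul_one]
      exact hvi i P' hP'

/-- The lower bound for the number of points. -/
theorem le_numPts (K : Type) [Field K] [Algebra 𝔽 K] [PosGenus K] : ∃ C n₀ : ℕ, ∀ n ≥ n₀,
    2 ^ n ≤ numPts K n + C * 2 ^ (n - n / 2) := by
  obtain ⟨x, hx, hsep⟩ := exists_separating K
  obtain ⟨hE, hfin⟩ := congFF_intermediate (E := 𝔽⟮x⟯) (y := ⟨x, mem_adjoin_simple_self 𝔽 x⟩) hx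
  obtain ⟨C, n₀, S, hram, h⟩ := sum_deg_complement_le hx
  let B : ℕ := ∑ P ∈ S, (ord P (x ^ 2 ^ deg P - x)).toNat * deg P
  refine ⟨C + B, n₀ + 1, fun n hn => ?_⟩
  have hn0 : n ≠ 0 := by omega
  have hw0 : x ^ 2 ^ n - x ≠ 0 := pow_sub_ne hx hn0
  set w := x ^ 2 ^ n - x with hw
  let T : Finset (Pl K) := (finite_pos w).toFinset
  have hT : ∀ P, P ∈ T ↔ 0 < ord P w := fun P => by simp [T]
  have hTx : ∀ P ∈ T, x ∈ fixSub P n := by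
    intro P hP
    have h1 : w ∈ pw P 1 := (mem_pw_of_ne hw0).2 ((hT P).1 hP)
    exact ⟨mem_of_pow_sub_mem hn0 (mem_pw_zero.1 (pw_anti (by norm_num) h1)), h1⟩
  have hcount : (2 : ℤ) ^ n * dg x = ∑ P ∈ T, ord P w * deg P := by
    rw [← degD_pow_sub hx hn0, degD_eq_sum (zdv w) T]
    · refine Finset.sum_congr rfl fun P hP => ?_
      rw [zdv_apply, max_eq_left ((hT P).1 hP).le]
    · intro P hP
      rw [Finsupp.mem_support_iff, zdv_apply] at hP
      rw [hT]
      by_contra h0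
      exact hP (max_eq_right (not_lt.1 h0))
  let β : Pl K → ℕ := fun P => (ord P (x ^ 2 ^ deg P - x)).toNat * deg P
  have h1 : (2 : ℤ) ^ n * dg x ≤ (∑ P ∈ T, if P ∈ S then β P else deg P : ℕ) := by
    rw [hcount, Nat.cast_sum]
    refine Finset.sum_le_sum fun P hP => ?_
    have h2 := hTx P hP
    split_ifs with hPS
    · simp only [β, Nat.cast_mul]
      refine mul_le_mul_of_nonneg_right ((?_ : ord P w ≤ _).trans (Int.self_le_toNat _))
        (by positivity)
      have hx' : aeval x (X ^ 2 ^ deg P - X : 𝔽[X]) = x ^ 2 ^ deg P - x := by simp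
      rw [← hx']
      refine ord_pow_sub_le h2.1 hn0 h2.2 ?_ ?_
      · rw [hx']; exact pow_card_sub_mem P h2.1
      · rw [hx']; exact pow_sub_ne hx (deg_pos P).ne'
    · have h3 : ord P w = 1 := by
        refine ord_pow_sub_eq_one h2.1 hn0 h2.2 hw0 (unif (res 𝔽⟮x⟯ P) : 𝔽⟮x⟯).2 ?_
        exact hram P hPS
      rw [h3, one_mul]
  rw [Finset.sum_ite] at h1
  have h2 : ∑ P ∈ T.filter (· ∈ S), β P ≤ B :=
    Finset.sum_le_sum_of_subset fun P hP => (Finset.mem_filter.1 hP).2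
  have h3 := Finset.sum_filter_add_sum_filter_not (T.filter (· ∉ S)) (fun P => deg P ∣ n)
    (fun P => deg P)
  have h4 : ∑ P ∈ (T.filter (· ∉ S)).filter (fun P => deg P ∣ n), deg P ≤ numPts K n :=
    Finset.sum_le_sum_of_subset fun P hP => (mem_placesDvd hn0).2 (Finset.mem_filter.1 hP).2
  have h5 := h n (by omega) ((T.filter (· ∉ S)).filter fun P => ¬ deg P ∣ n) fun P hP => by
    simp only [Finset.mem_filter] at hP
    exact ⟨hP.1.2, hTx P hP.1.1, hP.2⟩
  have h6 : 0 < dg x := Module.finrank_pos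
  obtain ⟨κ, hκ⟩ : ∃ κ, dg x = κ + 1 := Nat.exists_eq_succ_of_ne_zero h6.ne'
  have h7 : 1 ≤ 2 ^ (n - n / 2) := Nat.one_le_two_pow
  rw [hκ] at h1 h5
  rw [Nat.add_sub_cancel] at h5
  have h8 : 2 ^ n * (κ + 1) ≤ B + numPts K n + (κ * 2 ^ n + C * 2 ^ (n - n / 2)) := by
    have : 2 ^ n * (κ + 1) ≤ ∑ P ∈ T.filter (· ∈ S), β P + ∑ P ∈ T.filter (· ∉ S), deg P := by
      exact_mod_cast h1
    omega
  nlinarith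

end Lower

section NoRoot

/-- A real polynomial whose coefficients satisfy Newton-type relations with a sequence of
exponential growth `ρ` has no zero in `[0, ρ⁻¹)`. -/
lemma abs_mul_derivative_le {L : ℝ[X]} {s : ℕ → ℝ} {C ρ : ℝ} (hρ : 0 ≤ ρ)
    (hs : ∀ n, |s n| ≤ C * ρ ^ n)
    (hrec : ∀ n : ℕ, n * L.coeff n = - ∑ p ∈ Finset.HasAntidiagonal.antidiagonal n, L.coeff p.1 * s p.2)
    {t₀ t : ℝ} (ht : 0 ≤ t) (htt : t ≤ t₀) (ht₀ : ρ * t₀ < 1) :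
    |t * L.derivative.eval t| ≤ C * (1 - ρ * t₀)⁻¹ * |L.eval t| := by
  have hρt : ρ * t ≤ ρ * t₀ := mul_le_mul_of_nonneg_left htt hρ
  have hC : 0 ≤ C := by simpa using (abs_nonneg _).trans (hs 0)
  have hfin : ∀ f : ℕ → ℝ, (∀ n, L.natDegree < n → f n = 0) →
      ∑' n, f n = ∑ n ∈ Finset.range (L.natDegree + 1), f n := fun f hf =>
    tsum_eq_sum fun n hn => hf n (by simpa using hn)
  have h1 : ∑' n, L.coeff n * t ^ n = L.eval t := by
    rw [hfin _ fun n hn => by rw [coeff_eq_zero_of_natDegree_lt hn, zero_mul],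
      eval_eq_sum_range]
  have h2 : ∑' n : ℕ, n * L.coeff n * t ^ n = t * L.derivative.eval t := by
    rw [hfin _ fun n hn => by rw [coeff_eq_zero_of_natDegree_lt hn, mul_zero, zero_mul],
      derivative_eval, sum_over_range _ (by simp), Finset.mul_sum]
    refine Finset.sum_congr rfl fun n _ => ?_
    rcases n with - | n
    · simp
    · rw [Nat.add_sub_cancel, pow_succ]; ring
  have hb : ∀ n, ‖s n * t ^ n‖ ≤ C * (ρ * t) ^ n := fun n => by
    rw [norm_mul, norm_pow, Real.norm_eq_abs, Real.norm_eq_abs, abs_of_nonneg ht, mul_pow,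
      ← mul_assoc]
    exact mul_le_mul_of_nonneg_right (hs n) (pow_nonneg ht n)
  have hg := hasSum_geometric_of_lt_one (mul_nonneg hρ ht) (hρt.trans_lt ht₀)
  have hsum := Summable.of_nonneg_of_le (fun _ => norm_nonneg _) hb (hg.summable.mul_left C)
  have hS : |∑' n, s n * t ^ n| ≤ C * (1 - ρ * t₀)⁻¹ := by
    refine (tsum_of_norm_bounded (hg.mul_left C) hb).trans ?_
    refine mul_le_mul_of_nonneg_left (inv_anti₀ (by linarith) (by linarith)) hC
  have hLsum : Summable fun n => ‖L.coeff n * t ^ n‖ :=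
    summable_of_ne_finset_zero (s := Finset.range (L.natDegree + 1)) fun n hn => by
      rw [coeff_eq_zero_of_natDegree_lt (by simpa using hn), zero_mul, norm_zero]
  have h3 := tsum_mul_tsum_eq_tsum_sum_antidiagonal_of_summable_norm hLsum hsum
  have h4 : ∀ n : ℕ, ∑ p ∈ Finset.HasAntidiagonal.antidiagonal n, L.coeff p.1 * t ^ p.1 * (s p.2 * t ^ p.2) =
      - (n * L.coeff n * t ^ n) := fun n => by
    rw [hrec n, neg_mul, neg_neg, Finset.sum_mul]
    refine Finset.sum_congr rfl fun p hp => ?_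
    rw [← Finset.HasAntidiagonal.mem_antidiagonal.1 hp, pow_add]
    ring
  simp only [h4] at h3
  rw [tsum_neg, h1, h2] at h3
  rw [← abs_neg, ← h3, abs_mul, mul_comm]
  exact mul_le_mul_of_nonneg_right hS (abs_nonneg _)

lemma eval_ne_zero_of_newton {L : ℝ[X]} {s : ℕ → ℝ} {C ρ : ℝ} (hρ : 0 ≤ ρ)
    (hs : ∀ n, |s n| ≤ C * ρ ^ n)
    (hrec : ∀ n : ℕ, n * L.coeff n = - ∑ p ∈ Finset.HasAntidiagonal.antidiagonal n, L.coeff p.1 * s p.2)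
    (h0 : L.coeff 0 ≠ 0) {t₀ : ℝ} (ht : 0 ≤ t₀) (ht₀ : ρ * t₀ < 1) : L.eval t₀ ≠ 0 := by
  intro hroot
  have hL : L ≠ 0 := by rintro rfl; simp at h0
  have htpos : 0 < t₀ := by
    refine lt_of_le_of_ne ht ?_
    rintro rfl
    rw [← coeff_zero_eq_eval_zero] at hroot
    exact h0 hroot
  obtain ⟨Q, hQ, hQ0⟩ := exists_eq_pow_rootMultiplicity_mul_and_not_dvd L hL t₀
  have hk : 0 < rootMultiplicity t₀ L := (rootMultiplicity_pos hL).2 hroot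
  obtain ⟨k, hk'⟩ := Nat.exists_eq_succ_of_ne_zero hk.ne'
  rw [hk'] at hQ
  rw [dvd_iff_isRoot, IsRoot.def] at hQ0
  set M := C * (1 - ρ * t₀)⁻¹ with hM
  have key : ∀ t ∈ Set.Ioo 0 t₀, |t * ((k + 1) * Q.eval t + (t - t₀) * Q.derivative.eval t)| ≤
      M * (|t - t₀| * |Q.eval t|) := by
    intro t ht
    have h1 := abs_mul_derivative_le hρ hs hrec ht.1.le ht.2.le ht₀
    rw [hQ] at h1
    have h2 : 0 < |t - t₀| ^ k := pow_pos (abs_pos.2 (sub_ne_zero.2 ht.2.ne)) k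
    have h3 : t * (derivative ((X - Polynomial.C t₀) ^ (k + 1) * Q)).eval t =
        (t - t₀) ^ k * (t * ((k + 1) * Q.eval t + (t - t₀) * Q.derivative.eval t)) := by
      simp [derivative_mul, derivative_pow]
      ring
    rw [h3, eval_mul, eval_pow, eval_sub, eval_X, eval_C, abs_mul, abs_mul _ (eval t Q), abs_pow,
      abs_pow, pow_succ] at h1
    refine le_of_mul_le_mul_left ?_ h2
    linarith
  have hlim1 : Filter.Tendsto
      (fun t => |t * ((k + 1) * Q.eval t + (t - t₀) * Q.derivative.eval t)|)
      (nhdsWithin t₀ (Set.Iio t₀))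
      (nhds |t₀ * ((k + 1) * Q.eval t₀ + (t₀ - t₀) * Q.derivative.eval t₀)|) :=
    (by fun_prop : Continuous fun t : ℝ =>
      |t * ((k + 1) * Q.eval t + (t - t₀) * Q.derivative.eval t)|).continuousWithinAt
  have hlim2 : Filter.Tendsto (fun t => M * (|t - t₀| * |Q.eval t|))
      (nhdsWithin t₀ (Set.Iio t₀)) (nhds (M * (|t₀ - t₀| * |Q.eval t₀|))) :=
    (by fun_prop : Continuous fun t : ℝ => M * (|t - t₀| * |Q.eval t|)).continuousWithinAt
  have h4 := le_of_tendsto_of_tendsto hlim1 hlim2 (by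
    filter_upwards [Ioo_mem_nhdsLT htpos] with t ht using key t ht)
  rw [sub_self, abs_zero, zero_mul, zero_mul, mul_zero, add_zero] at h4
  have h5 := abs_nonpos_iff.1 h4
  have h6 : ((k : ℝ) + 1) ≠ 0 := by positivity
  simp [htpos.ne', h6, hQ0] at h5

end NoRoot

section LPolynomial

/-- The Newton relations in the form of power series. -/
lemma newton_of_recurrence (a N : ℕ → ℝ)
    (hrec : ∀ n : ℕ, n * a n = ∑ k ∈ Finset.Icc 1 n, N k * a (n - k))
    (l : ℕ → ℝ) (h0 : l 0 = a 0) (h1 : l 1 = a 1 - 3 * a 0)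
    (h2 : ∀ n, l (n + 2) = a (n + 2) - 3 * a (n + 1) + 2 * a n) (n : ℕ) :
    n * l n = - ∑ p ∈ Finset.HasAntidiagonal.antidiagonal n,
      l p.1 * (if p.2 = 0 then 0 else 2 ^ p.2 + 1 - N p.2) := by
  set A : PowerSeries ℝ := PowerSeries.mk a with hA
  set Np : PowerSeries ℝ := PowerSeries.mk fun k => if k = 0 then 0 else N k with hN
  set G : PowerSeries ℝ := PowerSeries.mk fun k => if k = 0 then 0 else 2 ^ k + 1 with hG
  set d := PowerSeries.derivative ℝ with hd
  set T : PowerSeries ℝ := 1 - PowerSeries.C 3 * PowerSeries.X + PowerSeries.C 2 * (PowerSeries.X * PowerSeries.X) with hT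
  have hTf : ∀ F : PowerSeries ℝ, T * F = F - PowerSeries.C 3 * (PowerSeries.X * F) +
      PowerSeries.C 2 * (PowerSeries.X * (PowerSeries.X * F)) := fun F => by rw [hT]; ring
  have hTc : ∀ F : PowerSeries ℝ, ∀ n, PowerSeries.coeff (n + 2) (T * F) =
      PowerSeries.coeff (n + 2) F - 3 * PowerSeries.coeff (n + 1) F +
        2 * PowerSeries.coeff n F := fun F n => by
    rw [hTf, map_add, map_sub, PowerSeries.coeff_C_mul, PowerSeries.coeff_C_mul,
      PowerSeries.coeff_succ_X_mul, PowerSeries.coeff_succ_X_mul, PowerSeries.coeff_succ_X_mul]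
  have hTc0 : ∀ F : PowerSeries ℝ, PowerSeries.coeff 0 (T * F) = PowerSeries.coeff 0 F :=
    fun F => by simp [hTf]
  have hTc1 : ∀ F : PowerSeries ℝ, PowerSeries.coeff 1 (T * F) =
      PowerSeries.coeff 1 F - 3 * PowerSeries.coeff 0 F := fun F => by
    have hX : ∀ H : PowerSeries ℝ, PowerSeries.coeff 1 (PowerSeries.X * H) =
        PowerSeries.coeff 0 H := fun H => PowerSeries.coeff_succ_X_mul 0 H
    rw [hTf, map_add, map_sub, PowerSeries.coeff_C_mul, PowerSeries.coeff_C_mul, hX, hX]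
    simp
  have hL : PowerSeries.mk l = T * A := by
    ext n
    rcases n with - | - | n
    · rw [hTc0, hA, PowerSeries.coeff_mk, PowerSeries.coeff_mk, h0]
    · rw [hTc1, hA, PowerSeries.coeff_mk, PowerSeries.coeff_mk, PowerSeries.coeff_mk, h1]
    · rw [hTc, hA]
      simp only [PowerSeries.coeff_mk, h2]
  have hXd : ∀ f : PowerSeries ℝ, ∀ n, PowerSeries.coeff n (PowerSeries.X * d f) =
      n * PowerSeries.coeff n f := by
    intro f n
    rcases n with - | n
    · simp
    · rw [PowerSeries.coeff_succ_X_mul, PowerSeries.coeff_derivative]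
      push_cast
      ring
  have hAN : PowerSeries.X * d A = Np * A := by
    ext n
    rw [hXd, hA, PowerSeries.coeff_mk, hrec, PowerSeries.coeff_mul,
      Finset.Nat.sum_antidiagonal_eq_sum_range_succ_mk, Finset.sum_range_succ']
    simp only [hN, PowerSeries.coeff_mk]
    rw [if_pos trivial, zero_mul, add_zero]
    refine Finset.sum_nbij' (fun x => x - 1) (fun x => x + 1) ?_ ?_ ?_ ?_ ?_
    · intro k hk
      rw [Finset.mem_Icc] at hk
      rw [Finset.mem_range]
      omega
    · intro k hk
      rw [Finset.mem_range] at hk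
      rw [Finset.mem_Icc]
      omega
    · intro k hk
      rw [Finset.mem_Icc] at hk
      show k - 1 + 1 = k
      omega
    · intro k _
      rfl
    · intro k hk
      rw [Finset.mem_Icc] at hk
      rw [if_neg (by omega), Nat.sub_add_cancel hk.1]
  have hTG : PowerSeries.X * d T = - (T * G) := by
    ext n
    rw [hXd, map_neg]
    have hT1 : T = T * 1 := (mul_one T).symm
    rcases n with - | - | - | n
    · rw [hTc0]; simp [hG]
    · rw [hT1, hTc1, mul_one, hTc1]
      simp [hG]
      norm_num
    · rw [hT1, hTc, mul_one, hTc]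
      simp [hG]
      norm_num
    · rw [hT1, hTc, mul_one, hTc]
      simp [hG]
      ring
  have hfinal : PowerSeries.X * d (T * A) = - ((T * A) * (G - Np)) := by
    have : d (T * A) = T * d A + A * d T := by
      rw [hd, Derivation.leibniz, smul_eq_mul, smul_eq_mul]
    rw [this]
    linear_combination T * hAN + A * hTG
  have h3 := congrArg (PowerSeries.coeff n) hfinal
  rw [hXd, ← hL, PowerSeries.coeff_mk, map_neg, PowerSeries.coeff_mul] at h3
  rw [h3]
  congr 1
  refine Finset.sum_congr rfl fun p _ => ?_
  simp only [hG, hN, map_sub, PowerSeries.coeff_mk]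
  split_ifs <;> ring

end LPolynomial

section FourSmall

/-- The deviation of the number of points from the one of the projective line. -/
def ptsDev (K : Type) [Field K] [Algebra 𝔽 K] [CongFF K] (n : ℕ) : ℝ :=
  if n = 0 then 0 else 2 ^ n + 1 - numPts K n

lemma two_pow_sub_half_le (n : ℕ) : (2 : ℝ) ^ (n - n / 2) ≤ 2 * Real.sqrt 2 ^ n := by
  have h1 : (1 : ℝ) ≤ Real.sqrt 2 := Real.one_le_sqrt.2 (by norm_num)
  have h2 : Real.sqrt 2 ^ 2 = 2 := Real.sq_sqrt (by norm_num)
  have h3 : Real.sqrt 2 ≤ 2 := by nlinarith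
  calc (2 : ℝ) ^ (n - n / 2) = Real.sqrt 2 ^ (2 * (n - n / 2)) := by rw [pow_mul, h2]
    _ ≤ Real.sqrt 2 ^ (n + 1) := pow_le_pow_right₀ h1 (by omega)
    _ = Real.sqrt 2 * Real.sqrt 2 ^ n := by ring
    _ ≤ _ := mul_le_mul_of_nonneg_right h3 (by positivity)

lemma abs_ptsDev_le (K : Type) [Field K] [Algebra 𝔽 K] [PosGenus K] :
    ∃ C : ℝ, ∀ n, |ptsDev K n| ≤ C * Real.sqrt 2 ^ n := by
  obtain ⟨C₁, n₁, h₁⟩ := numPts_le K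
  obtain ⟨C₂, n₂, h₂⟩ := le_numPts K
  have hs1 : (1 : ℝ) ≤ Real.sqrt 2 := Real.one_le_sqrt.2 (by norm_num)
  set S : ℝ := ∑ i ∈ Finset.range (n₁ + n₂), |ptsDev K i| with hS
  have hS0 : 0 ≤ S := Finset.sum_nonneg fun i _ => abs_nonneg _
  refine ⟨S + (1 + 2 * (C₁ + C₂)), fun n => ?_⟩
  have hp : (1 : ℝ) ≤ Real.sqrt 2 ^ n := one_le_pow₀ hs1
  by_cases hn : n < n₁ + n₂
  · have h3 : |ptsDev K n| ≤ S :=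
      Finset.single_le_sum (f := fun i => |ptsDev K i|) (fun i _ => abs_nonneg _)
        (Finset.mem_range.2 hn)
    have h4 : (0 : ℝ) ≤ 1 + 2 * (C₁ + C₂) := by positivity
    nlinarith
  · have h3 := h₁ n (by omega)
    have h4 := h₂ n (by omega)
    have h3' : (numPts K n : ℝ) ≤ 2 ^ n + C₁ * 2 ^ (n - n / 2) := by exact_mod_cast h3
    have h4' : (2 : ℝ) ^ n ≤ numPts K n + C₂ * 2 ^ (n - n / 2) := by exact_mod_cast h4
    have h5 := two_pow_sub_half_le n
    have hC1 : (0 : ℝ) ≤ C₁ := by positivity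
    have hC2 : (0 : ℝ) ≤ C₂ := by positivity
    have h6 := mul_le_mul_of_nonneg_left h5 hC1
    have h7 := mul_le_mul_of_nonneg_left h5 hC2
    have h8 : 0 ≤ S * Real.sqrt 2 ^ n := by positivity
    have h9 : 0 ≤ (C₁ : ℝ) * Real.sqrt 2 ^ n := by positivity
    have h10 : 0 ≤ (C₂ : ℝ) * Real.sqrt 2 ^ n := by positivity
    rw [ptsDev]
    split_ifs with h0
    · rw [abs_zero]; nlinarith
    · rw [abs_le]
      constructor <;> nlinarith

variable {K : Type} [Field K] [Algebra 𝔽 K]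

lemma exists_degD_one [PosGenus K] : ∃ D : Dv K, degD D = 1 := by
  obtain ⟨C, n₀, h⟩ := le_numPts K
  have key : ∀ n, n₀ ≤ n → 2 * C ≤ n → ∃ D : Dv K, degD D = n := by
    intro n hn hC
    have h1 := h n hn
    have h2 : numPts K n ≠ 0 := by
      intro h0
      rw [h0, zero_add] at h1
      have h3 : C < 2 ^ (n / 2) := lt_of_le_of_lt (by omega) Nat.lt_two_pow_self
      have h4 : (2 : ℕ) ^ n = 2 ^ (n / 2) * 2 ^ (n - n / 2) := by
        rw [← pow_add]; congr 1; omega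
      rw [h4] at h1
      exact absurd (Nat.le_of_mul_le_mul_right h1 (by positivity)) (by omega)
    rcases Nat.eq_zero_or_pos n with rfl | hpos
    · exact ⟨0, by simp⟩
    obtain ⟨P, hP, -⟩ := Finset.exists_ne_zero_of_sum_ne_zero h2
    obtain ⟨m, hm⟩ := (mem_placesDvd hpos.ne').1 hP
    refine ⟨Finsupp.single P (m : ℤ), ?_⟩
    rw [degD_single, hm]
    push_cast
    ring
  obtain ⟨D, hD⟩ := key (n₀ + 2 * C) (by omega) (by omega)
  obtain ⟨D', hD'⟩ := key (n₀ + 2 * C + 1) (by omega) (by omega)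
  exact ⟨D' - D, by rw [map_sub, hD, hD']; push_cast; ring⟩

lemma small_eq_one {X Y U : ℝ} (hX : X = 1 ∨ 2 ≤ X) (hY : Y = 1 ∨ 2 ≤ Y) (hU : U = 1 ∨ 2 ≤ U)
    (h : 0 < 1 + (X - 4) * (707/1000 : ℝ) + (Y - 3 * X + 4) * (707/1000 : ℝ) ^ 2 +
      (U - 3 * Y + 2 * X) * (707/1000 : ℝ) ^ 3 + (4 * Y - 3 * U) * (707/1000 : ℝ) ^ 4 +
      (4 * X - 6 * Y + 2 * U) * (707/1000 : ℝ) ^ 5 +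
      (16 - 12 * X + 4 * Y) * (707/1000 : ℝ) ^ 6 +
      (8 * X - 32) * (707/1000 : ℝ) ^ 7 + 16 * (707/1000 : ℝ) ^ 8) :
    X = 1 ∧ Y = 1 ∧ U = 1 := by
  norm_num at h
  rcases hX with hX | hX <;> rcases hY with hY | hY <;> rcases hU with hU | hU <;>
    first
    | exact ⟨hX, hY, hU⟩
    | (exfalso; subst_vars; nlinarith)

variable [GenusFour K]

lemma el_eq_zero_of_degD_neg {D : Dv K} (h : degD D < 0) : el D = 0 := by
  have h1 := card_Eff D
  rw [Eff_neg h, Finset.card_empty, zero_add] at h1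
  by_contra h2
  have := Nat.one_lt_two_pow h2
  omega

lemma el_duality {D D' : Dv K} (h : degD D + degD D' = 6) : (el D : ℤ) = degD D - 3 + el D' := by
  obtain ⟨l, W, hW, -⟩ := exists_differential (K := K)
  have h1 := hW.RR D
  have h2 := hW.deg_eq
  rw [gn_eq] at h1 h2
  have h3 : el (W - D) = el D' := el_congr (by rw [map_sub, h2]; push_cast; linarith)
  rw [h3] at h1
  rw [h1]
  push_cast
  ring

theorem el_eq_zero {D : Dv K} (h1 : 1 ≤ degD D) (h3 : degD D ≤ 3) : el D = 0 := by
  obtain ⟨D₁, hD₁⟩ := exists_degD_one (K := K)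
  have hd : ∀ n : ℤ, degD (n • D₁) = n := fun n => by rw [map_zsmul, hD₁]; simp
  set e : ℤ → ℕ := fun n => el (n • D₁) with he
  have hdual : ∀ n : ℤ, (e n : ℤ) = n - 3 + e (6 - n) := fun n => by
    have := el_duality (D := n • D₁) (D' := (6 - n) • D₁) (by rw [hd, hd]; ring)
    rwa [hd] at this
  have hneg : ∀ n : ℤ, n < 0 → e n = 0 := fun n hn => el_eq_zero_of_degD_neg (by rwa [hd])
  have e0 : e 0 = 1 := by rw [he]; simp only [zero_smul, el_zero]
  have e4 : e 4 = 1 + e 2 := by have := hdual 4; norm_num at this; omega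
  have e5 : e 5 = 2 + e 1 := by have := hdual 5; norm_num at this; omega
  have e6 : e 6 = 4 := by have := hdual 6; norm_num [e0] at this; omega
  have e7 : ∀ n : ℕ, e ((n : ℤ) + 7) = n + 4 := fun n => by
    have := hdual (n + 7)
    rw [hneg (6 - (n + 7)) (by omega)] at this
    omega
  set a : ℕ → ℝ := fun n => ((Eff K (n : ℤ)).card : ℝ) with ha
  have hae : ∀ n : ℕ, a n = 2 ^ e n - 1 := fun n => by
    have := card_Eff ((n : ℤ) • D₁)
    rw [hd] at this
    have h : ((Eff K (n : ℤ)).card : ℝ) + 1 = 2 ^ e n := by exact_mod_cast this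
    rw [ha, ← h]
    ring
  have hrec : ∀ n : ℕ, (n : ℝ) * a n = ∑ k ∈ Finset.Icc 1 n, (numPts K k : ℝ) * a (n - k) := by
    intro n
    have h := card_Eff_recurrence (K := K) n
    have h' : (n : ℝ) * a n =
        ∑ k ∈ Finset.Icc 1 n, (numPts K k : ℝ) * ((Eff K ((n : ℤ) - k)).card : ℝ) := by
      simp only [ha]
      exact_mod_cast h
    rw [h']
    refine Finset.sum_congr rfl fun k hk => ?_
    rw [Finset.mem_Icc] at hk
    simp only [ha]
    rw [Nat.cast_sub hk.2]
  set l : ℕ → ℝ := fun n => match n with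
    | 0 => a 0
    | 1 => a 1 - 3 * a 0
    | n + 2 => a (n + 2) - 3 * a (n + 1) + 2 * a n with hl
  have hnewt := newton_of_recurrence a (fun k => (numPts K k : ℝ)) hrec l rfl rfl fun n => rfl
  have a0 : a 0 = 1 := by rw [hae]; norm_num [e0]
  have a4 : a 4 = 2 * 2 ^ e 2 - 1 := by rw [hae]; norm_num [e4, pow_add]
  have a5 : a 5 = 4 * 2 ^ e 1 - 1 := by rw [hae]; norm_num [e5, pow_add]
  have a6 : a 6 = 15 := by rw [hae]; norm_num [e6]
  have a7 : ∀ n : ℕ, a (n + 7) = 16 * 2 ^ n - 1 := fun n => by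
    rw [hae]; push_cast; rw [e7, pow_add]; norm_num; ring
  have a1 : a 1 = 2 ^ e 1 - 1 := by rw [hae]; norm_num
  have a2 : a 2 = 2 ^ e 2 - 1 := by rw [hae]; norm_num
  have a3 : a 3 = 2 ^ e 3 - 1 := by rw [hae]; norm_num
  have l9 : ∀ n, l (n + 9) = 0 := fun n => by
    show a (n + 2 + 7) - 3 * a (n + 1 + 7) + 2 * a (n + 7) = 0
    rw [a7, a7, a7]; ring
  set L : ℝ[X] := ∑ i ∈ Finset.range 9, Polynomial.C (l i) * Polynomial.X ^ i with hL
  have hLc : ∀ n, L.coeff n = l n := fun n => by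
    rw [hL, finsetSum_coeff]
    simp only [coeff_C_mul_X_pow]
    rw [Finset.sum_ite_eq]
    split_ifs with h
    · rfl
    · rw [Finset.mem_range, not_lt] at h
      obtain ⟨m, rfl⟩ := Nat.exists_eq_add_of_le' h
      rw [l9]
  obtain ⟨C, hC⟩ := abs_ptsDev_le K
  have hroot : ∀ t : ℝ, 0 ≤ t → t ≤ 707/1000 → L.eval t ≠ 0 := by
    intro t ht ht1
    refine eval_ne_zero_of_newton (Real.sqrt_nonneg 2) hC ?_ ?_ ht ?_
    · intro n
      simp only [hLc]
      rw [hnewt n]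
      rfl
    · rw [hLc]
      show a 0 ≠ 0
      rw [a0]; norm_num
    · have : Real.sqrt 2 < 1.4144 := by
        rw [Real.sqrt_lt' (by norm_num)]; norm_num
      nlinarith [Real.sqrt_nonneg 2]
  have hpos : 0 < L.eval (707/1000 : ℝ) := by
    by_contra hcon
    push Not at hcon
    have h0 : L.eval 0 = 1 := by
      rw [← coeff_zero_eq_eval_zero, hLc]
      exact a0
    have := intermediate_value_Icc' (f := fun t => L.eval t) (show (0 : ℝ) ≤ 707/1000 by norm_num)
      L.continuous.continuousOn
    obtain ⟨t, ht, ht0⟩ := this ⟨hcon, by simp only [h0]; norm_num⟩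
    exact hroot t ht.1 ht.2 ht0
  have hone : ∀ n : ℕ, (2 : ℝ) ^ n = 1 ∨ 2 ≤ (2 : ℝ) ^ n := fun n => by
    rcases n with - | n
    · left; norm_num
    · right
      rw [pow_succ]
      have : (1 : ℝ) ≤ 2 ^ n := one_le_pow₀ (by norm_num)
      linarith
  have hz : ∀ n : ℕ, (2 : ℝ) ^ n = 1 → n = 0 := fun n hn => by
    by_contra h0
    have h : (2 : ℕ) ^ n = 1 := by exact_mod_cast hn
    have := Nat.one_lt_two_pow h0
    omega
  have h8 : a 8 = 31 := by rw [show (8 : ℕ) = 1 + 7 from rfl, a7]; norm_num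
  have h7 : a 7 = 15 := by rw [show (7 : ℕ) = 0 + 7 from rfl, a7]; norm_num
  have key := small_eq_one (hone (e 1)) (hone (e 2)) (hone (e 3)) (by
    have hev : L.eval (707/1000 : ℝ) = a 0 + (a 1 - 3 * a 0) * (707/1000) +
        (a 2 - 3 * a 1 + 2 * a 0) * (707/1000) ^ 2 + (a 3 - 3 * a 2 + 2 * a 1) * (707/1000) ^ 3 +
        (a 4 - 3 * a 3 + 2 * a 2) * (707/1000) ^ 4 + (a 5 - 3 * a 4 + 2 * a 3) * (707/1000) ^ 5 +
        (a 6 - 3 * a 5 + 2 * a 4) * (707/1000) ^ 6 + (a 7 - 3 * a 6 + 2 * a 5) * (707/1000) ^ 7 +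
        (a 8 - 3 * a 7 + 2 * a 6) * (707/1000) ^ 8 := by
      rw [hL, eval_finsetSum]
      simp only [Finset.sum_range_succ, Finset.sum_range_zero, eval_mul, eval_C, eval_pow, eval_X,
        pow_zero, pow_one, mul_one, zero_add, hl]
    rw [hev, a0, a1, a2, a3, a4, a5, a6, h7, h8] at hpos
    refine lt_of_lt_of_eq hpos ?_
    ring)
  have hDe : el D = e (degD D) := el_congr (hd _).symm
  rw [hDe]
  have : degD D = 1 ∨ degD D = 2 ∨ degD D = 3 := by omega
  rcases this with h | h | h <;> rw [h]
  · exact hz _ key.1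
  · exact hz _ key.2.1
  · exact hz _ key.2.2

end FourSmall

section SmallDegree

variable {K : Type} [Field K] [Algebra 𝔽 K] [GenusFour K]

lemma eq_zero_of_degD_le {D : Dv K} (h : 0 ≤ D) (h3 : degD D ≤ 3) : D = 0 := by
  by_cases h1 : 1 ≤ degD D
  · have h2 := card_Eff D
    rw [el_eq_zero h1 h3, pow_zero] at h2
    have h4 : Eff K (degD D) = ∅ := Finset.card_eq_zero.1 (by omega)
    have h5 : D ∈ Eff K (degD D) := mem_Eff.2 ⟨h, rfl⟩
    rw [h4] at h5
    exact absurd h5 (Finset.notMem_empty _)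
  · have := degD_nonneg h
    exact eq_zero_of_degD h (by omega)

lemma four_le_deg (P : Pl K) : 4 ≤ deg P := by
  by_contra hcon
  have h := eq_zero_of_degD_le (D := Finsupp.single P 1) (single_nonneg' P)
    (by rw [degD_single]; omega)
  rw [Finsupp.single_eq_zero] at h
  exact one_ne_zero h

lemma exists_single_le {D : Dv K} (h : 0 ≤ D) (h0 : D ≠ 0) :
    ∃ P, D P ≠ 0 ∧ 0 ≤ D - Finsupp.single P 1 := by
  obtain ⟨P, hP⟩ := Finsupp.ne_iff.1 h0
  refine ⟨P, hP, fun Q => ?_⟩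
  have hQ : 0 ≤ D Q := h Q
  have hP' : 0 ≤ D P := h P
  rw [Finsupp.coe_zero, Pi.zero_apply] at hP
  simp only [Finsupp.coe_zero, Pi.zero_apply, Finsupp.sub_apply, Finsupp.single_apply]
  split_ifs with hc
  · subst hc; omega
  · omega

lemma exists_eq_single {D : Dv K} (h : 0 ≤ D) (h4 : 0 < degD D) (h7 : degD D ≤ 7) :
    ∃ P, D = Finsupp.single P 1 := by
  obtain ⟨P, -, hP⟩ := exists_single_le h (by rintro rfl; simp at h4)
  have h1 := four_le_deg P
  refine ⟨P, sub_eq_zero.1 (eq_zero_of_degD_le hP ?_)⟩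
  rw [map_sub, degD_single]
  omega

lemma exists_deg_four : ∃ P : Pl K, deg P = 4 ∧ ∀ Q : Pl K, deg Q = 4 → Q = P := by
  obtain ⟨D₁, hD₁⟩ := exists_degD_one (K := K)
  have hd : ∀ n : ℤ, degD (n • D₁) = n := fun n => by rw [map_zsmul, hD₁]; simp
  have h1 := el_duality (D := (4 : ℤ) • D₁) (D' := (2 : ℤ) • D₁) (by rw [hd, hd]; norm_num)
  rw [el_eq_zero (D := (2 : ℤ) • D₁) (by rw [hd]; norm_num) (by rw [hd]; norm_num), hd] at h1
  have h2 := card_Eff ((4 : ℤ) • D₁)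
  rw [show el ((4 : ℤ) • D₁) = 1 by norm_num at h1; omega, hd] at h2
  obtain ⟨D, hD⟩ := Finset.card_eq_one.1 (show (Eff K 4).card = 1 by omega)
  have hDm : D ∈ Eff K 4 := by rw [hD]; exact Finset.mem_singleton_self D
  obtain ⟨hD0, hD4⟩ := mem_Eff.1 hDm
  obtain ⟨P, rfl⟩ := exists_eq_single hD0 (by omega) (by omega)
  rw [degD_single] at hD4
  refine ⟨P, by omega, fun Q hQ => ?_⟩
  have h3 : (Finsupp.single Q 1 : Dv K) ∈ Eff K 4 :=
    mem_Eff.2 ⟨single_nonneg' Q, by rw [degD_single, hQ]; norm_num⟩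
  rw [hD, Finset.mem_singleton] at h3
  exact Finsupp.single_left_injective one_ne_zero h3

end SmallDegree

section Cotrace

variable {K : Type} [Field K] [Algebra 𝔽 K] (E : IntermediateField 𝔽 K) [PosGenus K] [PosGenus E]
  [FiniteDimensional E K]

lemma exists_fiber (α : Pl K → K) : ∃ z : Pl E → K, ∀ P, z (res E P) - α P ∈ P.1 := by
  choose z hz using fun p : Pl E => approx (abv E p) α (fun _ => 0)
  exact ⟨z, fun P => mem_pw_zero.1 (hz _ P (self_mem_abv E P))⟩

/-- Repartitions of `K` that are constant on the fibers over `E`. -/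
def fibAdl : Submodule 𝔽 (Pl E → K) := (adl K).comap (LinearMap.funLeft 𝔽 K (res E))

/-- The trace of repartitions constant on fibers. -/
def trAdl : fibAdl E →ₗ[𝔽] adl E where
  toFun z := ⟨fun p => Algebra.trace E K (z.1 p), by
    refine ((show Set.Finite {P : Pl K | z.1 (res E P) ∉ P.1} from z.2).image (res E)).subset
      fun p hp => ?_
    by_contra hcon
    refine hp (trace_mem E fun P hP => ?_)
    by_contra hP'
    have := (mem_abv E).1 hP
    subst this
    exact hcon ⟨P, hP', rfl⟩⟩
  map_add' a b := Subtype.ext (funext fun p => map_add _ _ _)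
  map_smul' c a := Subtype.ext (funext fun p =>
    ((Algebra.trace E K).restrictScalars 𝔽).map_smul c (a.1 p))

lemma trAdl_apply (z : fibAdl E) (p : Pl E) :
    (trAdl E z : Pl E → E) p = Algebra.trace E K (z.1 p) := rfl

/-- The inclusion of the repartitions constant on fibers. -/
def fibIncl : fibAdl E →ₗ[𝔽] adl K where
  toFun z := ⟨fun P => z.1 (res E P), z.2⟩
  map_add' _ _ := rfl
  map_smul' _ _ := rfl

lemma fibIncl_apply (z : fibAdl E) (P : Pl K) : (fibIncl E z : Pl K → K) P = z.1 (res E P) := rfl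

lemma exists_fibIncl (α : adl K) : ∃ z, fibIncl E z - α ∈ AD (0 : Dv K) := by
  obtain ⟨z, hz⟩ := exists_fiber E (α : Pl K → K)
  refine ⟨⟨z, ?_⟩, mem_AD.2 fun P => ?_⟩
  · refine Set.Finite.subset α.2 fun P hP hP' => hP ?_
    have := P.1.add_mem _ _ (hz P) hP'
    rwa [sub_add_cancel] at this
  · rw [Finsupp.coe_zero, Pi.zero_apply, neg_zero, mem_pw_zero]
    exact hz P

lemma exists_dual_comp_trace {l : Module.Dual 𝔽 (adl E)} (hl : l ∈ Om (0 : Dv E)) :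
    ∃ l' : Module.Dual 𝔽 (adl K), (∀ α ∈ AD (0 : Dv K), l' α = 0) ∧
      ∀ z, l' (fibIncl E z) = l (trAdl E z) := by
  set φ := (AD (0 : Dv K)).mkQ.comp (fibIncl E) with hφ
  have hsurj : LinearMap.range φ = ⊤ := by
    rw [LinearMap.range_eq_top]
    intro q
    obtain ⟨α, rfl⟩ := Submodule.mkQ_surjective _ q
    obtain ⟨z, hz⟩ := exists_fibIncl E α
    exact ⟨z, (Submodule.Quotient.eq _).2 hz⟩
  obtain ⟨g, hg⟩ := φ.exists_rightInverse_of_surjective hsurj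
  have hker : ∀ z, φ z = 0 → l (trAdl E z) = 0 := by
    intro z hz
    have hz' : fibIncl E z ∈ AD (0 : Dv K) := (Submodule.Quotient.mk_eq_zero _).1 hz
    refine (mem_Om.1 hl).1 _ (mem_AD.2 fun p => ?_)
    rw [Finsupp.coe_zero, Pi.zero_apply, neg_zero, mem_pw_zero, trAdl_apply]
    refine trace_mem E fun P hP => ?_
    have := mem_AD.1 hz' P
    rwa [Finsupp.coe_zero, Pi.zero_apply, neg_zero, mem_pw_zero, fibIncl_apply,
      (mem_abv E).1 hP] at this
  refine ⟨(l.comp ((trAdl E).comp g)).comp (AD (0 : Dv K)).mkQ, fun α hα => ?_, fun z => ?_⟩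
  · simp only [LinearMap.comp_apply]
    rw [show (AD (0 : Dv K)).mkQ α = 0 from (Submodule.Quotient.mk_eq_zero _).2 hα]
    simp
  · have h1 : φ (g (φ z) - z) = 0 := by
      rw [map_sub, sub_eq_zero]
      exact LinearMap.congr_fun hg (φ z)
    have h2 := hker _ h1
    rw [map_sub, map_sub, sub_eq_zero] at h2
    exact h2

variable [Algebra.IsSeparable E K]

/-- The divisor of the cotrace of a differential. -/
theorem exists_cotrace {l : Module.Dual 𝔽 (adl E)} {W : Dv E} (hW : IsDivOf l W) (hW0 : 0 ≤ W) :
    ∃ (l' : Module.Dual 𝔽 (adl K)) (W' : Dv K), IsDivOf l' W' ∧ 0 ≤ W' ∧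
      (∀ D : Dv K, 0 ≤ D → (∀ (p : Pl E) (z : K), (∀ P ∈ abv E p, z ∈ pw P (-D P)) →
        Algebra.trace E K z ∈ pw p (-W p)) → D ≤ W') ∧
      ∀ (p : Pl E) (z : K), (∀ P ∈ abv E p, z ∈ pw P (-W' P)) →
        Algebra.trace E K z ∈ pw p (-W p) := by
  have hl0 : l ∈ Om (0 : Dv E) := (hW.2 0).2 hW0
  have hlW : l ∈ Om W := (hW.2 W).2 le_rfl
  obtain ⟨l', hl'0, hl'⟩ := exists_dual_comp_trace E hl0
  have hK : ∀ f, l' (dgl K f) = 0 := by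
    intro f
    have h1 := hl' ⟨fun _ => f, finite_not_mem f⟩
    have h2 : trAdl E ⟨fun _ => f, finite_not_mem f⟩ = dgl E (Algebra.trace E K f) := rfl
    rw [h2, (mem_Om.1 hl0).2] at h1
    exact h1
  have hmem : ∀ D : Dv K, 0 ≤ D → (∀ (p : Pl E) (z : K), (∀ P ∈ abv E p, z ∈ pw P (-D P)) →
        Algebra.trace E K z ∈ pw p (-W p)) → l' ∈ Om D := by
    intro D hD h
    refine mem_Om.2 ⟨fun α hα => ?_, hK⟩
    obtain ⟨z, hz⟩ := exists_fibIncl E α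
    have h1 : l' α = l' (fibIncl E z) := by
      have := hl'0 _ hz
      rw [map_sub, sub_eq_zero] at this
      exact this.symm
    rw [h1, hl']
    refine (mem_Om.1 hlW).1 _ (mem_AD.2 fun p => h p _ fun P hP => ?_)
    have h2 : fibIncl E z ∈ AD D := by
      have := Submodule.add_mem _ (AD_mono hD hz) hα
      rwa [sub_add_cancel] at this
    have := mem_AD.1 h2 P
    rwa [fibIncl_apply, (mem_abv E).1 hP] at this
  have hne : l' ≠ 0 := by
    rintro rfl
    obtain ⟨α, hα⟩ : ∃ α, l α ≠ 0 := by
      by_contra hcon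
      push Not at hcon
      exact hW.1 (LinearMap.ext hcon)
    obtain ⟨t, ht⟩ := Algebra.trace_surjective E K 1
    have hfib : (fun p => ((α : Pl E → E) p : K) * t) ∈ fibAdl E := by
      have h1 : Set.Finite {P : Pl K | res E P ∈ {p : Pl E | (α : Pl E → E) p ∉ p.1}} := by
        refine (Set.Finite.biUnion α.2 fun p _ => finite_over E p).subset fun P hP => ?_
        exact Set.mem_biUnion hP rfl
      refine (h1.union (finite_not_mem t)).subset fun P hP => ?_
      by_contra hcon
      simp only [Set.mem_union, Set.mem_ofPred_eq, not_or, not_not] at hcon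
      exact hP (P.1.mul_mem _ _ ((mem_res E).1 hcon.1) hcon.2)
    refine hα ?_
    have h2 := hl' ⟨_, hfib⟩
    have h3 : trAdl E ⟨_, hfib⟩ = α := by
      refine Subtype.ext (funext fun p => ?_)
      rw [trAdl_apply]
      show Algebra.trace E K (((α : Pl E → E) p : K) * t) = _
      have : ((α : Pl E → E) p : K) * t = (α : Pl E → E) p • t := rfl
      rw [this, map_smul, ht, smul_eq_mul, mul_one]
    rw [h3] at h2
    exact h2.symm
  have hl'Om : l' ∈ Om (0 : Dv K) := mem_Om.2 ⟨hl'0, hK⟩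
  obtain ⟨W', hW'⟩ := exists_isDivOf hne hl'Om
  refine ⟨l', W', hW', (hW'.2 0).1 hl'Om, fun D hD h => (hW'.2 D).1 (hmem D hD h), ?_⟩
  have hl'W : l' ∈ Om W' := (hW'.2 W').2 le_rfl
  intro p z hz
  by_contra hcon
  have hsg : ∀ w : K, (∀ P ∈ abv E p, w ∈ pw P (-W' P)) → l (sgl p (Algebra.trace E K w)) = 0 := by
    intro w hw
    have hf : (fun q => if q = p then w else 0) ∈ fibAdl E := by
      refine (finite_over E p).subset fun P hP => ?_
      by_contra hne
      refine hP ?_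
      show (if res E P = p then w else 0) ∈ P.1
      rw [if_neg (show ¬ res E P = p from hne)]
      exact P.1.zero_mem
    have h1 := hl' ⟨_, hf⟩
    have h2 : trAdl E ⟨_, hf⟩ = sgl p (Algebra.trace E K w) := by
      refine Subtype.ext (funext fun q => ?_)
      rw [trAdl_apply, sgl_apply]
      show Algebra.trace E K (if q = p then w else 0) = _
      split_ifs
      · rfl
      · exact map_zero _
    rw [h2] at h1
    rw [← h1]
    refine (mem_Om.1 hl'W).1 _ (mem_AD.2 fun P => ?_)
    rw [fibIncl_apply]
    show (if res E P = p then w else 0) ∈ _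
    split_ifs with h
    · exact hw P ((mem_abv E).2 h)
    · exact Submodule.zero_mem _
  set t := Algebra.trace E K z with ht
  have ht0 : t ≠ 0 := by rintro h; rw [h] at hcon; exact hcon (Submodule.zero_mem _)
  rw [mem_pw_of_ne ht0, not_le] at hcon
  have hle : W + Finsupp.single p 1 ≤ W := by
    refine (hW.2 _).1 (mem_Om.2 ⟨fun α hα => ?_, (mem_Om.1 hl0).2⟩)
    set y := (α : Pl E → E) p with hy
    have hyp : y ∈ pw p (-W p - 1) := by
      have := mem_AD.1 hα p
      rw [Finsupp.add_apply, Finsupp.single_eq_same] at this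
      exact pw_anti (by omega) this
    have h1 : l (sgl p y) = 0 := by
      have h2 := hsg ((y / t) • z) fun P hP => by
        have h3 : ((y / t : E) : K) ∈ pw P 0 := by
          rw [mem_pw_zero, ← mem_res E, (mem_abv E).1 hP]
          by_cases hy0 : y = 0
          · rw [hy0, zero_div]; exact p.1.zero_mem
          · rw [mem_iff_ord p (div_ne_zero hy0 ht0), ord_div p hy0 ht0]
            have := (mem_pw_of_ne hy0).1 hyp
            omega
        have := pw_mul h3 (hz P hP)
        rwa [zero_add] at this
      rwa [map_smul, smul_eq_mul, ← ht, div_mul_cancel₀ _ ht0] at h2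
    have h2 : α - sgl p y ∈ AD W := by
      refine mem_AD.2 fun q => ?_
      show (α : Pl E → E) q - (sgl p y : Pl E → E) q ∈ _
      rw [sgl_apply]
      split_ifs with hq
      · subst hq
        rw [hy, sub_self]; exact Submodule.zero_mem _
      · rw [sub_zero]
        have := mem_AD.1 hα q
        rwa [Finsupp.add_apply, Finsupp.single_eq_of_ne hq, add_zero] at this
    have h3 := (mem_Om.1 hlW).1 _ h2
    rw [map_sub, h1, sub_zero] at h3
    exact h3
  have := hle p
  rw [Finsupp.add_apply, Finsupp.single_eq_same] at this
  omega

end Cotrace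

section Inert

variable {K : Type} [Field K] [Algebra 𝔽 K] (E : IntermediateField 𝔽 K) [GenusFour K] [PosGenus E]
  [FiniteDimensional E K] [Algebra.IsSeparable E K]

lemma sub_sq_two (a b : K) : (a - b) ^ 2 = a ^ 2 - b ^ 2 := by
  simpa using sub_pow_two_pow a b 1

/-- A function with a double pole is a square up to functions with a simple pole. -/
lemma exists_sq_approx (P : Pl K) (S : Finset (Pl K)) (hP : P ∈ S) {z : K} (hz : z ∈ pw P (-2))
    (hzS : ∀ Q ∈ S, Q ≠ P → z ∈ Q.1) :
    ∃ w : K, (w ∈ pw P (-1) ∧ ∀ Q ∈ S, Q ≠ P → w ∈ Q.1) ∧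
      (z - w ^ 2 ∈ pw P (-1) ∧ ∀ Q ∈ S, Q ≠ P → z - w ^ 2 ∈ Q.1) := by
  set π := unif P with hπ
  have hπ0 : π ≠ 0 := unif_ne P
  have hπ1 : ∀ n : ℤ, π ^ n ∈ pw P n := fun n => by
    have := mem_pw_ord P (π ^ n)
    rwa [ord_unif_zpow] at this
  have hzπ : z * π ^ 2 ∈ P.1 := by
    rw [← mem_pw_zero]
    have := pw_mul hz (hπ1 2)
    rw [show (-2 : ℤ) + 2 = 0 by norm_num] at this
    exact_mod_cast this
  set u := (z * π ^ 2) ^ 2 ^ (deg P - 1) with hu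
  have huP : u ∈ P.1 := pow_mem hzπ _
  have hu2 : u ^ 2 - z * π ^ 2 ∈ pw P 1 := by
    have h1 := pow_card_sub_mem P hzπ
    rwa [show 2 ^ deg P = 2 ^ (deg P - 1) * 2 by
      rw [← pow_succ, Nat.sub_add_cancel (deg_pos P)], pow_mul] at h1
  obtain ⟨w, hw⟩ := approx S (fun Q => if Q = P then u * π ^ (-1 : ℤ) else 0) (fun _ => 0)
  have hwP := hw P hP
  rw [if_pos rfl] at hwP
  have hwQ : ∀ Q ∈ S, Q ≠ P → w ∈ Q.1 := fun Q hQ hne => by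
    have := hw Q hQ
    rwa [if_neg hne, sub_zero, mem_pw_zero] at this
  have huπ : u * π ^ (-1 : ℤ) ∈ pw P (-1) := by
    have := pw_mul (mem_pw_zero.2 huP) (hπ1 (-1))
    rwa [zero_add] at this
  refine ⟨w, ⟨?_, hwQ⟩, ?_, fun Q hQ hne => sub_mem (hzS Q hQ hne)
    (pow_mem (hwQ Q hQ hne) _)⟩
  · have := Submodule.add_mem _ (pw_anti (by norm_num : (-1 : ℤ) ≤ 0) hwP) huπ
    rwa [sub_add_cancel] at this
  · have h1 : (w - u * π ^ (-1 : ℤ)) ^ 2 ∈ pw P (-1) := by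
      have := pw_pow hwP 2
      exact pw_anti (by norm_num) this
    have h2 : (u ^ 2 - z * π ^ 2) * π ^ (-2 : ℤ) ∈ pw P (-1) := by
      have := pw_mul hu2 (hπ1 (-2))
      rwa [show (1 : ℤ) + -2 = -1 by norm_num] at this
    have h3 : z - w ^ 2 = - ((w - u * π ^ (-1 : ℤ)) ^ 2 + (u ^ 2 - z * π ^ 2) * π ^ (-2 : ℤ)) := by
      rw [sub_sq_two, mul_pow, ← zpow_natCast (π ^ (-1 : ℤ)), ← zpow_mul, sub_mul, mul_assoc,
        ← zpow_natCast π 2, ← zpow_add₀ hπ0]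
      norm_num
    rw [h3]
    exact Submodule.neg_mem _ (Submodule.add_mem _ h1 h2)

/-- The ramification of a place that divides the different only simply. -/
lemma trace_mem_of_three_le_ram {Q : Pl K} (hQ : 3 ≤ ram E Q) {p : Pl E} {z : K}
    (hz : ∀ P ∈ abv E p, z ∈ pw P (-(Finsupp.single Q 2 : Dv K) P)) :
    Algebra.trace E K z ∈ pw p 0 := by
  by_cases hp : res E Q = p
  · have h1 : Algebra.trace E K (unif p • z) ∈ pw p 1 := by
      refine trace_mem_max E fun P hP => ?_
      have h2 : ((unif p : E) : K) ∈ pw P (ram E P) := by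
        have := (coe_mem_pw E P (unif p) 1).2 (by
          rw [(mem_abv E).1 hP]
          have := mem_pw_ord p (unif p)
          rwa [ord_unif] at this)
        rwa [mul_one] at this
      have h3 := pw_mul h2 (hz P hP)
      refine pw_anti ?_ h3
      rw [Finsupp.single_apply]
      split_ifs with h
      · subst h; omega
      · have := ram_pos E P; omega
    rw [map_smul, smul_eq_mul] at h1
    have h4 : (unif p)⁻¹ ∈ pw p (-1) := by
      have := mem_pw_ord p (unif p)⁻¹
      rwa [ord_inv, ord_unif] at this
    have h5 := pw_mul h4 h1
    rwa [inv_mul_cancel_left₀ (unif_ne p), show (-1 : ℤ) + 1 = 0 by norm_num] at h5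
  · rw [mem_pw_zero]
    refine trace_mem E fun P hP => ?_
    have h := hz P hP
    rwa [Finsupp.single_eq_of_ne (by rintro rfl; exact hp ((mem_abv E).1 hP)), neg_zero,
      mem_pw_zero] at h

lemma el_eq_zero_of_degD_lt {L : Type} [Field L] [Algebra 𝔽 L] [CongFF L] {D : Dv L}
    (h : degD D < 0) : el D = 0 := by
  rw [el_eq]
  have : Lsp D = ⊥ := by
    rw [eq_bot_iff]
    intro f hf
    by_contra hf0
    have := degD_nonneg ((mem_Lsp_of_ne hf0).1 hf)
    rw [map_add, degD_dv] at this
    omega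
  rw [this, finrank_bot]

theorem exists_inert (hn : 2 ≤ Module.finrank E K) :
    Module.finrank E K = 3 ∧ gn E = 2 ∧ (∀ Q : Pl K, ram E Q ≤ 2) ∧
      ∃ (p : Pl E) (P : Pl K), deg p = 2 ∧ deg P = 6 ∧
        con E (Finsupp.single p 1) = Finsupp.single P 1 ∧
        el (Finsupp.single p 1 : Dv E) = 2 ∧ el (Finsupp.single p 2 : Dv E) = 3 := by
  obtain ⟨l, W, hW, hW0⟩ := exists_differential (K := E)
  obtain ⟨l', W', hW', hW'0, hA, hB⟩ := exists_cotrace E hW hW0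
  have hdeg' := hW'.deg_eq
  rw [gn_eq] at hdeg'
  norm_num at hdeg'
  obtain ⟨P, rfl⟩ := exists_eq_single hW'0 (by omega) (by omega)
  have hPdeg : deg P = 6 := by rw [degD_single] at hdeg'; omega
  have hz0 : ∀ p, ∀ t : E, t ∈ pw p 0 → t ∈ pw p (-W p) := fun p t ht =>
    pw_anti (by have : 0 ≤ W p := hW0 p; omega) ht
  set p := res E P with hp
  have hWp : 1 ≤ W p := by
    by_contra hcon
    have h0 : W p = 0 := by have : 0 ≤ W p := hW0 p; omega
    have h2 : (Finsupp.single P 2 : Dv K) ≤ Finsupp.single P 1 := by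
      refine hA _ (fun Q => ?_) fun q z hz => ?_
      · rw [Finsupp.single_apply]; split_ifs <;> simp
      · refine hz0 q _ ?_
        by_cases hq : q = p
        · subst hq
          have hPS := self_mem_abv E P
          have hzP := hz P hPS
          rw [Finsupp.single_eq_same] at hzP
          obtain ⟨w, ⟨hw1, hw2⟩, hw3, hw4⟩ := exists_sq_approx P (abv E (res E P)) hPS hzP
            fun Q hQ hne => by
              have := hz Q hQ
              rwa [Finsupp.single_eq_of_ne hne, neg_zero, mem_pw_zero] at this
          have hsimple : ∀ v : K, v ∈ pw P (-1) → (∀ Q ∈ abv E (res E P), Q ≠ P → v ∈ Q.1) →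
              Algebra.trace E K v ∈ pw (res E P) 0 := by
            intro v hv1 hv2
            have := hB (res E P) v fun Q hQ => by
              rw [Finsupp.single_apply]
              split_ifs with h
              · subst h; exact hv1
              · rw [neg_zero, mem_pw_zero]; exact hv2 Q hQ (Ne.symm h)
            rwa [← hp, h0, neg_zero] at this
          have h3 := hsimple _ hw3 hw4
          have h4 := pw_pow (hsimple _ hw1 hw2) 2
          rw [← trace_sq, mul_zero] at h4
          have h5 := Submodule.add_mem _ h3 h4
          rwa [← map_add, sub_add_cancel] at h5
        · rw [mem_pw_zero]
          refine trace_mem E fun Q hQ => ?_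
          have := hz Q hQ
          rwa [Finsupp.single_eq_of_ne (by rintro rfl; exact hq ((mem_abv E).1 hQ).symm), neg_zero,
            mem_pw_zero] at this
    have := h2 P
    rw [Finsupp.single_eq_same, Finsupp.single_eq_same] at this
    omega
  have hcon : con E W ≤ Finsupp.single P 1 := by
    refine hA _ (con_nonneg E hW0) fun q z hz => trace_mem_pw E _ fun Q hQ => ?_
    have := hz Q hQ
    rwa [con_apply, (mem_abv E).1 hQ, ← mul_neg] at this
  have hconP : con E W = Finsupp.single P 1 := by
    refine le_antisymm hcon fun Q => ?_
    rw [Finsupp.single_apply]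
    split_ifs with h
    · subst h
      rw [con_apply]
      have := ram_pos E P
      show 1 ≤ ram E P * W p
      nlinarith
    · exact con_nonneg E hW0 Q
  have hram : ∀ Q, ram E Q * W (res E Q) = (Finsupp.single P 1 : Dv K) Q := fun Q => by
    rw [← con_apply, hconP]
  have hWeq : W = Finsupp.single p 1 := by
    ext q
    obtain ⟨Q, hQ⟩ := exists_over E q
    have h1 := hram Q
    rw [hQ] at h1
    have h2 := ram_pos E Q
    rw [Finsupp.single_apply]
    split_ifs with h
    · have h3 := hram P
      rw [Finsupp.single_eq_same, ← hp] at h3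
      have h4 := ram_pos E P
      rw [← h]
      nlinarith
    · rw [Finsupp.single_eq_of_ne (by rintro rfl; exact h hQ)] at h1
      rcases mul_eq_zero.1 h1 with h3 | h3
      · omega
      · exact h3
  have hdeg := hW.deg_eq
  have h6 := degD_con E W
  rw [hconP, degD_single, hPdeg, hdeg] at h6
  rw [hWeq, degD_single] at hdeg
  have hgpos := gn_pos (K := E)
  have h3 : Module.finrank E K = 3 ∧ gn E = 2 := by
    have h7 : (3 : ℤ) = Module.finrank E K * (gn E - 1) := by push_cast at h6; linarith
    have h8 : 3 = Module.finrank E K * (gn E - 1) := by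
      have : ((gn E - 1 : ℕ) : ℤ) = gn E - 1 := by push_cast [hgpos]; rfl
      rw [← this] at h7
      exact_mod_cast h7
    have h9 : Module.finrank E K = 3 :=
      ((Nat.prime_three.eq_one_or_self_of_dvd _ ⟨_, h8⟩).resolve_left (by omega))
    refine ⟨h9, ?_⟩
    rw [h9] at h8
    omega
  have hdegp : deg p = 2 := by
    rw [h3.2] at hdeg
    push_cast at hdeg
    omega
  refine ⟨h3.1, h3.2, fun Q => ?_, p, P, hdegp, hPdeg, hWeq ▸ hconP, ?_, ?_⟩
  · by_contra hcon3
    have h7 : (Finsupp.single Q 2 : Dv K) ≤ Finsupp.single P 1 := by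
      refine hA _ (fun Q' => ?_) fun q z hz =>
        hz0 q _ (trace_mem_of_three_le_ram E (by omega) hz)
      rw [Finsupp.single_apply]; split_ifs <;> simp
    have := h7 Q
    rw [Finsupp.single_eq_same, Finsupp.single_apply] at this
    split_ifs at this <;> omega
  · rw [← hWeq, hW.el_eq, h3.2]
  · have h7 := hW.RR (Finsupp.single p 2)
    have h8 : el (W - Finsupp.single p 2) = 0 := by
      refine el_eq_zero_of_degD_lt ?_
      rw [map_sub, hWeq, degD_single, degD_single, hdegp]
      norm_num
    rw [h8, degD_single, hdegp, h3.2] at h7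
    push_cast at h7
    omega

end Inert

section Congruence

variable {K : Type} [Field K] [Algebra 𝔽 K] [CongFF K] {P : Pl K}

lemma pow_sub_pow_mem {a b : K} (ha : a ∈ P.1) (hb : b ∈ P.1) (h : a - b ∈ pw P 1) (n : ℕ) :
    a ^ n - b ^ n ∈ pw P 1 := by
  induction n with
  | zero => rw [pow_zero, pow_zero, sub_self]; exact Submodule.zero_mem _
  | succ n ih =>
    have h1 : a ^ (n + 1) - b ^ (n + 1) = a * (a ^ n - b ^ n) + b ^ n * (a - b) := by ring
    rw [h1]
    exact Submodule.add_mem _ (mul_mem_pw_one ha ih) (mul_mem_pw_one (pow_mem hb n) h)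

lemma mem_of_mem_pw_one {a : K} (h : a ∈ pw P 1) : a ∈ P.1 :=
  mem_pw_zero.1 (pw_anti zero_le_one h)

lemma mem_pw_one_or {a b : K} (h : a * b ∈ pw P 1) : a ∈ pw P 1 ∨ b ∈ pw P 1 := by
  by_cases hb : b ∈ pw P 1
  · exact Or.inr hb
  · exact Or.inl (mem_pw_one_of_mul h hb)

lemma sub_comm_mem {a b : K} {n : ℤ} (h : a - b ∈ pw P n) : b - a ∈ pw P n := by
  rw [← neg_sub]; exact Submodule.neg_mem _ h

lemma mem_pw_of_sub {a b : K} {n : ℤ} (h : a - b ∈ pw P n) (hb : b ∈ pw P n) : a ∈ pw P n := by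
  have := Submodule.add_mem _ h hb
  rwa [sub_add_cancel] at this

variable (E : IntermediateField 𝔽 K) [CongFF E] [FiniteDimensional E K]

lemma mem_pw_one_of_coe {y : E} (h : (y : K) ∈ pw P 1) : y ∈ pw (res E P) 1 := by
  by_contra hcon
  have h0 : y ≠ 0 := by
    rintro rfl
    exact hcon (Submodule.zero_mem _)
  have h0' : (y : K) ≠ 0 := fun h => h0 (Subtype.ext h)
  have h1 := (mem_pw_of_ne h0').1 h
  rw [ord_coe] at h1
  rw [mem_pw_of_ne h0, not_le] at hcon
  have := ram_pos E P
  nlinarith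

/-- A residue fixed by the Frobenius of the residue field below comes from below. -/
lemma exists_coe_of_pow_sub {z : K} (hz : z ∈ P.1)
    (h : z ^ 2 ^ deg (res E P) - z ∈ pw P 1) :
    ∃ y ∈ (res E P).1, z - ((y : E) : K) ∈ pw P 1 := by
  have := Fintype.ofFinite (IsLocalRing.ResidueField (res E P).1)
  have := Fintype.ofFinite (IsLocalRing.ResidueField P.1)
  set N := 2 ^ deg (res E P) with hN
  have hN1 : 1 < N := Nat.one_lt_two_pow (deg_pos _).ne'
  choose t ht using IsLocalRing.residue_surjective (R := (res E P).1)
  have hmem : ∀ a, (((t a : (res E P).1) : E) : K) ∈ P.1 := fun a => (t a).2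
  let g : IsLocalRing.ResidueField (res E P).1 → IsLocalRing.ResidueField P.1 := fun a =>
    IsLocalRing.residue P.1 ⟨_, hmem a⟩
  have hg : Function.Injective g := by
    intro a b hab
    have h1 := (residue_eq_iff _ _).1 hab
    rw [← ht a, ← ht b, residue_eq_iff]
    exact mem_pw_one_of_coe E (by exact_mod_cast h1)
  have hroots : (Finset.univ.image g) ⊆
      (X ^ N - X : (IsLocalRing.ResidueField P.1)[X]).roots.toFinset := by
    intro b hb
    obtain ⟨a, -, rfl⟩ := Finset.mem_image.1 hb
    rw [Multiset.mem_toFinset, mem_roots (FiniteField.X_pow_card_sub_X_ne_zero _ hN1), IsRoot.def,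
      eval_sub, eval_pow, eval_X, sub_eq_zero, ← map_pow, residue_eq_iff]
    exact coe_mem_pw_one E (pow_card_sub_mem (res E P) (t a).2)
  have hcard : (X ^ N - X : (IsLocalRing.ResidueField P.1)[X]).roots.toFinset.card ≤
      (Finset.univ.image g).card := by
    refine (Multiset.toFinset_card_le _).trans ((card_roots' _).trans ?_)
    rw [FiniteField.X_pow_card_sub_X_natDegree_eq _ hN1, Finset.card_image_of_injective _ hg,
      Finset.card_univ, ← Nat.card_eq_fintype_card, card_residueField]
  have heq := Finset.eq_of_subset_of_card_le hroots hcard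
  have hzr : IsLocalRing.residue P.1 ⟨z, hz⟩ ∈
      (X ^ N - X : (IsLocalRing.ResidueField P.1)[X]).roots.toFinset := by
    rw [Multiset.mem_toFinset, mem_roots (FiniteField.X_pow_card_sub_X_ne_zero _ hN1), IsRoot.def,
      eval_sub, eval_pow, eval_X, sub_eq_zero, ← map_pow, residue_eq_iff]
    exact h
  rw [← heq] at hzr
  obtain ⟨a, -, ha⟩ := Finset.mem_image.1 hzr
  exact ⟨(t a : (res E P).1), (t a).2, (residue_eq_iff _ _).1 ha.symm⟩

end Congruence

section Cubic

variable {K : Type} [Field K] [Algebra 𝔽 K] (E : IntermediateField 𝔽 K)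

/-- The second elementary symmetric function of the conjugates, for cubic extensions. -/
def esymmTwo (z : K) : E := Algebra.norm E z * Algebra.trace E K z⁻¹

variable [FiniteDimensional E K] [Algebra.IsSeparable E K] (h3 : Module.finrank E K = 3)

include h3

lemma exists_embeddings : ∃ σ : Fin 3 → (K →ₐ[E] AlgebraicClosure E), ∀ z : K,
    algebraMap E (AlgebraicClosure E) (Algebra.trace E K z) = σ 0 z + σ 1 z + σ 2 z ∧
    algebraMap E (AlgebraicClosure E) (Algebra.norm E z) = σ 0 z * σ 1 z * σ 2 z ∧
    algebraMap E (AlgebraicClosure E) (esymmTwo E z) =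
      σ 0 z * σ 1 z + σ 0 z * σ 2 z + σ 1 z * σ 2 z := by
  have hcard : Fintype.card (K →ₐ[E] AlgebraicClosure E) = 3 := by rw [AlgHom.card, h3]
  let e := (Fintype.equivFinOfCardEq hcard).symm
  have htr : ∀ z : K, algebraMap E (AlgebraicClosure E) (Algebra.trace E K z) =
      e 0 z + e 1 z + e 2 z := fun z => by
    rw [trace_eq_sum_embeddings (AlgebraicClosure E),
      ← Fintype.sum_equiv e (fun i => e i z) (fun σ => σ z) (fun _ => rfl), Fin.sum_univ_three]
  have hno : ∀ z : K, algebraMap E (AlgebraicClosure E) (Algebra.norm E z) =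
      e 0 z * e 1 z * e 2 z := fun z => by
    rw [Algebra.norm_eq_prod_embeddings E (AlgebraicClosure E),
      ← Fintype.prod_equiv e (fun i => e i z) (fun σ => σ z) (fun _ => rfl), Fin.prod_univ_three]
  refine ⟨e, fun z => ⟨htr z, hno z, ?_⟩⟩
  rw [esymmTwo, map_mul, htr, hno]
  by_cases hz : z = 0
  · simp [hz]
  · have h0 : ∀ i, e i z ≠ 0 := fun i => (map_ne_zero (e i)).2 hz
    have h00 := h0 0
    have h01 := h0 1
    have h02 := h0 2
    simp only [map_inv₀]
    field_simp
    ring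

lemma cubic_eq (z : K) : z ^ 3 - Algebra.trace E K z • z ^ 2 + esymmTwo E z • z -
    algebraMap E K (Algebra.norm E z) = 0 := by
  obtain ⟨σ, hσ⟩ := exists_embeddings E h3
  obtain ⟨h1, h2, h4⟩ := hσ z
  apply (σ 0 : K →+* AlgebraicClosure E).injective
  change σ 0 _ = σ 0 0
  simp only [Algebra.smul_def, map_zero, map_sub, map_add, map_mul, map_pow, AlgHom.commutes]
  rw [h1, h2, h4]
  ring

lemma esymmTwo_add (z w : K) : esymmTwo E (z + w) = esymmTwo E z + esymmTwo E w +
    Algebra.trace E K z * Algebra.trace E K w - Algebra.trace E K (z * w) := by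
  obtain ⟨σ, hσ⟩ := exists_embeddings E h3
  apply (algebraMap E (AlgebraicClosure E)).injective
  rw [map_sub, map_add, map_add, map_mul, (hσ _).2.2, (hσ z).2.2, (hσ w).2.2, (hσ z).1, (hσ w).1,
    (hσ (z * w)).1]
  simp only [map_add, map_mul]
  ring

lemma esymmTwo_smul (y : E) (z : K) : esymmTwo E (y • z) = y ^ 2 * esymmTwo E z := by
  obtain ⟨σ, hσ⟩ := exists_embeddings E h3
  apply (algebraMap E (AlgebraicClosure E)).injective
  rw [map_mul, (hσ _).2.2, (hσ z).2.2, map_pow]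
  simp only [Algebra.smul_def, map_mul, AlgHom.commutes]
  ring

variable [CongFF K] [CongFF E]

lemma esymmTwo_mem {p : Pl E} {z : K} (hz : ∀ P ∈ abv E p, z ∈ P.1) : esymmTwo E z ∈ p.1 := by
  obtain ⟨σ, hσ⟩ := exists_embeddings E h3
  have hintegral := isIntegral_of_abv E hz
  have h1 : ∀ i, IsIntegral p.1 (σ i z) := fun i => hintegral.map ((σ i).restrictScalars p.1)
  refine mem_of_isIntegral E ?_
  rw [← isIntegral_algebraMap_iff (algebraMap E (AlgebraicClosure E)).injective, (hσ z).2.2]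
  exact (((h1 0).mul (h1 1)).add ((h1 0).mul (h1 2))).add ((h1 1).mul (h1 2))

lemma esymmTwo_mem_pw {p : Pl E} {z : K} (n : ℤ) (h : ∀ P ∈ abv E p, z ∈ pw P (ram E P * n)) :
    esymmTwo E z ∈ pw p (2 * n) := by
  have hu := zpow_ne_zero n (unif_ne p)
  have h1 : esymmTwo E ((unif p ^ n)⁻¹ • z) ∈ p.1 := by
    refine esymmTwo_mem E h3 fun P hP => ?_
    rw [Algebra.smul_def, ← mem_pw_zero]
    have h2 : (((unif p ^ n)⁻¹ : E) : K) ∈ pw P (ram E P * (-n)) := by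
      rw [coe_mem_pw, (mem_abv E).1 hP]
      have := mem_pw_ord p ((unif p ^ n)⁻¹ : E)
      rwa [ord_inv, ord_unif_zpow] at this
    have h3 := pw_mul h2 (h P hP)
    rwa [mul_neg, neg_add_cancel] at h3
  rw [esymmTwo_smul E h3] at h1
  have h4 := pw_mul (pw_pow (mem_pw_ord p (unif p ^ n)) 2) (mem_pw_zero.2 h1)
  rw [ord_unif_zpow, add_zero, ← mul_assoc, inv_pow, mul_inv_cancel₀ (pow_ne_zero 2 hu),
    one_mul] at h4
  exact_mod_cast h4

end Cubic

section Pair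

variable {K : Type} [Field K] [Algebra 𝔽 K] (E : IntermediateField 𝔽 K) [GenusFour K] [PosGenus E]
  [FiniteDimensional E K] [Algebra.IsSeparable E K]

lemma con_single_apply (q : Pl E) (Q : Pl K) :
    con E (Finsupp.single q 1) Q = if res E Q = q then ram E Q else 0 := by
  rw [con_apply, Finsupp.single_apply]
  split_ifs with h1 h2 h2
  · rw [mul_one]
  · exact absurd h1.symm h2
  · exact absurd h2.symm h1
  · rw [mul_zero]

lemma sub_single_nonneg {D : Dv K} (h : 0 ≤ D) {P : Pl K} (hP : 1 ≤ D P) :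
    0 ≤ D - Finsupp.single P 1 := by
  intro Q
  rw [Finsupp.sub_apply, Finsupp.single_apply]
  have : 0 ≤ D Q := h Q
  split_ifs with hQ
  · subst hQ; show (0 : ℤ) ≤ _; omega
  · show (0 : ℤ) ≤ _; omega

/-- The place `q` of degree four is unramified with exactly two places `P`, `P'` above it, the
first of which has residue degree one. -/
structure IsPair (q : Pl E) (P P' : Pl K) : Prop where
  deg_base : deg q = 4
  deg_fst : deg P = 4
  ne : P ≠ P'
  mem_abv_iff : ∀ Q, Q ∈ abv E q ↔ Q = P ∨ Q = P'
  ram_fst : ram E P = 1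
  ram_snd : ram E P' = 1

theorem exists_isPair (h3 : Module.finrank E K = 3) (hram : ∀ Q : Pl K, ram E Q ≤ 2) :
    ∃ (q : Pl E) (P P' : Pl K), IsPair E q P P' := by
  obtain ⟨P, hP, hPu⟩ := exists_deg_four (K := K)
  set q := res E P with hq
  have hdvd : deg q ∣ 4 := by
    refine deg_dvd_of_forall fun y hy => ?_
    have := pow_card_sub_mem P ((mem_res E).1 hy)
    rw [hP] at this
    refine mem_pw_one_of_coe E (P := P) ?_
    exact_mod_cast this
  have hC0 : 0 ≤ con E (Finsupp.single q 1) := con_nonneg E (single_nonneg' q)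
  have hCdeg := degD_con E (Finsupp.single q 1)
  have hCP : con E (Finsupp.single q 1) P = ram E P := by rw [con_single_apply, if_pos hq.symm]
  have hC := fun Q => con_single_apply E q Q
  set C := con E (Finsupp.single q 1) with hCdef
  rw [degD_single, h3] at hCdeg
  have hr := ram_pos E P
  have hR0 := sub_single_nonneg hC0 (P := P) (by omega)
  set R := C - Finsupp.single P 1 with hR
  have hRdeg : degD R = 3 * deg q - 4 := by
    rw [hR, map_sub, degD_single, hCdeg, hP]; push_cast; ring
  have hRP : R P = ram E P - 1 := by rw [hR, Finsupp.sub_apply, hCP, Finsupp.single_eq_same]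
  have hq4 : deg q = 4 := by
    have h1 : deg q = 1 ∨ deg q = 2 ∨ deg q = 4 := by
      have := Nat.le_of_dvd (by norm_num) hdvd
      interval_cases deg q <;> omega
    rcases h1 with h1 | h1 | h1
    · have := degD_nonneg hR0
      rw [hRdeg, h1] at this
      norm_num at this
    · have := eq_zero_of_degD_le hR0 (by rw [hRdeg, h1]; norm_num)
      rw [this, map_zero, h1] at hRdeg
      norm_num at hRdeg
    · exact h1
  rw [hq4] at hRdeg
  norm_num at hRdeg
  have hrP : ram E P = 1 := by
    by_contra hcon
    have h1 := sub_single_nonneg hR0 (P := P) (by omega)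
    have h2 : degD (R - Finsupp.single P 1) = 4 := by rw [map_sub, degD_single, hRdeg, hP]; norm_num
    obtain ⟨Q, hQ⟩ := exists_eq_single h1 (by omega) (by omega)
    have h3' := h2
    rw [hQ, degD_single] at h3'
    have h4 := hPu Q (by omega)
    have h5 := DFunLike.congr_fun hQ P
    rw [h4, Finsupp.sub_apply, Finsupp.single_eq_same, hRP] at h5
    have := hram P
    omega
  obtain ⟨P', hP'0, hP'⟩ := exists_single_le hR0 (by rintro h; rw [h, map_zero] at hRdeg; omega)
  have hne : P ≠ P' := by
    rintro rfl
    omega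
  have h4 := four_le_deg P'
  have h5 : deg P' ≠ 4 := fun h => hne (hPu P' h).symm
  have h6 : R - Finsupp.single P' 1 = 0 := by
    refine eq_zero_of_degD_le hP' ?_
    rw [map_sub, degD_single, hRdeg]
    omega
  have hCeq : C = Finsupp.single P 1 + Finsupp.single P' 1 := by
    rw [← sub_eq_zero.1 h6, hR]; abel
  refine ⟨q, P, P', hq4, hP, hne, fun Q => ?_, hrP, ?_⟩
  · have h7 := hC Q
    rw [hCeq, Finsupp.add_apply, Finsupp.single_apply, Finsupp.single_apply] at h7
    have h8 := ram_pos E Q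
    rw [mem_abv]
    constructor
    · intro h
      by_contra hcon
      push Not at hcon
      rw [if_pos h, if_neg (Ne.symm hcon.1), if_neg (Ne.symm hcon.2)] at h7
      omega
    · intro h
      by_contra hcon
      rw [if_neg hcon] at h7
      rcases h with rfl | rfl
      · rw [if_pos rfl] at h7
        split_ifs at h7 <;> omega
      · rw [if_pos rfl] at h7
        split_ifs at h7 <;> omega
  · have h7 := hC P'
    rw [hCeq, Finsupp.add_apply, Finsupp.single_eq_same, Finsupp.single_eq_of_ne hne.symm] at h7
    split_ifs at h7 <;> omega

end Pair

section Local

variable {K : Type} [Field K] [Algebra 𝔽 K] {E : IntermediateField 𝔽 K} [GenusFour K] [PosGenus E]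
  [FiniteDimensional E K] [Algebra.IsSeparable E K] {q : Pl E} {P P' : Pl K}

section Basic

variable (h : IsPair E q P P')

include h

lemma IsPair.res_fst : res E P = q := (mem_abv E).1 ((h.mem_abv_iff P).2 (Or.inl rfl))

lemma IsPair.res_snd : res E P' = q := (mem_abv E).1 ((h.mem_abv_iff P').2 (Or.inr rfl))

lemma IsPair.forall {p : Pl K → Prop} (h1 : p P) (h2 : p P') : ∀ Q ∈ abv E q, p Q := by
  intro Q hQ
  rcases (h.mem_abv_iff Q).1 hQ with rfl | rfl
  · exact h1
  · exact h2

lemma IsPair.coe_fst {y : E} : (y : K) ∈ pw P 1 ↔ y ∈ pw q 1 := by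
  rw [← h.res_fst]
  exact ⟨mem_pw_one_of_coe E, coe_mem_pw_one E⟩

lemma IsPair.coe_snd {y : E} : (y : K) ∈ pw P' 1 ↔ y ∈ pw q 1 := by
  rw [← h.res_snd]
  exact ⟨mem_pw_one_of_coe E, coe_mem_pw_one E⟩

lemma IsPair.coe_mem_fst {y : E} : (y : K) ∈ P.1 ↔ y ∈ q.1 := by
  rw [← h.res_fst, mem_res]

lemma IsPair.coe_mem_snd {y : E} : (y : K) ∈ P'.1 ↔ y ∈ q.1 := by
  rw [← h.res_snd, mem_res]

end Basic

lemma trace_coe (h3 : Module.finrank E K = 3) (y : E) : Algebra.trace E K (y : K) = y := by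
  have := Algebra.trace_algebraMap (R := E) (S := K) y
  rw [h3] at this
  refine this.trans ?_
  rw [show 3 • y = (y + y) + y by ring, add_self_K, zero_add]

variable (h : IsPair E q P P') (h3 : Module.finrank E K = 3)

include h h3

lemma IsPair.mem_or_of_trace {z : K} {y w : E} (hy : y ∈ q.1) (hw : w ∈ q.1)
    (hzy : z - y ∈ pw P 1) (hzw : z - w ∈ pw P' 1) (ht : Algebra.trace E K z ∈ pw q 1) :
    y ∈ pw q 1 ∨ w ∈ pw q 1 := by
  obtain ⟨ε, hε⟩ := approx {P, P'} (fun Q => if Q = P then 1 else 0) (fun _ => 1)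
  have h1 := hε P (by simp)
  have h2 := hε P' (by simp)
  rw [if_pos rfl] at h1
  rw [if_neg h.ne.symm, sub_zero] at h2
  have hεP : ε ∈ P.1 := by
    have := add_mem (mem_of_mem_pw_one h1) (one_mem P.1)
    rwa [sub_add_cancel] at this
  have hεP' := mem_of_mem_pw_one h2
  set t := Algebra.trace E K ε with htdef
  have htt : t * (t - 1) ∈ pw q 1 := by
    have h5 : Algebra.trace E K (ε ^ 2 - ε) ∈ pw q 1 := by
      refine trace_mem_max E (h.forall ?_ ?_)
      · rw [show ε ^ 2 - ε = ε * (ε - 1) by ring]; exact mul_mem_pw_one hεP h1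
      · rw [show ε ^ 2 - ε = (ε - 1) * ε by ring]
        exact mul_mem_pw_one (sub_mem hεP' (one_mem _)) h2
    rw [map_sub, trace_sq, ← htdef] at h5
    rwa [show t * (t - 1) = t ^ 2 - t by ring]
  have h6 : Algebra.trace E K (z - (y • ε + w • (1 - ε))) ∈ pw q 1 := by
    refine trace_mem_max E (h.forall ?_ ?_)
    · rw [Algebra.smul_def, Algebra.smul_def]
      have h7 : z - ((y : K) * ε + (w : K) * (1 - ε)) =
          (z - y) - ((y : K) - w) * (ε - 1) := by ring
      show z - ((y : K) * ε + (w : K) * (1 - ε)) ∈ _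
      rw [h7]
      exact Submodule.sub_mem _ hzy
        (mul_mem_pw_one (sub_mem (h.coe_mem_fst.2 hy) (h.coe_mem_fst.2 hw)) h1)
    · rw [Algebra.smul_def, Algebra.smul_def]
      have h7 : z - ((y : K) * ε + (w : K) * (1 - ε)) =
          (z - w) - ((y : K) - w) * ε := by ring
      show z - ((y : K) * ε + (w : K) * (1 - ε)) ∈ _
      rw [h7]
      exact Submodule.sub_mem _ hzw
        (mul_mem_pw_one (sub_mem (h.coe_mem_snd.2 hy) (h.coe_mem_snd.2 hw)) h2)
  have hone : Algebra.trace E K (1 : K) = 1 := trace_coe h3 (1 : E)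
  rw [map_sub, map_add, map_smul, map_smul, map_sub, hone, ← htdef, smul_eq_mul, smul_eq_mul] at h6
  have h8 : y * t + w * (1 - t) ∈ pw q 1 := by
    have := Submodule.sub_mem _ ht h6
    rwa [sub_sub_cancel] at this
  rcases mem_pw_one_or htt with h9 | h9
  · right
    have h10 := Submodule.sub_mem _ h8 (mul_mem_pw_one (sub_mem hy hw) h9)
    rwa [show y * t + w * (1 - t) - (y - w) * t = w by ring] at h10
  · left
    have h10 := Submodule.sub_mem _ h8 (mul_mem_pw_one (sub_mem hy hw) h9)
    rwa [show y * t + w * (1 - t) - (y - w) * (t - 1) = y by ring] at h10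

/-- An integral element whose reduction is annihilated by trace and second symmetric function
reduces to zero. -/
theorem IsPair.mem_pw_one {θ : K} (hθ : θ ∈ P.1) (hθ' : θ ∈ P'.1)
    (ht : Algebra.trace E K θ ∈ pw q 1) (he : esymmTwo E θ ∈ pw q 1) :
    θ ∈ pw P 1 ∧ θ ∈ pw P' 1 := by
  set N := Algebra.norm E θ with hN
  have hNq : N ∈ q.1 := norm_mem E (h.forall hθ hθ')
  have hcube : θ ^ 3 - (N : K) = (Algebra.trace E K θ : K) * θ ^ 2 - (esymmTwo E θ : K) * θ := by
    have := cubic_eq E h3 θ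
    rw [Algebra.smul_def, Algebra.smul_def] at this
    change θ ^ 3 - (Algebra.trace E K θ : K) * θ ^ 2 + (esymmTwo E θ : K) * θ - (N : K) = 0 at this
    linear_combination this
  have hc : θ ^ 3 - (N : K) ∈ pw P 1 := by
    rw [hcube]
    exact Submodule.sub_mem _ (mul_mem_pw_one' (h.coe_fst.2 ht) (pow_mem hθ 2))
      (mul_mem_pw_one' (h.coe_fst.2 he) hθ)
  have hc' : θ ^ 3 - (N : K) ∈ pw P' 1 := by
    rw [hcube]
    exact Submodule.sub_mem _ (mul_mem_pw_one' (h.coe_snd.2 ht) (pow_mem hθ' 2))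
      (mul_mem_pw_one' (h.coe_snd.2 he) hθ')
  have hiff : θ ∈ pw P 1 ↔ θ ∈ pw P' 1 := by
    constructor
    · intro h1
      refine mem_pw_one_of_pow (k := 3) (mem_pw_of_sub hc' (h.coe_snd.2 (h.coe_fst.1 ?_)))
      refine mem_pw_of_sub (sub_comm_mem hc) ?_
      rw [pow_succ]
      exact mul_mem_pw_one (pow_mem hθ 2) h1
    · intro h1
      refine mem_pw_one_of_pow (k := 3) (mem_pw_of_sub hc (h.coe_fst.2 (h.coe_snd.1 ?_)))
      refine mem_pw_of_sub (sub_comm_mem hc') ?_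
      rw [pow_succ]
      exact mul_mem_pw_one (pow_mem hθ' 2) h1
  suffices h0 : θ ∈ pw P 1 from ⟨h0, hiff.1 h0⟩
  by_contra hnot
  obtain ⟨y, hy, hθy⟩ := exists_coe_of_pow_sub E (P := P) hθ (by
    have := pow_card_sub_mem P hθ
    rwa [h.deg_fst, ← h.deg_base, ← h.res_fst] at this)
  rw [h.res_fst] at hy
  have hynot : y ∉ pw q 1 := fun h1 => hnot (mem_pw_of_sub hθy (h.coe_fst.2 h1))
  have hy15 : y ^ 15 - 1 ∈ pw q 1 := by
    have h1 := pow_card_sub_mem q hy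
    rw [h.deg_base, show y ^ 2 ^ 4 - y = (y ^ 15 - 1) * y by ring] at h1
    exact mem_pw_one_of_mul h1 hynot
  have hyN : y ^ 3 - N ∈ pw q 1 := by
    rw [← h.coe_fst]
    have h1 := pow_sub_pow_mem hθ (h.coe_mem_fst.2 hy) hθy 3
    have h2 := Submodule.sub_mem _ hc h1
    rw [sub_sub_sub_cancel_left] at h2
    exact_mod_cast h2
  have hN5 : N ^ 5 - 1 ∈ pw q 1 := by
    have h1 := pow_sub_pow_mem (pow_mem hy 3) hNq hyN 5
    rw [← pow_mul] at h1
    have h2 := Submodule.sub_mem _ hy15 h1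
    rwa [sub_sub_sub_cancel_left] at h2
  have hθ15 : θ ^ 15 - 1 ∈ pw P' 1 := by
    have h1 := pow_sub_pow_mem (pow_mem hθ' 3) (h.coe_mem_snd.2 hNq) hc' 5
    rw [← pow_mul] at h1
    have h2 : (N : K) ^ 5 - 1 ∈ pw P' 1 := by
      have := h.coe_snd.2 hN5
      exact_mod_cast this
    have h4 := Submodule.add_mem _ h1 h2
    rwa [sub_add_sub_cancel] at h4
  obtain ⟨w, hw, hθw⟩ := exists_coe_of_pow_sub E (P := P') hθ' (by
    rw [h.res_snd, h.deg_base, show θ ^ 2 ^ 4 - θ = θ * (θ ^ 15 - 1) by ring]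
    exact mul_mem_pw_one hθ' hθ15)
  rw [h.res_snd] at hw
  rcases h.mem_or_of_trace h3 hy hw hθy hθw ht with h1 | h1
  · exact hynot h1
  · exact hnot (hiff.2 (mem_pw_of_sub hθw (h.coe_snd.2 h1)))

end Local

section Descent

variable {K : Type} [Field K] [Algebra 𝔽 K] {E : IntermediateField 𝔽 K} [GenusFour K] [PosGenus E]
  [FiniteDimensional E K] [Algebra.IsSeparable E K]

lemma dv_norm {f : K} (hf : f ≠ 0) {D : Dv E} (hD : dv f = con E D) :
    dv (Algebra.norm E f) = Module.finrank E K • D := by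
  ext p
  set n := Module.finrank E K
  set s := unif p ^ D p with hs
  have hs0 : s ≠ 0 := zpow_ne_zero _ (unif_ne p)
  have hs0' : (s : K) ≠ 0 := fun h => hs0 (Subtype.ext h)
  have hN0 : Algebra.norm E f ≠ 0 := Algebra.norm_ne_zero_iff.2 hf
  have hord : ∀ P ∈ abv E p, ord P f = ord P (s : K) := fun P hP => by
    rw [← dv_apply, hD, con_apply, ord_coe, (mem_abv E).1 hP, ord_unif_zpow]
  have h1 : Algebra.norm E (f * (s : K)⁻¹) ∈ p.1 := norm_mem E fun P hP => by
    rw [mem_iff_ord P (mul_ne_zero hf (inv_ne_zero hs0')), ord_mul P hf (inv_ne_zero hs0'), ord_inv,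
      hord P hP, add_neg_cancel]
  have h2 : Algebra.norm E (f⁻¹ * (s : K)) ∈ p.1 := norm_mem E fun P hP => by
    rw [mem_iff_ord P (mul_ne_zero (inv_ne_zero hf) hs0'), ord_mul P (inv_ne_zero hf) hs0', ord_inv,
      hord P hP, neg_add_cancel]
  have h4 : Algebra.norm E (s : K) = s ^ n := Algebra.norm_algebraMap (S := K) s
  have hinv : ∀ x : K, x ≠ 0 → Algebra.norm E x⁻¹ = (Algebra.norm E x)⁻¹ := fun x hx =>
    eq_inv_of_mul_eq_one_left (by rw [← map_mul, inv_mul_cancel₀ hx, map_one])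
  have hsn := pow_ne_zero n hs0
  rw [map_mul, hinv _ hs0', h4, mem_iff_ord p (mul_ne_zero hN0 (inv_ne_zero hsn)),
    ord_mul p hN0 (inv_ne_zero hsn), ord_inv, ord_pow, ord_unif_zpow] at h1
  rw [map_mul, hinv f hf, h4, mem_iff_ord p (mul_ne_zero (inv_ne_zero hN0) hsn),
    ord_mul p (inv_ne_zero hN0) hsn, ord_inv, ord_pow, ord_unif_zpow] at h2
  rw [dv_apply, Finsupp.smul_apply, nsmul_eq_mul]
  linarith

variable {q p : Pl E} {P P' : Pl K}

/-- The function on `E` with divisor `q - 2 p`. -/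
theorem IsPair.exists_vanishing (h : IsPair E q P P') (h3 : Module.finrank E K = 3)
    (hp : deg p = 2) :
    ∃ g : E, g ≠ 0 ∧ g ∈ Lsp (Finsupp.single p 2) ∧ g ∈ pw q 1 := by
  set D : Dv E := Finsupp.single q 1 - Finsupp.single p 2 with hDdef
  have hqp : q ≠ p := by
    rintro rfl
    have := h.deg_base
    omega
  have hDq : D q = 1 := by
    rw [hDdef, Finsupp.sub_apply, Finsupp.single_eq_same, Finsupp.single_eq_of_ne hqp, sub_zero]
  obtain ⟨f, hf, hDf⟩ := exists_eq_dv (D := con E D) (by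
    rw [degD_con, hDdef, map_sub, degD_single, degD_single, h.deg_base, hp]
    norm_num)
  have hN := dv_norm hf hDf.symm
  have hN0 : Algebra.norm E f ≠ 0 := Algebra.norm_ne_zero_iff.2 hf
  have hN0' : ((Algebra.norm E f : E) : K) ≠ 0 := fun h => hN0 (Subtype.ext h)
  have hcube : f ^ 3 = ((Algebra.norm E f : E) : K) := by
    refine eq_of_dv_eq (pow_ne_zero 3 hf) hN0' ?_
    rw [dv_pow, ← hDf, ← con_dv, hN, h3, map_nsmul]
  have hordP : ord P f = 1 := by
    rw [← dv_apply, ← hDf, con_apply, h.res_fst, hDq, h.ram_fst, mul_one]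
  have hordP' : ord P' f = 1 := by
    rw [← dv_apply, ← hDf, con_apply, h.res_snd, hDq, h.ram_snd, mul_one]
  have hlin : ((Algebra.trace E K f : E) : K) * f = ((esymmTwo E f : E) : K) := by
    have h1 := cubic_eq E h3 f
    rw [Algebra.smul_def, Algebra.smul_def] at h1
    change f ^ 3 - (Algebra.trace E K f : K) * f ^ 2 + (esymmTwo E f : K) * f -
      (Algebra.norm E f : K) = 0 at h1
    refine mul_right_cancel₀ hf ?_
    linear_combination hcube - h1
  by_cases ht : Algebra.trace E K f = 0
  · exfalso
    have he : esymmTwo E f = 0 := by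
      rw [ht] at hlin
      refine Subtype.ext (hlin.symm.trans ?_)
      exact zero_mul _
    have hu := unif_ne q
    have hu' : (((unif q)⁻¹ : E) : K) ≠ 0 := fun h => inv_ne_zero hu (Subtype.ext h)
    have h0 : (((unif q)⁻¹ : E) : K) * f ≠ 0 := mul_ne_zero hu' hf
    have hmP : ord P ((((unif q)⁻¹ : E) : K) * f) = 0 := by
      rw [ord_mul P hu' hf, ord_coe, h.res_fst, ord_inv, ord_unif, h.ram_fst, hordP]; norm_num
    have hmP' : ord P' ((((unif q)⁻¹ : E) : K) * f) = 0 := by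
      rw [ord_mul P' hu' hf, ord_coe, h.res_snd, ord_inv, ord_unif, h.ram_snd, hordP']; norm_num
    have h4 := (h.mem_pw_one h3 (θ := (unif q)⁻¹ • f) ((mem_iff_ord P h0).2 hmP.ge)
      ((mem_iff_ord P' h0).2 hmP'.ge)
      (by rw [map_smul, ht, smul_zero]; exact Submodule.zero_mem _)
      (by rw [esymmTwo_smul E h3, he, mul_zero]; exact Submodule.zero_mem _)).1
    have h5 : (((unif q)⁻¹ : E) : K) * f ∈ pw P 1 := h4
    rw [mem_pw_of_ne h0, hmP] at h5
    norm_num at h5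
  · have ht' : ((Algebra.trace E K f : E) : K) ≠ 0 := fun h => ht (Subtype.ext h)
    have hg : (((Algebra.trace E K f)⁻¹ * esymmTwo E f : E) : K) = f := by
      show (Algebra.trace E K f : K)⁻¹ * (esymmTwo E f : K) = f
      rw [← hlin, inv_mul_cancel_left₀ ht']
    refine ⟨(Algebra.trace E K f)⁻¹ * esymmTwo E f, fun h0 => hf ?_, (mem_Lsp_con E).1 ?_, h.coe_fst.1 ?_⟩
    · rw [← hg, h0]; rfl
    · rw [hg, mem_Lsp_of_ne hf, ← hDf, ← map_add, hDdef, sub_add_cancel]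
      exact con_nonneg E (single_nonneg' q)
    · rw [hg, mem_pw_of_ne hf, hordP]

end Descent

section Generator

variable {L : Type} [Field L] [Algebra 𝔽 L] [CongFF L]

lemma mem_Lsp_sub_single {D : Dv L} {q : Pl L} (hD : D q = 0) {y : L} (hy : y ∈ Lsp D)
    (hq : y ∈ pw q 1) : y ∈ Lsp (D - Finsupp.single q 1) := by
  rw [mem_Lsp]
  intro Q
  rw [Finsupp.sub_apply, Finsupp.single_apply]
  split_ifs with h
  · rw [← h, hD]
    exact hq
  · rw [sub_zero]
    exact mem_Lsp.1 hy Q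

lemma eq_zero_of_mem_Lsp {D : Dv L} (h : degD D < 0) {y : L} (hy : y ∈ Lsp D) : y = 0 := by
  by_contra h0
  have := degD_nonneg ((mem_Lsp_of_ne h0).1 hy)
  rw [map_add, degD_dv] at this
  omega

lemma mem_of_mem_Lsp_single {p q : Pl L} (hqp : q ≠ p) {n : ℤ} {y : L}
    (hy : y ∈ Lsp (Finsupp.single p n)) : y ∈ q.1 := by
  have := mem_Lsp.1 hy q
  rwa [Finsupp.single_eq_of_ne hqp, neg_zero, mem_pw_zero] at this

lemma mul_mem_Lsp {D D' : Dv L} {y z : L} (hy : y ∈ Lsp D) (hz : z ∈ Lsp D') :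
    y * z ∈ Lsp (D + D') := by
  rw [mem_Lsp] at hy hz ⊢
  intro Q
  rw [Finsupp.add_apply, neg_add]
  exact pw_mul (hy Q) (hz Q)

lemma one_mem_Lsp_single (p : Pl L) : (1 : L) ∈ Lsp (Finsupp.single p 1) :=
  Lsp_mono (single_nonneg' p) (mem_Lsp_zero.2 (Or.inr rfl))

/-- The functions with at most a double pole at `p` reduce into a field of four elements at `q`,
if one of them vanishes there. -/
theorem exists_generator {p q : Pl L} (hp : deg p = 2) (hq : deg q = 4)
    (h1 : el (Finsupp.single p 1 : Dv L) = 2) (h2 : el (Finsupp.single p 2 : Dv L) = 3)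
    {g : L} (hg0 : g ≠ 0) (hg : g ∈ Lsp (Finsupp.single p 2)) (hgq : g ∈ pw q 1) :
    ∃ x ∈ Lsp (Finsupp.single p 1 : Dv L), x ∉ p.1 ∧ x ^ 2 + x + 1 ∈ pw q 1 ∧
      ∀ u ∈ Lsp (Finsupp.single p 2 : Dv L), u ∈ q.1 ∧ u ^ 4 - u ∈ pw q 1 := by
  have hqp : q ≠ p := by
    rintro rfl
    omega
  have hvan : ∀ y ∈ Lsp (Finsupp.single p 1 : Dv L), y ∈ pw q 1 → y = 0 := fun y hy hyq => by
    refine eq_zero_of_mem_Lsp ?_ (mem_Lsp_sub_single (Finsupp.single_eq_of_ne hqp) hy hyq)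
    rw [map_sub, degD_single, degD_single, hp, hq]
    norm_num
  obtain ⟨x, hx, hx0⟩ : ∃ x ∈ Lsp (Finsupp.single p 1 : Dv L), x ∉ Lsp (0 : Dv L) := by
    by_contra hcon
    push Not at hcon
    have h4 : Lsp (Finsupp.single p 1 : Dv L) = Lsp 0 :=
      le_antisymm hcon (Lsp_mono (single_nonneg' p))
    rw [el_eq, h4, ← el_eq, el_zero] at h1
    omega
  have hx01 := hx0
  rw [mem_Lsp_zero, not_or] at hx01
  have hxq := mem_of_mem_Lsp_single hqp hx
  have hone := one_mem_Lsp_single p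
  have hx2 : x ^ 2 ∈ Lsp (Finsupp.single p 2 : Dv L) := by
    have := mul_mem_Lsp hx hx
    rwa [← Finsupp.single_add, ← sq] at this
  have hle : Lsp (Finsupp.single p 1 : Dv L) ≤ Lsp (Finsupp.single p 2) := by
    refine Lsp_mono ?_
    rw [show (Finsupp.single p 2 : Dv L) = Finsupp.single p 1 + Finsupp.single p 1 by
      rw [← Finsupp.single_add]; norm_num]
    exact le_add_of_nonneg_left (single_nonneg' p)
  have hrep : ∀ u ∈ Lsp (Finsupp.single p 2 : Dv L), ∃ a b c : 𝔽,
      u = a • (1 : L) + b • x + c • x ^ 2 := by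
    let v : Fin 3 → Lsp (Finsupp.single p 2 : Dv L) := ![⟨1, hle hone⟩, ⟨x, hle hx⟩, ⟨x ^ 2, hx2⟩]
    have hv : ∀ a : Fin 3 → 𝔽, ((∑ i, a i • v i : Lsp (Finsupp.single p 2 : Dv L)) : L) =
        a 0 • (1 : L) + a 1 • x + a 2 • x ^ 2 := fun a => by
      rw [Fin.sum_univ_three]; rfl
    have hind : LinearIndependent 𝔽 v := by
      rw [Fintype.linearIndependent_iff]
      intro a ha
      have h4 := hv a
      rw [ha] at h4
      have h5 := (_root_.transcendental_iff.1 (transcendental_iff.2 hx01))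
        (C (a 0) + C (a 1) * X + C (a 2) * X ^ 2) (by
          simp only [map_add, map_mul, aeval_C, aeval_X, map_pow]
          rw [Algebra.smul_def, Algebra.smul_def, Algebra.smul_def, mul_one] at h4
          exact h4.symm)
      have c0 := congrArg (fun f => coeff f 0) h5
      have c1 := congrArg (fun f => coeff f 1) h5
      have c2 := congrArg (fun f => coeff f 2) h5
      simp [coeff_X, coeff_C] at c0 c1 c2
      intro i
      fin_cases i
      · exact c0
      · exact c1
      · exact c2
    have hspan := hind.span_eq_top_of_card_eq_finrank (by rw [Fintype.card_fin, ← el_eq, h2])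
    intro u hu
    have h4 : (⟨u, hu⟩ : Lsp (Finsupp.single p 2 : Dv L)) ∈ Submodule.span 𝔽 (Set.range v) := by
      rw [hspan]; exact Submodule.mem_top
    obtain ⟨a, ha⟩ := (Submodule.mem_span_range_iff_exists_fun 𝔽).1 h4
    refine ⟨a 0, a 1, a 2, ?_⟩
    rw [← hv, ha]
  have hx1 : x + 1 ∈ Lsp (Finsupp.single p 1 : Dv L) := Submodule.add_mem _ hx hone
  have hx10 : x + 1 ≠ 0 := fun h => hx01.2 (by
    have := add_self_K (1 : L)
    linear_combination h - this)
  have hquad : x ^ 2 + x + 1 ∈ pw q 1 := by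
    obtain ⟨a, b, c, habc⟩ := hrep g hg
    rcases zmod_two_cases c with rfl | rfl
    · rw [zero_smul, add_zero] at habc
      refine absurd (hvan g ?_ hgq) hg0
      rw [habc]
      exact Submodule.add_mem _ (Submodule.smul_mem _ _ hone) (Submodule.smul_mem _ _ hx)
    · rw [one_smul] at habc
      rcases zmod_two_cases a with rfl | rfl
      · rcases zmod_two_cases b with rfl | rfl
        · rw [habc, zero_smul, zero_smul, zero_add, zero_add] at hgq
          exact absurd (hvan x hx (mem_pw_one_of_pow hgq)) hx01.1
        · rw [habc, zero_smul, one_smul, zero_add, show x + x ^ 2 = x * (x + 1) by ring] at hgq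
          rcases mem_pw_one_or hgq with h4 | h4
          · exact absurd (hvan x hx h4) hx01.1
          · exact absurd (hvan _ hx1 h4) hx10
      · rcases zmod_two_cases b with rfl | rfl
        · rw [habc, zero_smul, one_smul, add_zero, show 1 + x ^ 2 = (x + 1) ^ 2 - (x + x) by ring,
            add_self_K, sub_zero] at hgq
          exact absurd (hvan _ hx1 (mem_pw_one_of_pow hgq)) hx10
        · rwa [habc, one_smul, one_smul, show 1 + x + x ^ 2 = x ^ 2 + x + 1 by ring] at hgq
  refine ⟨x, hx, fun hxp => hx0 ?_, hquad, fun u hu => ⟨mem_of_mem_Lsp_single hqp hu, ?_⟩⟩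
  · rw [mem_Lsp]
    intro Q
    rw [Finsupp.zero_apply, neg_zero, mem_pw_zero]
    by_cases hQ : Q = p
    · rwa [hQ]
    · exact mem_of_mem_Lsp_single hQ hx
  · have hx4 : x ^ 4 - x ∈ pw q 1 := by
      rw [show x ^ 4 - x = (x * (x - 1)) * (x ^ 2 + x + 1) by ring]
      exact mul_mem_pw_one (mul_mem hxq (sub_mem hxq (one_mem _))) hquad
    have hx8 : (x ^ 2) ^ 4 - x ^ 2 ∈ pw q 1 := by
      rw [show (x ^ 2) ^ 4 - x ^ 2 = (x ^ 4 + x) * (x ^ 4 - x) by ring]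
      exact mul_mem_pw_one (add_mem (pow_mem hxq 4) hxq) hx4
    have hsub : ∀ y z : L, (y + z) ^ 4 = y ^ 4 + z ^ 4 := fun y z => by
      have := charP_K L
      exact add_pow_char_pow y z 2 2
    have hsm : ∀ a : 𝔽, ∀ y : L, y ^ 4 - y ∈ pw q 1 → (a • y) ^ 4 - a • y ∈ pw q 1 := by
      intro a y hy
      rcases zmod_two_cases a with rfl | rfl
      · rw [zero_smul, zero_pow (by norm_num), sub_zero]; exact Submodule.zero_mem _
      · rwa [one_smul]
    obtain ⟨a, b, c, rfl⟩ := hrep u hu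
    have h5 := Submodule.add_mem _ (Submodule.add_mem _
      (hsm a 1 (by rw [one_pow, sub_self]; exact Submodule.zero_mem _)) (hsm b x hx4)) (hsm c _ hx8)
    rw [hsub, hsub]
    convert h5 using 1
    ring

end Generator

section Form

lemma sq_add_self_surjective_on {k : Type*} [Field k] (h2 : (2 : k) = 0) (hk : ∀ x : k, x ^ 16 = x)
    (hex : ∃ u : k, u ^ 4 ≠ u) {ω d : k} (hω : ω ^ 2 + ω + 1 = 0) (hd : d ^ 4 = d) :
    ∃ r, r ^ 2 + r = d := by
  have h4 : d * (d - 1) * (d ^ 2 + d + 1) = 0 := by linear_combination hd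
  rcases mul_eq_zero.1 h4 with h5 | h5
  · rcases mul_eq_zero.1 h5 with h6 | h6
    · exact ⟨0, by rw [h6]; ring⟩
    · exact ⟨ω, by linear_combination hω - h6 - h2⟩
  · obtain ⟨u, hu⟩ := hex
    have hv : u + u ^ 4 ≠ 0 := fun h => hu (by linear_combination h - u * h2)
    have hv4 : (u + u ^ 4) ^ 4 = u + u ^ 4 := by
      have := hk u
      linear_combination this +
        (2 * u ^ 7 + 3 * u ^ 10 + 2 * u ^ 13) * h2
    set v := u + u ^ 4 with hvdef
    set s := u / v with hs
    have hs4 : s ^ 4 + s = 1 := by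
      rw [hs, div_pow, hv4, ← add_div, add_comm, ← hvdef, div_self hv]
    have he : (d - (s ^ 2 + s)) * (d - (s ^ 2 + s + 1)) = 0 := by
      linear_combination h5 + hs4 + (-d * (s ^ 2 + s) - d + s ^ 2 + s ^ 3) * h2
    rcases mul_eq_zero.1 he with h6 | h6
    · exact ⟨s, by linear_combination -h6⟩
    · exact ⟨s + ω, by linear_combination -h6 + hω + (s * ω - 1) * h2⟩

lemma exists_isotropic {k : Type*} [Field k] (h2 : (2 : k) = 0) (hk : ∀ x : k, x ^ 16 = x)
    (hex : ∃ u : k, u ^ 4 ≠ u) {ω A B C : k} (hω : ω ^ 2 + ω + 1 = 0) (hA : A ^ 4 = A)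
    (hB : B ^ 4 = B) (hC : C ^ 4 = C) :
    ∃ s t : k, (s ≠ 0 ∨ t ≠ 0) ∧ A * s ^ 2 + C * s * t + B * t ^ 2 = 0 := by
  by_cases hA0 : A = 0
  · exact ⟨1, 0, Or.inl one_ne_zero, by rw [hA0]; ring⟩
  by_cases hC0 : C = 0
  · refine ⟨B ^ 8, A ^ 8, Or.inr (pow_ne_zero 8 hA0), ?_⟩
    rw [hC0, ← pow_mul, ← pow_mul, hk, hk]
    linear_combination A * B * h2
  · obtain ⟨r, hr⟩ := sq_add_self_surjective_on h2 hk hex hω (d := A * B / C ^ 2) (by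
      rw [div_pow, mul_pow, hA, hB, ← pow_mul, mul_comm 2 4, pow_mul, hC])
    refine ⟨C / A * r, 1, Or.inr one_ne_zero, ?_⟩
    have h4 : A * (C / A * r) ^ 2 + C * (C / A * r) * 1 + B * 1 ^ 2 =
        C ^ 2 / A * (r ^ 2 + r) + B := by
      field_simp
    rw [h4, hr]
    field_simp
    linear_combination B * h2

variable {L : Type} [Field L] [Algebra 𝔽 L] [CongFF L]

lemma exists_isotropic_mod {q : Pl L} (hq : deg q = 4) {ω A B C : L} (hω : ω ∈ q.1)
    (hω' : ω ^ 2 + ω + 1 ∈ pw q 1) (hA : A ∈ q.1 ∧ A ^ 4 - A ∈ pw q 1)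
    (hB : B ∈ q.1 ∧ B ^ 4 - B ∈ pw q 1) (hC : C ∈ q.1 ∧ C ^ 4 - C ∈ pw q 1) :
    ∃ s ∈ q.1, ∃ t ∈ q.1, (s ∉ pw q 1 ∨ t ∉ pw q 1) ∧
      A * s ^ 2 + C * s * t + B * t ^ 2 ∈ pw q 1 := by
  let r := IsLocalRing.residue q.1
  have hr0 : ∀ x : q.1, r x = 0 ↔ (x : L) ∈ pw q 1 := fun x => by
    rw [← map_zero r, residue_eq_iff]
    show (x : L) - 0 ∈ _ ↔ _
    rw [sub_zero]
  have hr4 : ∀ x : q.1, (x : L) ^ 4 - x ∈ pw q 1 → r x ^ 4 = r x := fun x hx => by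
    rw [← map_pow, residue_eq_iff]
    exact hx
  have hex : ∃ u : IsLocalRing.ResidueField q.1, u ^ 4 ≠ u := by
    by_contra hcon
    push Not at hcon
    have : deg q ∣ 2 := deg_dvd_of_forall fun z hz => by
      have h1 := hcon (r ⟨z, hz⟩)
      rw [← map_pow, residue_eq_iff] at h1
      exact h1
    rw [hq] at this
    norm_num at this
  have h2 : (2 : IsLocalRing.ResidueField q.1) = 0 := by
    have h1 : r (1 + 1) = 0 := (hr0 _).2 (by
      show (1 : L) + 1 ∈ _
      rw [add_self_K]
      exact Submodule.zero_mem _)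
    rw [map_add, map_one] at h1
    rw [← h1]
    norm_num
  have hk : ∀ x : IsLocalRing.ResidueField q.1, x ^ 16 = x := fun x => by
    obtain ⟨y, rfl⟩ := IsLocalRing.residue_surjective x
    rw [← map_pow, residue_eq_iff]
    have := pow_card_sub_mem q y.2
    rwa [hq] at this
  obtain ⟨s, t, hst, hform⟩ := exists_isotropic h2 hk hex (ω := r ⟨ω, hω⟩) (A := r ⟨A, hA.1⟩)
    (B := r ⟨B, hB.1⟩) (C := r ⟨C, hC.1⟩) (by
      rw [← map_pow, ← map_add, ← map_one r, ← map_add, hr0]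
      exact hω') (hr4 _ hA.2) (hr4 _ hB.2) (hr4 _ hC.2)
  obtain ⟨s, rfl⟩ := IsLocalRing.residue_surjective s
  obtain ⟨t, rfl⟩ := IsLocalRing.residue_surjective t
  refine ⟨s, s.2, t, t.2, ?_, ?_⟩
  · rw [← hr0, ← hr0]
    exact hst
  · change r _ * r _ ^ 2 + r _ * r _ * r _ + r _ * r _ ^ 2 = 0 at hform
    rw [← map_pow, ← map_pow, ← map_mul, ← map_mul, ← map_mul, ← map_mul, ← map_add, ← map_add,
      hr0] at hform
    exact hform

end Form

section TraceZero

variable {K : Type} [Field K] [Algebra 𝔽 K] {E : IntermediateField 𝔽 K} [GenusFour K] [PosGenus E]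
  [FiniteDimensional E K] [Algebra.IsSeparable E K] {q p : Pl E} {P P' : Pl K}

/-- Functions of trace zero in the pullback of the Riemann-Roch space of `p`. -/
def traceZero (E : IntermediateField 𝔽 K) [CongFF E] [FiniteDimensional E K] (p : Pl E) :
    Submodule 𝔽 K :=
  Lsp (con E (Finsupp.single p 1)) ⊓
    LinearMap.ker ((Algebra.trace E K).restrictScalars 𝔽)

lemma mem_traceZero {z : K} : z ∈ traceZero E p ↔
    z ∈ Lsp (con E (Finsupp.single p 1)) ∧ Algebra.trace E K z = 0 := by
  rw [traceZero, Submodule.mem_inf, LinearMap.mem_ker, LinearMap.restrictScalars_apply]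

lemma exists_pair_traceZero (h3 : Module.finrank E K = 3) (hp : deg p = 2)
    (h1 : el (Finsupp.single p 1 : Dv E) = 2) :
    ∃ z₁ ∈ traceZero E p, ∃ z₂ ∈ traceZero E p, z₁ ≠ 0 ∧ z₂ ≠ 0 ∧ z₁ + z₂ ≠ 0 := by
  have hel : el (con E (Finsupp.single p 1)) = 4 := by
    have hdeg : degD (con E (Finsupp.single p 1)) = 6 := by
      rw [degD_con, degD_single, h3, hp]; norm_num
    have := el_duality (D := con E (Finsupp.single p 1)) (D' := 0) (by rw [hdeg, map_zero]; rfl)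
    rw [hdeg, el_zero] at this
    omega
  let f : Lsp (con E (Finsupp.single p 1)) →ₗ[𝔽] Lsp (Finsupp.single p 1 : Dv E) :=
    LinearMap.restrict ((Algebra.trace E K).restrictScalars 𝔽) fun z hz => trace_mem_Lsp E hz
  have hf := LinearMap.finrank_range_add_finrank_ker f
  have hr := Submodule.finrank_le (LinearMap.range f)
  rw [← el_eq, h1] at hr
  rw [← el_eq, hel] at hf
  have : Nontrivial (LinearMap.ker f) := Module.nontrivial_of_finrank_pos (R := 𝔽) (by omega)
  obtain ⟨a, ha⟩ := exists_ne (0 : LinearMap.ker f)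
  obtain ⟨b, hab⟩ := exists_linearIndependent_pair_of_one_lt_finrank (R := 𝔽)
    (M := LinearMap.ker f) (by omega) ha
  have hmem : ∀ c : LinearMap.ker f, ((c : Lsp (con E (Finsupp.single p 1))) : K) ∈
      traceZero E p := fun c =>
    mem_traceZero.2 ⟨c.1.2, congrArg Subtype.val (LinearMap.mem_ker.1 c.2)⟩
  have hne : ∀ c : LinearMap.ker f, c ≠ 0 → ((c : Lsp (con E (Finsupp.single p 1))) : K) ≠ 0 :=
    fun c hc h => hc (Subtype.ext (Subtype.ext h))
  have hb : b ≠ 0 := hab.ne_zero 1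
  have hab' : a + b ≠ 0 := fun h0 => by
    have := LinearIndependent.pair_iff.1 hab 1 1 (by rw [one_smul, one_smul, h0])
    exact one_ne_zero this.1
  exact ⟨_, hmem a, _, hmem b, hne a ha, hne b hb, hne (a + b) hab'⟩

variable (h : IsPair E q P P') (h3 : Module.finrank E K = 3) (hqp : q ≠ p)

include h h3 hqp

omit h3 in
lemma IsPair.mem_of_Lsp {n : ℤ} {z : K} (hz : z ∈ Lsp (con E (Finsupp.single p n))) :
    z ∈ P.1 ∧ z ∈ P'.1 := by
  have h1 := mem_Lsp.1 hz
  have hP := h1 P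
  have hP' := h1 P'
  rw [con_apply, h.res_fst, Finsupp.single_eq_of_ne hqp, mul_zero, neg_zero, mem_pw_zero] at hP
  rw [con_apply, h.res_snd, Finsupp.single_eq_of_ne hqp, mul_zero, neg_zero, mem_pw_zero] at hP'
  exact ⟨hP, hP'⟩

lemma IsPair.esymmTwo_not_mem (hp : deg p = 2) {z : K} (hz : z ∈ traceZero E p) (hz0 : z ≠ 0) :
    esymmTwo E z ∉ pw q 1 := by
  intro he
  obtain ⟨hzL, ht⟩ := mem_traceZero.1 hz
  obtain ⟨hzP, hzP'⟩ := h.mem_of_Lsp hqp hzL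
  have h1 := (h.mem_pw_one h3 hzP hzP' (by rw [ht]; exact Submodule.zero_mem _) he).1
  have h2 : z ∈ Lsp (con E (Finsupp.single p 1) - Finsupp.single P 1) := by
    refine mem_Lsp_sub_single ?_ hzL h1
    rw [con_apply, h.res_fst, Finsupp.single_eq_of_ne hqp, mul_zero]
  have h4 : degD (con E (Finsupp.single p 1) - Finsupp.single P 1) = 2 := by
    rw [map_sub, degD_con, degD_single, degD_single, h3, hp, h.deg_fst]; norm_num
  have h5 := el_eq_zero (D := con E (Finsupp.single p 1) - Finsupp.single P 1)
    (by omega) (by omega)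
  rw [el_eq, Submodule.finrank_eq_zero] at h5
  rw [h5] at h2
  exact hz0 h2

omit h hqp in
lemma esymmTwo_mem_Lsp {z : K} (hz : z ∈ Lsp (con E (Finsupp.single p 1))) :
    esymmTwo E z ∈ Lsp (Finsupp.single p 2) := by
  rw [mem_Lsp]
  intro p'
  have h1 := esymmTwo_mem_pw E h3 (p := p') (-(Finsupp.single p 1 : Dv E) p') fun Q hQ => by
    have := mem_Lsp.1 hz Q
    rwa [con_apply, (mem_abv E).1 hQ, ← mul_neg] at this
  have h2 : (Finsupp.single p 2 : Dv E) p' = 2 * (Finsupp.single p 1 : Dv E) p' := by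
    rw [show (2 : ℤ) = 1 + 1 by norm_num, Finsupp.single_add, Finsupp.add_apply]; ring
  rwa [mul_neg, ← h2] at h1

omit h h3 hqp in
lemma mul_mem_Lsp_con_two {z w : K} (hz : z ∈ Lsp (con E (Finsupp.single p 1)))
    (hw : w ∈ Lsp (con E (Finsupp.single p 1))) :
    z * w ∈ Lsp (con E (Finsupp.single p 2)) := by
  have := mul_mem_Lsp hz hw
  rwa [← map_add, ← Finsupp.single_add] at this

/-- A combination of trace zero functions on which the second symmetric function vanishes
reduces to zero. -/
lemma IsPair.comb_mem {z₁ z₂ : K} (hz₁ : z₁ ∈ traceZero E p) (hz₂ : z₂ ∈ traceZero E p) {s t : E}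
    (hs : s ∈ q.1) (ht : t ∈ q.1)
    (hst : esymmTwo E z₁ * s ^ 2 + Algebra.trace E K (z₁ * z₂) * s * t + esymmTwo E z₂ * t ^ 2 ∈
      pw q 1) :
    s • z₁ + t • z₂ ∈ pw P 1 ∧ s • z₁ + t • z₂ ∈ pw P' 1 := by
  obtain ⟨hL₁, ht₁⟩ := mem_traceZero.1 hz₁
  obtain ⟨hL₂, ht₂⟩ := mem_traceZero.1 hz₂
  obtain ⟨hP₁, hP'₁⟩ := h.mem_of_Lsp hqp hL₁
  obtain ⟨hP₂, hP'₂⟩ := h.mem_of_Lsp hqp hL₂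
  have htr : Algebra.trace E K (s • z₁ + t • z₂) = 0 := by
    rw [map_add, map_smul, map_smul, ht₁, ht₂, smul_zero, smul_zero, add_zero]
  refine h.mem_pw_one h3 ?_ ?_ (by rw [htr]; exact Submodule.zero_mem _) ?_
  · rw [Algebra.smul_def, Algebra.smul_def]
    exact add_mem (mul_mem (h.coe_mem_fst.2 hs) hP₁) (mul_mem (h.coe_mem_fst.2 ht) hP₂)
  · rw [Algebra.smul_def, Algebra.smul_def]
    exact add_mem (mul_mem (h.coe_mem_snd.2 hs) hP'₁) (mul_mem (h.coe_mem_snd.2 ht) hP'₂)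
  · convert hst using 1
    rw [esymmTwo_add E h3, esymmTwo_smul E h3, esymmTwo_smul E h3, map_smul, ht₁, smul_zero,
      zero_mul, add_zero, smul_mul_smul_comm, map_smul, smul_eq_mul]
    linear_combination -(add_self_K (s * t * Algebra.trace E K (z₁ * z₂)))

/-- The trace form takes a vanishing value on a pair of trace zero functions. -/
lemma IsPair.trace_mul_mem {z₁ z₂ : K} (hz₁ : z₁ ∈ traceZero E p) (hz₂ : z₂ ∈ traceZero E p)
    {x : E} (hx : x ∈ q.1) (hx' : x ^ 2 + x + 1 ∈ pw q 1)
    (hval : ∀ u ∈ Lsp (Finsupp.single p 2 : Dv E), u ∈ q.1 ∧ u ^ 4 - u ∈ pw q 1) :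
    Algebra.trace E K (z₁ * z₂) ∈ pw q 1 := by
  obtain ⟨hL₁, ht₁⟩ := mem_traceZero.1 hz₁
  obtain ⟨hL₂, ht₂⟩ := mem_traceZero.1 hz₂
  obtain ⟨hP₁, hP'₁⟩ := h.mem_of_Lsp hqp hL₁
  obtain ⟨hP₂, hP'₂⟩ := h.mem_of_Lsp hqp hL₂
  obtain ⟨s, hs, t, ht, hne, hform⟩ := exists_isotropic_mod h.deg_base hx hx'
    (hval _ (esymmTwo_mem_Lsp h3 hL₁)) (hval _ (esymmTwo_mem_Lsp h3 hL₂))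
    (hval _ (trace_mem_Lsp E (mul_mem_Lsp_con_two hL₁ hL₂)))
  obtain ⟨hθ, hθ'⟩ := h.comb_mem h3 hqp hz₁ hz₂ hs ht hform
  have h1 := trace_mem_max E (h.forall (mul_mem_pw_one' hθ hP₁) (mul_mem_pw_one' hθ' hP'₁))
  have h2 := trace_mem_max E (h.forall (mul_mem_pw_one' hθ hP₂) (mul_mem_pw_one' hθ' hP'₂))
  rw [add_mul, smul_mul_assoc, smul_mul_assoc, map_add, map_smul, map_smul, ← sq, trace_sq, ht₁,
    zero_pow two_ne_zero, smul_zero, zero_add, smul_eq_mul, mul_comm z₂] at h1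
  rw [add_mul, smul_mul_assoc, smul_mul_assoc, map_add, map_smul, map_smul, ← sq, trace_sq, ht₂,
    zero_pow two_ne_zero, smul_zero, add_zero, smul_eq_mul] at h2
  rcases hne with h4 | h4
  · exact (mem_pw_one_or h2).resolve_left h4
  · exact (mem_pw_one_or h1).resolve_left h4

end TraceZero

section Contradiction

variable {K : Type} [Field K] [Algebra 𝔽 K] {E : IntermediateField 𝔽 K} [GenusFour K] [PosGenus E]
  [FiniteDimensional E K] [Algebra.IsSeparable E K] {q p : Pl E} {P P' : Pl K}

lemma dv_eq_of_vanishing {L : Type} [Field L] [Algebra 𝔽 L] [CongFF L] {p q : Pl L}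
    (hp : deg p = 2) (hq : deg q = 4) {g : L} (hg0 : g ≠ 0) (hg : g ∈ Lsp (Finsupp.single p 2))
    (hgq : g ∈ pw q 1) : dv g = Finsupp.single q 1 - Finsupp.single p 2 := by
  have hqp : q ≠ p := by
    rintro rfl
    omega
  have h1 := (mem_Lsp_of_ne hg0).1
    (mem_Lsp_sub_single (Finsupp.single_eq_of_ne hqp : (Finsupp.single p 2 : Dv L) q = 0) hg hgq)
  have h2 := eq_zero_of_degD h1 (by
    rw [map_add, map_sub, degD_dv, degD_single, degD_single, hp, hq]; norm_num)
  rw [eq_neg_of_add_eq_zero_left h2, neg_sub]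

variable (h : IsPair E q P P') (h3 : Module.finrank E K = 3) (hp : deg p = 2)

include h h3 hp

lemma IsPair.no_generator {g : E} (hg0 : g ≠ 0) (hg : g ∈ Lsp (Finsupp.single p 2))
    (hgq : g ∈ pw q 1) {z₁ z₂ : K} (hz₁ : z₁ ∈ traceZero E p) (hz₂ : z₂ ∈ traceZero E p)
    (hz₁0 : z₁ ≠ 0) (hC : Algebra.trace E K (z₁ * z₂) ∈ pw q 1) {ξ : E}
    (hξ : ξ ∈ Lsp (Finsupp.single p 1)) (hξp : ξ ∉ p.1)
    (hform : esymmTwo E z₁ * ξ ^ 2 + esymmTwo E z₂ ∈ pw q 1) : False := by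
  have hqp : q ≠ p := by
    rintro rfl
    have := h.deg_base
    omega
  have hξq := mem_of_mem_Lsp_single hqp hξ
  have hξ0 : ξ ≠ 0 := by
    rintro rfl
    exact hξp (zero_mem _)
  have hξ0' : (ξ : K) ≠ 0 := fun h => hξ0 (Subtype.ext h)
  obtain ⟨hL₁, ht₁⟩ := mem_traceZero.1 hz₁
  obtain ⟨hL₂, ht₂⟩ := mem_traceZero.1 hz₂
  obtain ⟨hθ, hθ'⟩ := h.comb_mem h3 hqp hz₁ hz₂ hξq (one_mem _) (by
    rw [mul_one, one_pow, mul_one, add_right_comm]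
    exact Submodule.add_mem _ hform (mul_mem_pw_one' hC hξq))
  set θ := ξ • z₁ + (1 : E) • z₂ with hθdef
  have hθeq : θ = (ξ : K) * z₁ + z₂ := by
    rw [hθdef, one_smul, Algebra.smul_def]; rfl
  have htr : Algebra.trace E K θ = 0 := by
    rw [hθdef, map_add, map_smul, map_smul, ht₁, ht₂, smul_zero, smul_zero, add_zero]
  have hθL : θ ∈ Lsp (con E (Finsupp.single p 2)) := by
    rw [hθeq]
    refine Submodule.add_mem _ (mul_mem_Lsp_con_two ((mem_Lsp_con E).2 hξ) hL₁) ?_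
    have := mul_mem_Lsp_con_two hL₂ ((mem_Lsp_con E).2 (one_mem_Lsp_single p))
    rwa [show ((1 : E) : K) = 1 from rfl, mul_one] at this
  have hg0' : (g : K) ≠ 0 := fun h => hg0 (Subtype.ext h)
  have hdv := dv_eq_of_vanishing hp h.deg_base hg0 hg hgq
  have hord : ∀ Q, θ ∈ pw Q (ord Q (g : K)) := fun Q => by
    rw [ord_coe, ← dv_apply, hdv, Finsupp.sub_apply]
    by_cases hQ : res E Q = q
    · rw [hQ, Finsupp.single_eq_same, Finsupp.single_eq_of_ne hqp]
      rcases (h.mem_abv_iff Q).1 ((mem_abv E).2 hQ) with rfl | rfl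
      · rw [h.ram_fst]; exact hθ
      · rw [h.ram_snd]; exact hθ'
    · rw [Finsupp.single_eq_of_ne hQ, zero_sub, mul_neg, ← con_apply]
      exact mem_Lsp.1 hθL Q
  have hquot : θ * (g : K)⁻¹ ∈ Lsp (0 : Dv K) := by
    rw [mem_Lsp]
    intro Q
    have := pw_mul (hord Q) (mem_pw_ord Q (g : K)⁻¹)
    rwa [ord_inv, add_neg_cancel] at this
  rcases mem_Lsp_zero.1 hquot with h4 | h4
  · have hz : (ξ : K) * z₁ + z₂ = 0 := by
      rw [← hθeq]
      exact (mul_eq_zero.1 h4).resolve_right (inv_ne_zero hg0')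
    have hz₁' : z₁ ∈ Lsp (0 : Dv K) := by
      rw [mem_Lsp]
      intro Q
      have h5 := mem_Lsp.1 hL₁ Q
      have h6 := mem_Lsp.1 hL₂ Q
      rw [con_apply] at h5 h6
      by_cases hQ : res E Q = p
      · rw [hQ, Finsupp.single_eq_same] at h6
        have h7 : ξ⁻¹ ∈ pw p 1 := by
          rw [mem_iff_ord p hξ0, not_le] at hξp
          rw [mem_pw_of_ne (inv_ne_zero hξ0), ord_inv]
          omega
        rw [← hQ, ← coe_mem_pw] at h7
        have h8 := pw_mul h7 (Submodule.neg_mem _ h6)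
        have h9 : ((ξ⁻¹ : E) : K) * -z₂ = z₁ := by
          rw [← eq_neg_of_add_eq_zero_left hz]
          exact inv_mul_cancel_left₀ hξ0' z₁
        rwa [h9, add_neg_cancel] at h8
      · rwa [Finsupp.single_eq_of_ne hQ, mul_zero] at h5
    rcases mem_Lsp_zero.1 hz₁' with h5 | h5
    · exact hz₁0 h5
    · have := trace_coe h3 (1 : E)
      rw [show ((1 : E) : K) = z₁ from h5.symm, ht₁] at this
      exact zero_ne_one this
  · have h5 : θ = (g : K) := eq_of_div_eq_one (by rwa [div_eq_mul_inv])
    rw [h5, trace_coe h3] at htr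
    exact hg0 htr

end Contradiction

theorem finrank_lt_two {K : Type} [Field K] [Algebra 𝔽 K] (E : IntermediateField 𝔽 K) [GenusFour K]
    [PosGenus E] [FiniteDimensional E K] [Algebra.IsSeparable E K] : Module.finrank E K < 2 := by
  by_contra hn
  obtain ⟨h3, -, hram, p, R, hp, -, -, hel1, hel2⟩ := exists_inert E (not_lt.1 hn)
  obtain ⟨q, P, P', h⟩ := exists_isPair E h3 hram
  obtain ⟨g, hg0, hg, hgq⟩ := h.exists_vanishing h3 hp
  obtain ⟨x, hx, hxp, hquad, hval⟩ := exists_generator hp h.deg_base hel1 hel2 hg0 hg hgq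
  have hqp : q ≠ p := by
    rintro rfl
    have := h.deg_base
    omega
  have hxq := mem_of_mem_Lsp_single hqp hx
  obtain ⟨z₁, hz₁, z₂, hz₂, hz₁0, hz₂0, hz0⟩ := exists_pair_traceZero (E := E) h3 hp hel1
  have hC := h.trace_mul_mem h3 hqp hz₁ hz₂ hxq hquad hval
  have hA0 := h.esymmTwo_not_mem h3 hqp hp hz₁ hz₁0
  have hB0 := h.esymmTwo_not_mem h3 hqp hp hz₂ hz₂0
  have hAB0 := h.esymmTwo_not_mem h3 hqp hp (Submodule.add_mem _ hz₁ hz₂) hz0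
  rw [esymmTwo_add E h3, (mem_traceZero.1 hz₁).2, zero_mul, add_zero] at hAB0
  obtain ⟨hAq, hA4⟩ := hval _ (esymmTwo_mem_Lsp h3 (mem_traceZero.1 hz₁).1)
  obtain ⟨hBq, hB4⟩ := hval _ (esymmTwo_mem_Lsp h3 (mem_traceZero.1 hz₂).1)
  have hno := fun ξ => h.no_generator h3 hp hg0 hg hgq hz₁ hz₂ hz₁0 hC (ξ := ξ)
  set A := esymmTwo E z₁
  set B := esymmTwo E z₂
  have h2 : (2 : E) = 0 := by
    have := add_self_K (1 : E)
    linear_combination this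
  have hA3 : A ^ 3 - 1 ∈ pw q 1 := by
    rw [show A ^ 4 - A = (A ^ 3 - 1) * A by ring] at hA4
    exact mem_pw_one_of_mul hA4 hA0
  have hB3 : B ^ 3 - 1 ∈ pw q 1 := by
    rw [show B ^ 4 - B = (B ^ 3 - 1) * B by ring] at hB4
    exact mem_pw_one_of_mul hB4 hB0
  set y := A * B ^ 2 with hy
  have hyq : y ∈ q.1 := mul_mem hAq (pow_mem hBq 2)
  have hy2 : ∀ ξ : E, ξ ∈ q.1 → ξ - y ∈ pw q 1 → A * ξ ^ 2 + B ∈ pw q 1 := fun ξ hξq hξ => by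
    have h4 : A * ξ ^ 2 + B = A * (ξ + y) * (ξ - y) + B ^ 4 * (A ^ 3 - 1) + B * (B ^ 3 - 1) := by
      rw [hy]
      linear_combination B * h2
    rw [h4]
    exact Submodule.add_mem _ (Submodule.add_mem _
      (mul_mem_pw_one (mul_mem hAq (add_mem hξq hyq)) hξ) (mul_mem_pw_one (pow_mem hBq 4) hA3))
      (mul_mem_pw_one hBq hB3)
  have hy3 : y ^ 3 - 1 ∈ pw q 1 := by
    rw [show y ^ 3 - 1 = B ^ 6 * (A ^ 3 - 1) + (B ^ 3 + 1) * (B ^ 3 - 1) by rw [hy]; ring]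
    exact Submodule.add_mem _ (mul_mem_pw_one (pow_mem hBq 6) hA3)
      (mul_mem_pw_one (add_mem (pow_mem hBq 3) (one_mem _)) hB3)
  rw [show y ^ 3 - 1 = (1 - y) * -(y ^ 2 + y + 1) by ring] at hy3
  rcases mem_pw_one_or hy3 with h4 | h4
  · refine hAB0 (Submodule.sub_mem _ ?_ hC)
    have := hy2 1 (one_mem _) h4
    rwa [one_pow, mul_one] at this
  · have h5 : (x - y) * (x + 1 - y) ∈ pw q 1 := by
      have := Submodule.sub_mem _ hquad h4
      rw [show x ^ 2 + x + 1 - -(y ^ 2 + y + 1) = (x - y) * (x + 1 - y) + 2 * (1 + y + x * y) by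
        ring, h2, zero_mul, add_zero] at this
      exact this
    rcases mem_pw_one_or h5 with h6 | h6
    · exact hno x hx hxp (hy2 x hxq h6)
    · refine hno (x + 1) (Submodule.add_mem _ hx (one_mem_Lsp_single p)) (fun h7 => hxp ?_)
        (hy2 _ (add_mem hxq (one_mem _)) h6)
      have := sub_mem h7 (one_mem p.1)
      rwa [add_sub_cancel_right] at this

end CFF

open CFF in
/-- In a congruence function field over `𝔽₂` of genus `4` and class number `1`,
every proper intermediate field `𝔽₂ ⊊ E ⊊ K` with `K/E` separable has
genus `0`. -/
theorem proper_subfield_has_genus_zero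
    (K : Type) [Field K] [Algebra (ZMod 2) K]
    (hFF : IsFunctionField (ZMod 2) K)
    (hconst : HasExactConstants (ZMod 2) K)
    (hg : genus (ZMod 2) K = 4)
    (hh : classNumber (ZMod 2) K = 1)
    (E : IntermediateField (ZMod 2) K)
    (hbot : E ≠ ⊥) (htop : E ≠ ⊤)
    (hsep : Algebra.IsSeparable E K) :
    genus (ZMod 2) E = 0 := by
  by_contra hgE
  have hK : CongFF K := ⟨hFF, hconst⟩
  have hK1 : PosGenus K := { hK with genus_ne := by rw [hg]; norm_num }
  have hK2 : GenusFour K := { hK1 with genus_eq := hg, classNumber_eq := hh }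
  obtain ⟨y, hyE, hy⟩ := SetLike.not_le_iff_exists.1 fun hle => hbot (le_bot_iff.1 hle)
  have hy' : Transcendental (ZMod 2) y := transcendental_iff.2
    ⟨by rintro rfl; exact hy (zero_mem _), by rintro rfl; exact hy (one_mem _)⟩
  obtain ⟨hE, hfin⟩ := congFF_intermediate (y := (⟨y, hyE⟩ : E)) hy'
  have hE1 : PosGenus E := { hE with genus_ne := hgE }
  have hlt := finrank_lt_two E
  have hpos : 0 < Module.finrank E K := Module.finrank_pos
  exact htop (IntermediateField.finrank_eq_one_iff_eq_top.1 (by omega))
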